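/- Let Ω ⊂ ℝ^N (N ≥ 2) be a smooth bounded domain, assume (S1), (P1), (μ1), let q ∈ C₊(ℝ^N×ℝ^N) satisfy 2/q(x,y) + μ(x,y)/N = 2, and let f satisfy (F1) and (F2). Then for every c ∈ ℝ, the functional J satisfies the Palais–Smale condition at level c: every sequence (u_m) ⊂ X₀ with J(u_m) → c and ‖J′(u_m)‖_{X₀*} → 0 (i.e., sup{|⟨J′(u_m),w⟩| : w ∈ X₀, ‖w‖_{X₀} ≤ 1} → 0) possesses a subsequence converging strongly in X₀. -/

import Mathlib

open MeasureTheory Set Filter ENNReal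

noncomputable section

namespace VarOrderChoquard

variable {N : ℕ}

/-- `ℝ^N` with the Euclidean structure. -/
abbrev RN (N : ℕ) := EuclideanSpace ℝ (Fin N)

/-- `Φ⁻` : infimum of a two-variable real function over `ℝ^N × ℝ^N`. -/
def inf2 (f : RN N → RN N → ℝ) : ℝ := sInf {t | ∃ x y, f x y = t}

/-- `Φ⁺` : supremum of a two-variable real function over `ℝ^N × ℝ^N`. -/
def sup2 (f : RN N → RN N → ℝ) : ℝ := sSup {t | ∃ x y, f x y = t}

/-- `Φ⁻` over a subset `D ⊆ ℝ^N`. -/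
def infOn (D : Set (RN N)) (g : RN N → ℝ) : ℝ := sInf (g '' D)

/-- `Φ⁺` over a subset `D ⊆ ℝ^N`. -/
def supOn (D : Set (RN N)) (g : RN N → ℝ) : ℝ := sSup (g '' D)

/-- `C₊(ℝ^N × ℝ^N)` : continuous with `1 < Φ⁻ ≤ Φ⁺ < ∞`. -/
def CPlus2 (f : RN N → RN N → ℝ) : Prop :=
  Continuous (fun z : RN N × RN N => f z.1 z.2) ∧ 1 < inf2 f ∧
    BddAbove {t | ∃ x y, f x y = t}

/-- `C₊(D)` for `D ⊆ ℝ^N`. -/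
def CPlusOn (D : Set (RN N)) (g : RN N → ℝ) : Prop :=
  ContinuousOn g D ∧ 1 < infOn D g ∧ BddAbove (g '' D)

/-- Condition (S1). -/
def S1 (s : RN N → RN N → ℝ) : Prop :=
  Continuous (fun z : RN N × RN N => s z.1 z.2) ∧ (∀ x y, s x y = s y x) ∧
    BddAbove {t | ∃ x y, s x y = t} ∧ 0 < inf2 s ∧ sup2 s < 1

/-- Condition (P1). -/
def P1 (s p : RN N → RN N → ℝ) : Prop :=
  CPlus2 p ∧ (∀ x y, p x y = p y x) ∧ sup2 s * sup2 p < N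

/-- Condition (μ1). -/
def Mu1 (μ : RN N → RN N → ℝ) : Prop :=
  (∀ x y, μ x y = μ y x) ∧ BddAbove {t | ∃ x y, μ x y = t} ∧
    0 < inf2 μ ∧ sup2 μ < N

/-- The critical exponent `p_s*(x) = N p(x,x) / (N - s(x,x) p(x,x))`. -/
def pstar (s p : RN N → RN N → ℝ) (x : RN N) : ℝ :=
  N * p x x / (N - s x x * p x x)

/-- The class `𝓜` : `p(x,x) ≤ r(x)q⁻ ≤ r(x)q⁺ < p_s*(x)` for all `x`. -/
def MemM (s p q : RN N → RN N → ℝ) (r : RN N → ℝ) : Prop :=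
  ∀ x, p x x ≤ r x * inf2 q ∧ r x * inf2 q ≤ r x * sup2 q ∧
    r x * sup2 q < pstar s p x

/-- Variable-exponent modular `∫_U |u/l|^{γ(x)} dx`. -/
def lmodular (U : Set (RN N)) (γ : RN N → ℝ) (u : RN N → ℝ) (l : ℝ) : ℝ≥0∞ :=
  ∫⁻ x in U, ENNReal.ofReal (|u x| / l) ^ γ x

/-- Membership in the variable-exponent Lebesgue space `L^{γ(x)}(U)`. -/
def MemVarLp (U : Set (RN N)) (γ : RN N → ℝ) (u : RN N → ℝ) : Prop :=
  Measurable u ∧ ∃ l, 0 < l ∧ lmodular U γ u l < ⊤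

/-- Luxemburg norm on `L^{γ(x)}(U)`. -/
def luxNorm (U : Set (RN N)) (γ : RN N → ℝ) (u : RN N → ℝ) : ℝ :=
  sInf {l | 0 < l ∧ lmodular U γ u l ≤ 1}

/-- Membership in the classical Lebesgue space `L^t(U)` (constant exponent `t`). -/
def MemCLp (U : Set (RN N)) (t : ℝ) (g : RN N → ℝ) : Prop :=
  Measurable g ∧ (∫⁻ x in U, ENNReal.ofReal |g x| ^ t) < ⊤

/-- The classical `L^t(U)`-norm. -/
def cLpNorm (U : Set (RN N)) (t : ℝ) (g : RN N → ℝ) : ℝ :=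
  (∫⁻ x in U, ENNReal.ofReal |g x| ^ t).toReal ^ (1 / t)

/-- Gagliardo-type modular
`∫_A (|u(x)-u(y)|/l)^{p(x,y)} / |x-y|^{N+s(x,y)p(x,y)} dx dy`. -/
def gmodular (A : Set (RN N × RN N)) (s p : RN N → RN N → ℝ) (u : RN N → ℝ)
    (l : ℝ) : ℝ≥0∞ :=
  ∫⁻ z in A, ENNReal.ofReal (|u z.1 - u z.2| / l) ^ p z.1 z.2 /
    ENNReal.ofReal (dist z.1 z.2) ^ ((N : ℝ) + s z.1 z.2 * p z.1 z.2)

/-- Membership in `W^{s(x,y),β(x),p(x,y)}(U)`. -/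
def MemW (U : Set (RN N)) (s p : RN N → RN N → ℝ) (β : RN N → ℝ)
    (u : RN N → ℝ) : Prop :=
  MemVarLp U β u ∧ ∃ l, 0 < l ∧ gmodular (U ×ˢ U) s p u l < ⊤

/-- The Gagliardo seminorm `[u]_U^{s,p}`. -/
def wSeminorm (U : Set (RN N)) (s p : RN N → RN N → ℝ) (u : RN N → ℝ) : ℝ :=
  sInf {l | 0 < l ∧ gmodular (U ×ˢ U) s p u l < 1}

/-- The norm on `W`. -/
def wNorm (U : Set (RN N)) (s p : RN N → RN N → ℝ) (β : RN N → ℝ)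
    (u : RN N → ℝ) : ℝ :=
  luxNorm U β u + wSeminorm U s p u

/-- `Q = (ℝ^N × ℝ^N) \ (Ωᶜ × Ωᶜ)`. -/
def Qset (Ω : Set (RN N)) : Set (RN N × RN N) := univ \ (Ωᶜ ×ˢ Ωᶜ)

/-- Membership in `X₀`. -/
def MemX0 (Ω : Set (RN N)) (s p : RN N → RN N → ℝ) (β : RN N → ℝ)
    (u : RN N → ℝ) : Prop :=
  Measurable u ∧ MemVarLp Ω β u ∧ (∃ l, 0 < l ∧ gmodular (Qset Ω) s p u l < ⊤) ∧
    (∀ᵐ x, x ∉ Ω → u x = 0)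

/-- The `X₀`-norm. -/
def x0Norm (s p : RN N → RN N → ℝ) (u : RN N → ℝ) : ℝ :=
  sInf {l | 0 < l ∧ gmodular univ s p u l < 1}

/-- The modular `ρ_{X₀}`. -/
def rhoX0 (s p : RN N → RN N → ℝ) (u : RN N → ℝ) : ℝ≥0∞ :=
  gmodular univ s p u 1

/-- Carathéodory function. -/
def Caratheodory (f : RN N → ℝ → ℝ) : Prop :=
  (∀ t, Measurable fun x => f x t) ∧ ∀ x, Continuous fun t => f x t

/-- `F(x,t) = ∫₀ᵗ f(x,τ) dτ`. -/
def Fant (f : RN N → ℝ → ℝ) (x : RN N) (t : ℝ) : ℝ := ∫ τ in (0:ℝ)..t, f x τ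

/-- Growth condition (F1) (with data `M` and `r`). -/
def F1 (Ω : Set (RN N)) (f : RN N → ℝ → ℝ) (M : ℝ) (r : RN N → ℝ) : Prop :=
  0 < M ∧ ∀ x ∈ Ω, ∀ t : ℝ, |f x t| ≤ M * |t| ^ (r x - 1)

/-- Ambrosetti–Rabinowitz type condition (F2) (with data `Θ`). -/
def F2 (Ω : Set (RN N)) (f : RN N → ℝ → ℝ) (Θ : ℝ) : Prop :=
  ∀ᵐ x, x ∈ Ω → ∀ t : ℝ, t ≠ 0 →
    0 < Θ * Fant f x t ∧ Θ * Fant f x t ≤ 2 * (t * f x t)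

/-- The left-hand side pairing
`∫∫ |u(x)-u(y)|^{p-2}(u(x)-u(y))(w(x)-w(y)) / |x-y|^{N+sp} dx dy`. -/
def energyLHS (s p : RN N → RN N → ℝ) (u w : RN N → ℝ) : ℝ :=
  ∫ z : RN N × RN N,
    |u z.1 - u z.2| ^ (p z.1 z.2 - 2) * (u z.1 - u z.2) * (w z.1 - w z.2) /
      dist z.1 z.2 ^ ((N : ℝ) + s z.1 z.2 * p z.1 z.2)

/-- The Choquard right-hand side `∫_Ω ∫_Ω F(x,u(x)) f(y,u(y)) w(y) / |x-y|^μ`. -/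
def choquardRHS (Ω : Set (RN N)) (μ : RN N → RN N → ℝ) (f : RN N → ℝ → ℝ)
    (u w : RN N → ℝ) : ℝ :=
  ∫ x in Ω, ∫ y in Ω, Fant f x (u x) * f y (u y) * w y / dist x y ^ μ x y

/-- The energy functional `J`. -/
def Jfun (Ω : Set (RN N)) (s p μ : RN N → RN N → ℝ) (f : RN N → ℝ → ℝ)
    (u : RN N → ℝ) : ℝ :=
  (∫ z : RN N × RN N,
    |u z.1 - u z.2| ^ p z.1 z.2 /
      (p z.1 z.2 * dist z.1 z.2 ^ ((N : ℝ) + s z.1 z.2 * p z.1 z.2)))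
  - (1/2) * ∫ x in Ω, ∫ y in Ω,
      Fant f x (u x) * Fant f y (u y) / dist x y ^ μ x y

/-- `⟨J'(u), w⟩`. -/
def Jderiv (Ω : Set (RN N)) (s p μ : RN N → RN N → ℝ) (f : RN N → ℝ → ℝ)
    (u w : RN N → ℝ) : ℝ :=
  energyLHS s p u w - choquardRHS Ω μ f u w

/-- The perturbed functional `J_λ`. -/
def Jlam (Ω : Set (RN N)) (s p μ : RN N → RN N → ℝ) (f : RN N → ℝ → ℝ)
    (α : RN N → ℝ) (lam : ℝ) (u : RN N → ℝ) : ℝ :=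
  Jfun Ω s p μ f u - lam * ∫ x in Ω, |u x| ^ α x / α x


/-- Uniform bounds on a continuous pair of order and exponent functions. -/
structure Exponents (s p : RN N → RN N → ℝ) (s₀ p₀ P : ℝ) : Prop where
  s_cont : Continuous fun z : RN N × RN N => s z.1 z.2
  p_cont : Continuous fun z : RN N × RN N => p z.1 z.2
  s_pos : 0 < s₀
  s_ge : ∀ x y, s₀ ≤ s x y
  s_le : ∀ x y, s x y ≤ 1
  p_one : 1 < p₀
  p_ge : ∀ x y, p₀ ≤ p x y
  p_le : ∀ x y, p x y ≤ P

namespace Exponents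

variable {s p : RN N → RN N → ℝ} {s₀ p₀ P : ℝ} (h : Exponents s p s₀ p₀ P)
include h

lemma one_lt (x y : RN N) : 1 < p x y := h.p_one.trans_le (h.p_ge x y)

lemma pos (x y : RN N) : 0 < p x y := zero_lt_one.trans (h.one_lt x y)

lemma one_lt_sup : 1 < P := (h.one_lt 0 0).trans_le (h.p_le 0 0)

end Exponents

/-- Density of the Gagliardo modular. -/
def gagDensity (s p : RN N → RN N → ℝ) (u : RN N → ℝ) (z : RN N × RN N) : ℝ :=
  |u z.1 - u z.2| ^ p z.1 z.2 / dist z.1 z.2 ^ ((N : ℝ) + s z.1 z.2 * p z.1 z.2)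

/-- Gagliardo modular as the integral of its real density. -/
def gagEnergy (s p : RN N → RN N → ℝ) (u : RN N → ℝ) : ℝ≥0∞ :=
  ∫⁻ z : RN N × RN N, ENNReal.ofReal (gagDensity s p u z)

lemma gagDensity_nonneg (s p : RN N → RN N → ℝ) (u : RN N → ℝ) (z : RN N × RN N) :
    0 ≤ gagDensity s p u z := by
  unfold gagDensity; positivity

section Density

variable {s p : RN N → RN N → ℝ} {s₀ p₀ P : ℝ}

lemma measurable_kernel (h : Exponents s p s₀ p₀ P) :
    Measurable fun z : RN N × RN N => dist z.1 z.2 ^ ((N : ℝ) + s z.1 z.2 * p z.1 z.2) := by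
  have h1 := h.s_cont.measurable
  have h2 := h.p_cont.measurable
  fun_prop

lemma measurable_gagDensity (h : Exponents s p s₀ p₀ P) {u : RN N → ℝ} (hu : Measurable u) :
    Measurable (gagDensity s p u) := by
  have h2 := h.p_cont.measurable
  have h3 := measurable_kernel h
  unfold gagDensity
  fun_prop

lemma ofReal_gagDensity_div (h : Exponents s p s₀ p₀ P) (u : RN N → ℝ) {l : ℝ} (hl : 0 < l)
    (z : RN N × RN N) :
    ENNReal.ofReal (|u z.1 - u z.2| / l) ^ p z.1 z.2 /
      ENNReal.ofReal (dist z.1 z.2) ^ ((N : ℝ) + s z.1 z.2 * p z.1 z.2) =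
    ENNReal.ofReal (gagDensity s p (fun x => u x / l) z) := by
  have hp := h.pos z.1 z.2
  have hs : 0 < s z.1 z.2 := h.s_pos.trans_le (h.s_ge _ _)
  have he : 0 < (N : ℝ) + s z.1 z.2 * p z.1 z.2 := by positivity
  have ha : |u z.1 / l - u z.2 / l| = |u z.1 - u z.2| / l := by
    rw [← sub_div, abs_div, abs_of_pos hl]
  unfold gagDensity
  rw [ha]
  rcases eq_or_ne z.1 z.2 with hz | hz
  · rw [hz] at hp he ⊢
    simp [ENNReal.zero_rpow_of_pos hp, Real.zero_rpow hp.ne']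
  · have hd : 0 < dist z.1 z.2 := dist_pos.2 hz
    rw [ENNReal.ofReal_rpow_of_nonneg (by positivity : 0 ≤ |u z.1 - u z.2| / l) hp.le,
      ENNReal.ofReal_rpow_of_pos hd, ENNReal.ofReal_div_of_pos (by positivity)]

lemma gmodular_univ (h : Exponents s p s₀ p₀ P) (u : RN N → ℝ) {l : ℝ} (hl : 0 < l) :
    gmodular univ s p u l = gagEnergy s p (fun x => u x / l) := by
  unfold gmodular gagEnergy
  rw [Measure.restrict_univ]
  exact lintegral_congr fun z => ofReal_gagDensity_div h u hl z

lemma gagDensity_mul (s p : RN N → RN N → ℝ) (u : RN N → ℝ) {l : ℝ} (hl : 0 ≤ l)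
    (z : RN N × RN N) :
    gagDensity s p (fun x => l * u x) z = l ^ p z.1 z.2 * gagDensity s p u z := by
  unfold gagDensity
  rw [← mul_sub, abs_mul, abs_of_nonneg hl, Real.mul_rpow hl (abs_nonneg _), mul_div_assoc]

lemma gagEnergy_mul_le (u : RN N → ℝ) {l B : ℝ} (hl : 0 ≤ l)
    (hB : ∀ x y, l ^ p x y ≤ B) :
    gagEnergy s p (fun x => l * u x) ≤ ENNReal.ofReal B * gagEnergy s p u := by
  unfold gagEnergy
  rw [← lintegral_const_mul' _ _ ENNReal.ofReal_ne_top]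
  refine lintegral_mono fun z => ?_
  rw [← ENNReal.ofReal_mul ((Real.rpow_nonneg hl _).trans (hB 0 0)), gagDensity_mul s p u hl]
  exact ENNReal.ofReal_le_ofReal
    (mul_le_mul_of_nonneg_right (hB _ _) (gagDensity_nonneg _ _ _ _))

lemma rpow_le_max_rpow (h : Exponents s p s₀ p₀ P) {l : ℝ} (hl : 0 ≤ l) (x y : RN N) :
    l ^ p x y ≤ max l 1 ^ P :=
  (Real.rpow_le_rpow hl (le_max_left _ _) (h.pos x y).le).trans
    (Real.rpow_le_rpow_of_exponent_le (le_max_right _ _) (h.p_le x y))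

lemma gagEnergy_mul_lt_top (h : Exponents s p s₀ p₀ P) {u : RN N → ℝ} {l : ℝ} (hl : 0 ≤ l)
    (hu : gagEnergy s p u < ⊤) : gagEnergy s p (fun x => l * u x) < ⊤ :=
  (gagEnergy_mul_le u hl fun x y => rpow_le_max_rpow h hl x y).trans_lt
    (ENNReal.mul_lt_top ENNReal.ofReal_lt_top hu)

lemma abs_half_sub_rpow_le {e : ℝ} (he : 1 ≤ e) (a b : ℝ) :
    |(a - b) / 2| ^ e ≤ (|a| ^ e + |b| ^ e) / 2 := by
  have h1 : |(a - b) / 2| ≤ (1 / 2) * |a| + (1 / 2) * |b| := by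
    rw [abs_div, abs_two]; linarith [abs_sub a b]
  have h2 := (convexOn_rpow he).2 (mem_Ici.2 (abs_nonneg a)) (mem_Ici.2 (abs_nonneg b))
    (by norm_num : (0 : ℝ) ≤ 1 / 2) (by norm_num : (0 : ℝ) ≤ 1 / 2) (by norm_num)
  simp only [smul_eq_mul] at h2
  have h3 := Real.rpow_le_rpow (abs_nonneg _) h1 (by linarith : 0 ≤ e)
  linarith

lemma gagDensity_half_sub_le (h : Exponents s p s₀ p₀ P) (u v : RN N → ℝ) (z : RN N × RN N) :
    gagDensity s p (fun x => (u x - v x) / 2) z ≤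
      (gagDensity s p u z + gagDensity s p v z) / 2 := by
  have h1 := abs_half_sub_rpow_le (h.one_lt z.1 z.2).le (u z.1 - u z.2) (v z.1 - v z.2)
  have h2 : (u z.1 - v z.1) / 2 - (u z.2 - v z.2) / 2 =
    (u z.1 - u z.2 - (v z.1 - v z.2)) / 2 := by ring
  unfold gagDensity
  rw [h2, ← add_div, div_div, mul_comm _ (2 : ℝ), ← div_div]
  gcongr

lemma gagDensity_sub_le (h : Exponents s p s₀ p₀ P) (u v : RN N → ℝ) (z : RN N × RN N) :
    gagDensity s p (fun x => u x - v x) z ≤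
      2 ^ P * (gagDensity s p u z + gagDensity s p v z) := by
  have h1 := gagDensity_half_sub_le h u v z
  have h2 := gagDensity_mul s p (fun x => (u x - v x) / 2) (l := 2) (by norm_num) z
  have h3 : (fun x => 2 * ((u x - v x) / 2)) = fun x => u x - v x := by ext x; ring
  rw [h3] at h2
  rw [h2]
  have h4 : (2 : ℝ) ^ p z.1 z.2 ≤ 2 ^ P :=
    Real.rpow_le_rpow_of_exponent_le (by norm_num) (h.p_le _ _)
  have h5 := gagDensity_nonneg s p u z
  have h6 := gagDensity_nonneg s p v z
  exact mul_le_mul h4 (by linarith) (gagDensity_nonneg _ _ _ _) (by positivity)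

lemma gagEnergy_sub_le (h : Exponents s p s₀ p₀ P) {u v : RN N → ℝ} (hu : Measurable u) :
    gagEnergy s p (fun x => u x - v x) ≤
      ENNReal.ofReal (2 ^ P) * (gagEnergy s p u + gagEnergy s p v) := by
  unfold gagEnergy
  rw [← lintegral_add_left (measurable_gagDensity h hu).ennreal_ofReal,
    ← lintegral_const_mul' _ _ ENNReal.ofReal_ne_top]
  refine lintegral_mono fun z => ?_
  rw [← ENNReal.ofReal_add (gagDensity_nonneg _ _ _ _) (gagDensity_nonneg _ _ _ _),
    ← ENNReal.ofReal_mul (by positivity)]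
  exact ENNReal.ofReal_le_ofReal (gagDensity_sub_le h u v z)

lemma integrable_gagDensity (h : Exponents s p s₀ p₀ P) {u : RN N → ℝ} (hu : Measurable u)
    (hfin : gagEnergy s p u < ⊤) : Integrable (gagDensity s p u) :=
  ⟨(measurable_gagDensity h hu).aestronglyMeasurable, by
    rwa [hasFiniteIntegral_iff_ofReal (ae_of_all _ fun z => gagDensity_nonneg s p u z)]⟩

lemma integral_gagDensity (h : Exponents s p s₀ p₀ P) {u : RN N → ℝ} (hu : Measurable u) :
    ∫ z, gagDensity s p u z = (gagEnergy s p u).toReal :=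
  integral_eq_lintegral_of_nonneg_ae (ae_of_all _ fun z => gagDensity_nonneg s p u z)
    (measurable_gagDensity h hu).aestronglyMeasurable


/-- Outside `Qset Ω` the density vanishes when `u` vanishes outside `Ω`. -/
lemma gmodular_Qset (h : Exponents s p s₀ p₀ P) {Ω : Set (RN N)} (hΩ : MeasurableSet Ω)
    {u : RN N → ℝ} (hu0 : ∀ᵐ x, x ∉ Ω → u x = 0) (l : ℝ) :
    gmodular (Qset Ω) s p u l = gmodular univ s p u l := by
  unfold gmodular
  rw [Measure.restrict_univ]
  have hQ : MeasurableSet (Qset Ω) := MeasurableSet.univ.diff (hΩ.compl.prod hΩ.compl)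
  rw [← lintegral_indicator hQ]
  refine lintegral_congr_ae ?_
  have h1 := (Measure.quasiMeasurePreserving_fst
    (μ := (volume : Measure (RN N))) (ν := (volume : Measure (RN N)))).ae hu0
  have h2 := (Measure.quasiMeasurePreserving_snd
    (μ := (volume : Measure (RN N))) (ν := (volume : Measure (RN N)))).ae hu0
  rw [Measure.volume_eq_prod]
  filter_upwards [h1, h2] with z hz1 hz2
  by_cases hz : z ∈ Qset Ω
  · rw [indicator_of_mem hz]
  · rw [indicator_of_notMem hz]
    simp only [Qset, Set.mem_sdiff, mem_univ, true_and, not_not, mem_prod, mem_compl_iff] at hz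
    rw [hz1 hz.1, hz2 hz.2]
    simp [ENNReal.zero_rpow_of_pos (h.pos z.1 z.2)]

end Density

section Cells

/-- Index of the dyadic cube of side `2⁻ᵏ` containing `x`. -/
def cell (k : ℕ) (x : RN N) : Fin N → ℤ := fun i => ⌊2 ^ k * x i⌋

/-- The dyadic cube of side `2⁻ᵏ` containing `x`. -/
def cube (k : ℕ) (x : RN N) : Set (RN N) := {y | cell k y = cell k x}

lemma measurable_cell (k : ℕ) : Measurable (cell (N := N) k) := by
  refine measurable_pi_lambda _ fun i => Int.measurable_floor.comp ?_
  fun_prop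

lemma measurableSet_cube (k : ℕ) (x : RN N) : MeasurableSet (cube k x) :=
  measurable_cell k (measurableSet_singleton _)

lemma mem_cube_comm {k : ℕ} {x y : RN N} : y ∈ cube k x ↔ x ∈ cube k y := eq_comm

lemma mem_cube_self (k : ℕ) (x : RN N) : x ∈ cube k x := rfl

lemma dist_le_of_mem_cube {k : ℕ} {x y z : RN N} (hy : y ∈ cube k x) (hz : z ∈ cube k x) :
    dist y z ≤ N * (2⁻¹ : ℝ) ^ k := by
  have hyz : cell k y = cell k z := Eq.trans hy (Eq.symm hz)
  have h1 : ∀ i, dist (y i) (z i) ≤ (2⁻¹ : ℝ) ^ k := fun i => by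
    have h2 := Int.abs_sub_lt_one_of_floor_eq_floor (congrFun hyz i)
    rw [← mul_sub, abs_mul, abs_of_pos (by positivity : (0 : ℝ) < 2 ^ k)] at h2
    rw [Real.dist_eq, inv_pow, ← one_div, le_div_iff₀' (by positivity)]
    exact h2.le
  rw [EuclideanSpace.dist_eq]
  refine Real.sqrt_le_iff.2 ⟨by positivity, ?_⟩
  calc ∑ i, dist (y i) (z i) ^ 2 ≤ ∑ _i : Fin N, ((2⁻¹ : ℝ) ^ k) ^ 2 :=
        Finset.sum_le_sum fun i _ => pow_le_pow_left₀ dist_nonneg (h1 i) 2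
    _ = N * ((2⁻¹ : ℝ) ^ k) ^ 2 := by simp
    _ ≤ (N * (2⁻¹ : ℝ) ^ k) ^ 2 := by
        rw [mul_pow]
        gcongr
        exact_mod_cast Nat.le_self_pow two_ne_zero N

lemma volume_cube (k : ℕ) (x : RN N) :
    volume (cube k x) = ENNReal.ofReal (((2⁻¹ : ℝ) ^ k) ^ N) := by
  have h1 := (EuclideanSpace.volume_preserving_symm_measurableEquiv_toLp (Fin N))
  have h2 : cube k x = (MeasurableEquiv.toLp 2 (Fin N → ℝ)).symm ⁻¹'
      (univ.pi fun i => Ico ((cell k x i : ℝ) / 2 ^ k) (((cell k x i : ℝ) + 1) / 2 ^ k)) := by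
    ext y
    have : (∀ i, ⌊2 ^ k * y i⌋ = cell k x i) ↔ ∀ i, (cell k x i : ℝ) / 2 ^ k ≤ y i ∧
        y i < ((cell k x i : ℝ) + 1) / 2 ^ k := forall_congr' fun i => by
      rw [Int.floor_eq_iff, div_le_iff₀' (by positivity), lt_div_iff₀' (by positivity)]
    simpa [cube, funext_iff, cell] using this
  rw [h2, h1.measure_preimage (MeasurableSet.univ_pi fun i => measurableSet_Ico).nullMeasurableSet,
    Real.volume_pi_Ico]
  have h3 : ∀ i, ((cell k x i : ℝ) + 1) / 2 ^ k - (cell k x i : ℝ) / 2 ^ k = (2⁻¹ : ℝ) ^ k := by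
    intro i; rw [← sub_div, add_sub_cancel_left, inv_pow, one_div]
  simp only [h3, Finset.prod_const, Finset.card_univ, Fintype.card_fin]
  rw [← ENNReal.ofReal_pow (by positivity)]

lemma volume_cube_ne_zero (k : ℕ) (x : RN N) : volume (cube k x) ≠ 0 := by
  rw [volume_cube]; simp

lemma volume_cube_ne_top (k : ℕ) (x : RN N) : volume (cube k x) ≠ ⊤ := by
  rw [volume_cube]; simp

/-- Uniform probability measure on the dyadic cube containing `x`. -/
def cubeMeasure (k : ℕ) (x : RN N) : Measure (RN N) := ProbabilityTheory.cond volume (cube k x)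

instance (k : ℕ) (x : RN N) : IsProbabilityMeasure (cubeMeasure k x) :=
  ProbabilityTheory.cond_isProbabilityMeasure_of_finite
    (volume_cube_ne_zero k x) (volume_cube_ne_top k x)

lemma ae_mem_cube (k : ℕ) (x : RN N) : ∀ᵐ y ∂cubeMeasure k x, y ∈ cube k x :=
  ProbabilityTheory.ae_cond_mem (measurableSet_cube k x)

lemma cubeMeasure_eq (k : ℕ) (x : RN N) :
    cubeMeasure k x = (volume (cube k x))⁻¹ • volume.restrict (cube k x) := rfl

lemma integrable_cubeMeasure {u : RN N → ℝ} (hu : Integrable u) (k : ℕ) (x : RN N) :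
    Integrable u (cubeMeasure k x) :=
  hu.restrict.smul_measure (by simp [volume_cube_ne_zero])

/-- Average over the dyadic cube containing `x`. -/
def cubeAvg (u : RN N → ℝ) (k : ℕ) (x : RN N) : ℝ := ∫ y, u y ∂cubeMeasure k x

lemma enorm_sub_integral_le {ν : Measure (RN N)} [IsProbabilityMeasure ν] {u : RN N → ℝ}
    (hu : Integrable u ν) (c : ℝ) : ‖c - ∫ y, u y ∂ν‖ₑ ≤ ∫⁻ y, ‖c - u y‖ₑ ∂ν := by
  have h1 : c - ∫ y, u y ∂ν = ∫ y, (c - u y) ∂ν := by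
    rw [integral_sub (integrable_const c) hu]; simp
  rw [h1]
  exact enorm_integral_le_lintegral_enorm _

lemma enorm_cubeAvg_sub_le {u : RN N → ℝ} (hu : Integrable u) (hm : Measurable u) (k l : ℕ)
    (x : RN N) :
    ‖cubeAvg u k x - cubeAvg u l x‖ₑ ≤
      ∫⁻ z, ‖u z.1 - u z.2‖ₑ ∂(cubeMeasure k x).prod (cubeMeasure l x) := by
  have h1 := enorm_sub_integral_le (integrable_cubeMeasure hu k x) (cubeAvg u l x)
  rw [← enorm_neg, neg_sub]
  refine h1.trans ?_
  rw [lintegral_prod _ (by fun_prop)]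
  refine lintegral_mono fun y => ?_
  rw [← enorm_neg, neg_sub]
  exact enorm_sub_integral_le (integrable_cubeMeasure hu l x) (u y)

lemma enorm_cubeAvg_le (u : RN N → ℝ) (k : ℕ) (x : RN N) :
    ‖cubeAvg u k x‖ₑ ≤ (ENNReal.ofReal (((2⁻¹ : ℝ) ^ k) ^ N))⁻¹ * ∫⁻ y, ‖u y‖ₑ := by
  refine (enorm_integral_le_lintegral_enorm _).trans ?_
  rw [cubeMeasure_eq, lintegral_smul_measure, volume_cube, smul_eq_mul]
  exact mul_le_mul_right (setLIntegral_le_lintegral _ _) _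

/-- Integral of a density over the pairs of points in the cubes of generations `k`, `l`
containing `x`. -/
def cubeMass (g : RN N × RN N → ℝ≥0∞) (k l : ℕ) (x : RN N) : ℝ≥0∞ :=
  ∫⁻ z, (cube k x ×ˢ cube l x).indicator g z

lemma cubeMass_le (g : RN N × RN N → ℝ≥0∞) (k l : ℕ) (x : RN N) :
    cubeMass g k l x ≤ ∫⁻ z, g z :=
  lintegral_mono fun z => indicator_le_self _ _ z

lemma lintegral_cubeMeasure_prod (g : RN N × RN N → ℝ≥0∞) (k l : ℕ) (x : RN N) :
    ∫⁻ z, g z ∂(cubeMeasure k x).prod (cubeMeasure l x) =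
      (ENNReal.ofReal (((2⁻¹ : ℝ) ^ k) ^ N))⁻¹ * (ENNReal.ofReal (((2⁻¹ : ℝ) ^ l) ^ N))⁻¹ *
        cubeMass g k l x := by
  rw [cubeMeasure_eq, cubeMeasure_eq, Measure.prod_smul_left, Measure.prod_smul_right,
    Measure.prod_restrict, lintegral_smul_measure, lintegral_smul_measure, volume_cube,
    volume_cube, cubeMass, lintegral_indicator
      ((measurableSet_cube k x).prod (measurableSet_cube l x)), ← Measure.volume_eq_prod,
    smul_eq_mul, smul_eq_mul, mul_assoc]

lemma measurable_cubeMass_integrand {g : RN N × RN N → ℝ≥0∞} (hg : Measurable g) (k l : ℕ) :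
    Measurable fun w : RN N × (RN N × RN N) =>
      (cube k w.1 ×ˢ cube l w.1).indicator g w.2 := by
  have h1 : (fun w : RN N × (RN N × RN N) => (cube k w.1 ×ˢ cube l w.1).indicator g w.2) =
      {w : RN N × (RN N × RN N) | cell k w.2.1 = cell k w.1 ∧ cell l w.2.2 = cell l w.1}.indicator
        fun w => g w.2 := by
    ext w
    simp [indicator, cube]
  rw [h1]
  have hk := measurable_cell (N := N) k
  have hl := measurable_cell (N := N) l
  refine (hg.comp measurable_snd).indicator (MeasurableSet.inter ?_ ?_)
  · exact measurableSet_eq_fun (hk.comp (measurable_fst.comp measurable_snd))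
      (hk.comp measurable_fst)
  · exact measurableSet_eq_fun (hl.comp (measurable_snd.comp measurable_snd))
      (hl.comp measurable_fst)

lemma measurable_cubeMass {g : RN N × RN N → ℝ≥0∞} (hg : Measurable g) (k l : ℕ) :
    Measurable (cubeMass g k l) :=
  (measurable_cubeMass_integrand hg k l).lintegral_prod_right'

lemma lintegral_cubeMass_le {g : RN N × RN N → ℝ≥0∞} (hg : Measurable g) (k l : ℕ) :
    ∫⁻ x, cubeMass g k l x ≤ ENNReal.ofReal (((2⁻¹ : ℝ) ^ k) ^ N) * ∫⁻ z, g z := by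
  unfold cubeMass
  rw [lintegral_lintegral_swap (measurable_cubeMass_integrand hg k l).aemeasurable,
    ← lintegral_const_mul' _ _ ENNReal.ofReal_ne_top]
  refine lintegral_mono fun z => ?_
  calc ∫⁻ x, (cube k x ×ˢ cube l x).indicator g z
      ≤ ∫⁻ x, (cube k z.1).indicator (fun _ => g z) x := by
        refine lintegral_mono fun x => ?_
        by_cases hz : z ∈ cube k x ×ˢ cube l x
        · rw [indicator_of_mem hz, indicator_of_mem (mem_cube_comm.1 hz.1)]
        · rw [indicator_of_notMem hz]; exact zero_le
    _ = ENNReal.ofReal (((2⁻¹ : ℝ) ^ k) ^ N) * g z := by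
        rw [lintegral_indicator (measurableSet_cube k z.1), lintegral_const,
          Measure.restrict_apply_univ, volume_cube, mul_comm]

end Cells

section LocalEstimates

variable {s p : RN N → RN N → ℝ} {s₀ p₀ P : ℝ}

/-- Lowering of order and exponent at scale `T`. -/
lemma abs_sub_rpow_le (h : Exponents s p s₀ p₀ P) (u : RN N → ℝ) {z : RN N × RN N} {T σ π : ℝ}
    (hT : 0 < T) (hT1 : T ≤ 1) (hd : dist z.1 z.2 ≤ T) (hσ : σ ≤ s z.1 z.2) (hπ : 0 ≤ π)
    (hπp : π ≤ p z.1 z.2) :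
    |u z.1 - u z.2| ^ π ≤ T ^ (σ * π) * (1 + T ^ (N : ℝ) * gagDensity s p u z) := by
  have hp := h.pos z.1 z.2
  have hg := gagDensity_nonneg s p u z
  set a := |u z.1 - u z.2| with ha
  have ha0 : 0 ≤ a := abs_nonneg _
  have hTσ : 0 < T ^ σ := Real.rpow_pos_of_pos hT _
  rcases le_or_gt a (T ^ σ) with hc | hc
  · calc a ^ π ≤ (T ^ σ) ^ π := Real.rpow_le_rpow ha0 hc hπ
      _ = T ^ (σ * π) := (Real.rpow_mul hT.le _ _).symm
      _ ≤ _ := le_mul_of_one_le_right (by positivity) (le_add_of_nonneg_right (by positivity))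
  · have ha1 : 0 < a := hTσ.trans hc
    have hd0 : 0 < dist z.1 z.2 := by
      refine dist_pos.2 fun hz => ha1.ne' ?_
      rw [ha, hz]; simp
    have hs : 0 < s z.1 z.2 := h.s_pos.trans_le (h.s_ge _ _)
    have h1 : (a / T ^ σ) ^ π ≤ (a / T ^ σ) ^ p z.1 z.2 :=
      Real.rpow_le_rpow_of_exponent_le ((one_le_div hTσ).2 hc.le) hπp
    have h2 : dist z.1 z.2 ^ ((N : ℝ) + s z.1 z.2 * p z.1 z.2) ≤
        T ^ ((N : ℝ) + σ * p z.1 z.2) :=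
      (Real.rpow_le_rpow hd0.le hd (by positivity)).trans
        (Real.rpow_le_rpow_of_exponent_ge hT hT1 (by gcongr))
    have h3 : (a / T ^ σ) ^ p z.1 z.2 ≤ T ^ (N : ℝ) * gagDensity s p u z := by
      rw [Real.div_rpow ha0 hTσ.le, ← Real.rpow_mul hT.le, gagDensity, ← ha, ← mul_div_assoc,
        div_le_div_iff₀ (by positivity) (by positivity)]
      calc a ^ p z.1 z.2 * dist z.1 z.2 ^ ((N : ℝ) + s z.1 z.2 * p z.1 z.2)
          ≤ a ^ p z.1 z.2 * T ^ ((N : ℝ) + σ * p z.1 z.2) := by gcongr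
        _ = T ^ (N : ℝ) * a ^ p z.1 z.2 * T ^ (σ * p z.1 z.2) := by
          rw [Real.rpow_add hT]; ring
    have h4 : a ^ π = T ^ (σ * π) * (a / T ^ σ) ^ π := by
      rw [Real.div_rpow ha0 hTσ.le, ← Real.rpow_mul hT.le]; field_simp
    rw [h4]
    gcongr
    linarith

lemma enorm_sub_rpow_le (h : Exponents s p s₀ p₀ P) (u : RN N → ℝ) {z : RN N × RN N} {T σ π : ℝ}
    (hT : 0 < T) (hT1 : T ≤ 1) (hd : dist z.1 z.2 ≤ T) (hσ : σ ≤ s z.1 z.2) (hπ : 0 ≤ π)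
    (hπp : π ≤ p z.1 z.2) :
    ‖u z.1 - u z.2‖ₑ ^ π ≤ ENNReal.ofReal (T ^ (σ * π)) *
      (1 + ENNReal.ofReal (T ^ (N : ℝ)) * ENNReal.ofReal (gagDensity s p u z)) := by
  have hg := gagDensity_nonneg s p u z
  rw [Real.enorm_eq_ofReal_abs, ENNReal.ofReal_rpow_of_nonneg (abs_nonneg _) hπ,
    ← ENNReal.ofReal_mul (by positivity), ← ENNReal.ofReal_one,
    ← ENNReal.ofReal_add zero_le_one (by positivity), ← ENNReal.ofReal_mul (by positivity)]
  exact ENNReal.ofReal_le_ofReal (abs_sub_rpow_le h u hT hT1 hd hσ hπ hπp)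

lemma ofReal_scale_mul_inv (k : ℕ) :
    ENNReal.ofReal ((N * (2⁻¹ : ℝ) ^ k) ^ (N : ℝ)) * (ENNReal.ofReal (((2⁻¹ : ℝ) ^ k) ^ N))⁻¹ =
      ENNReal.ofReal ((N : ℝ) ^ N) := by
  rw [← ENNReal.ofReal_inv_of_pos (by positivity), ← ENNReal.ofReal_mul (by positivity),
    Real.rpow_natCast, mul_pow, mul_assoc, mul_inv_cancel₀ (by positivity), mul_one]

/-- `L¹` rate of convergence of dyadic averages. -/
lemma lintegral_sub_cubeAvg_le (h : Exponents s p s₀ p₀ P) (hN : 0 < N) {u : RN N → ℝ}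
    (hm : Measurable u) (hu : Integrable u) (Ω : Set (RN N)) {k : ℕ}
    (hk : N * (2⁻¹ : ℝ) ^ k ≤ 1) :
    ∫⁻ x in Ω, ‖u x - cubeAvg u k x‖ₑ ≤ ENNReal.ofReal ((N * (2⁻¹ : ℝ) ^ k) ^ s₀) *
      (volume Ω + ENNReal.ofReal ((N : ℝ) ^ N) * gagEnergy s p u) := by
  set T : ℝ := N * (2⁻¹ : ℝ) ^ k with hTdef
  have hT : 0 < T := by positivity
  set g : RN N × RN N → ℝ≥0∞ := fun z => ENNReal.ofReal (gagDensity s p u z) with hg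
  have hgm : Measurable g := (measurable_gagDensity h hm).ennreal_ofReal
  set V := ENNReal.ofReal (((2⁻¹ : ℝ) ^ k) ^ N) with hV
  have hVinv : V⁻¹ ≠ ⊤ := by simp [V]
  have h1 : ∀ x, ‖u x - cubeAvg u k x‖ₑ ≤ ENNReal.ofReal (T ^ s₀) *
      (1 + (ENNReal.ofReal (T ^ (N : ℝ)) * V⁻¹) * ∫⁻ y, g (x, y)) := by
    intro x
    calc ‖u x - cubeAvg u k x‖ₑ ≤ ∫⁻ y, ‖u x - u y‖ₑ ∂cubeMeasure k x :=
          enorm_sub_integral_le (integrable_cubeMeasure hu k x) (u x)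
      _ ≤ ∫⁻ y, ENNReal.ofReal (T ^ s₀) * (1 + ENNReal.ofReal (T ^ (N : ℝ)) * g (x, y))
            ∂cubeMeasure k x := by
          refine lintegral_mono_ae ?_
          filter_upwards [ae_mem_cube k x] with y hy
          have := enorm_sub_rpow_le h u (z := (x, y)) (σ := s₀) (π := 1) hT hk
            (dist_le_of_mem_cube (mem_cube_self k x) hy) (h.s_ge _ _) zero_le_one
            (h.one_lt _ _).le
          simpa using this
      _ = ENNReal.ofReal (T ^ s₀) * (1 + ENNReal.ofReal (T ^ (N : ℝ)) *
            (V⁻¹ * ∫⁻ y in cube k x, g (x, y))) := by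
          rw [lintegral_const_mul' _ _ ENNReal.ofReal_ne_top, lintegral_add_left measurable_const,
            lintegral_const_mul' _ _ ENNReal.ofReal_ne_top, lintegral_const, measure_univ, mul_one,
            cubeMeasure_eq, lintegral_smul_measure, volume_cube, smul_eq_mul]
      _ ≤ _ := by
          rw [mul_assoc]
          gcongr
          exact Measure.restrict_le_self
  calc ∫⁻ x in Ω, ‖u x - cubeAvg u k x‖ₑ
      ≤ ∫⁻ x in Ω, ENNReal.ofReal (T ^ s₀) *
        (1 + (ENNReal.ofReal (T ^ (N : ℝ)) * V⁻¹) * ∫⁻ y, g (x, y)) := lintegral_mono h1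
    _ = ENNReal.ofReal (T ^ s₀) * (volume Ω + (ENNReal.ofReal (T ^ (N : ℝ)) * V⁻¹) *
          ∫⁻ x in Ω, ∫⁻ y, g (x, y)) := by
        rw [lintegral_const_mul' _ _ ENNReal.ofReal_ne_top, lintegral_add_left measurable_const,
          lintegral_const_mul' _ _ (ENNReal.mul_ne_top ENNReal.ofReal_ne_top hVinv), lintegral_const,
          Measure.restrict_apply_univ, one_mul]
    _ ≤ _ := by
        rw [ofReal_scale_mul_inv]
        have h2 : ∫⁻ x in Ω, ∫⁻ y, g (x, y) ≤ gagEnergy s p u := by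
          refine (setLIntegral_le_lintegral _ _).trans ?_
          rw [gagEnergy, Measure.volume_eq_prod, lintegral_prod _ hgm.aemeasurable]
        gcongr

/-- Poincaré inequality in `L¹` for functions vanishing outside a bounded set. -/
lemma exists_lintegral_enorm_le (h : Exponents s p s₀ p₀ P) (hN : 2 ≤ N) {Ω : Set (RN N)}
    (hΩb : Bornology.IsBounded Ω) (hΩm : MeasurableSet Ω) :
    ∃ C : ℝ≥0∞, C ≠ ⊤ ∧ ∀ u : RN N → ℝ, Measurable u → (∀ᵐ x, x ∉ Ω → u x = 0) →
      ∫⁻ x, ‖u x‖ₑ ≤ volume Ω + C * gagEnergy s p u := by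
  obtain ⟨R, hR0, hR⟩ := hΩb.subset_ball_lt 0 0
  have : Nonempty (Fin N) := ⟨⟨0, by omega⟩⟩
  obtain ⟨x₁, hx₁⟩ := exists_norm_eq (RN N) (by linarith : 0 ≤ R + 2)
  set B := Metric.ball x₁ 1
  set L : ℝ := 2 * R + 3
  have hL : 1 ≤ L := by simp only [L]; linarith
  have hP := h.one_lt_sup
  have hdist : ∀ x ∈ Ω, ∀ y ∈ B, dist x y ≤ L := fun x hx y hy => by
    have h1 := hR hx
    have h2 : dist y x₁ < 1 := hy
    rw [Metric.mem_ball, dist_zero_right] at h1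
    have h3 := dist_triangle x x₁ y
    have h4 : dist x x₁ ≤ ‖x‖ + ‖x₁‖ := dist_le_norm_add_norm x x₁
    rw [dist_comm x₁ y] at h3
    simp only [L]; linarith
  have hdisj : ∀ y ∈ B, y ∉ Ω := fun y hy hyΩ => by
    have h1 := hR hyΩ
    have h2 : dist y x₁ < 1 := hy
    rw [Metric.mem_ball, dist_zero_right] at h1
    rw [dist_eq_norm] at h2
    have := norm_le_norm_add_norm_sub' x₁ y
    rw [norm_sub_rev] at this
    linarith
  have hB0 : volume B ≠ 0 := (Metric.measure_ball_pos volume x₁ one_pos).ne'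
  have hBt : volume B ≠ ⊤ := measure_ball_lt_top.ne
  set K := ENNReal.ofReal (L ^ ((N : ℝ) + P))
  refine ⟨(volume B)⁻¹ * K, ENNReal.mul_ne_top (ENNReal.inv_ne_top.2 hB0) ENNReal.ofReal_ne_top,
    fun u hm hu0 => ?_⟩
  set g : RN N × RN N → ℝ≥0∞ := fun z => ENNReal.ofReal (gagDensity s p u z) with hg
  have hgm : Measurable g := (measurable_gagDensity h hm).ennreal_ofReal
  have hpt : ∀ x ∈ Ω, ∀ y ∈ B, u y = 0 → ‖u x‖ₑ ≤ 1 + K * g (x, y) := by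
    intro x hx y hy hy0
    have hd0 : 0 < dist x y := dist_pos.2 fun hxy => hdisj y hy (hxy ▸ hx)
    have hs : 0 < s x y := h.s_pos.trans_le (h.s_ge _ _)
    have h1 : |u x| ≤ 1 + |u x| ^ p x y := by
      rcases le_total |u x| 1 with hc | hc
      · have : 0 ≤ |u x| ^ p x y := by positivity
        linarith
      · have := Real.rpow_le_rpow_of_exponent_le hc (h.one_lt x y).le
        rw [Real.rpow_one] at this
        linarith
    have h2 : dist x y ^ ((N : ℝ) + s x y * p x y) ≤ L ^ ((N : ℝ) + P) := by
      have hp := h.pos x y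
      refine (Real.rpow_le_rpow hd0.le (hdist x hx y hy) (by positivity)).trans
        (Real.rpow_le_rpow_of_exponent_le hL ?_)
      have h3 : s x y * p x y ≤ 1 * P :=
        mul_le_mul (h.s_le x y) (h.p_le x y) hp.le zero_le_one
      linarith
    have h3 : |u x| ^ p x y ≤ L ^ ((N : ℝ) + P) * gagDensity s p u (x, y) := by
      unfold gagDensity
      simp only [hy0, sub_zero]
      rw [← mul_div_assoc, le_div_iff₀ (by positivity), mul_comm]
      gcongr
    have hg0 := gagDensity_nonneg s p u (x, y)
    rw [Real.enorm_eq_ofReal_abs, ← ENNReal.ofReal_mul (by positivity), ← ENNReal.ofReal_one,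
      ← ENNReal.ofReal_add zero_le_one (by positivity)]
    exact ENNReal.ofReal_le_ofReal (by linarith)
  have h1 : ∀ x ∈ Ω, ‖u x‖ₑ ≤ 1 + (volume B)⁻¹ * K * ∫⁻ y, g (x, y) := by
    intro x hx
    have h2 : ∫⁻ _y in B, ‖u x‖ₑ ≤ ∫⁻ y in B, (1 + K * g (x, y)) := by
      refine lintegral_mono_ae ?_
      filter_upwards [ae_restrict_mem measurableSet_ball, ae_restrict_of_ae hu0] with y hy hy0
      exact hpt x hx y hy (hy0 (hdisj y hy))
    rw [lintegral_const, Measure.restrict_apply_univ, lintegral_add_left measurable_const,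
      lintegral_const_mul' _ _ ENNReal.ofReal_ne_top, lintegral_const,
      Measure.restrict_apply_univ, one_mul] at h2
    calc ‖u x‖ₑ = (volume B)⁻¹ * (‖u x‖ₑ * volume B) := by
          rw [mul_comm, mul_assoc, ENNReal.mul_inv_cancel hB0 hBt, mul_one]
      _ ≤ (volume B)⁻¹ * (volume B + K * ∫⁻ y in B, g (x, y)) := by gcongr
      _ = 1 + (volume B)⁻¹ * K * ∫⁻ y in B, g (x, y) := by
          rw [mul_add, ENNReal.inv_mul_cancel hB0 hBt, mul_assoc]
      _ ≤ _ := by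
          gcongr
          exact Measure.restrict_le_self
  have h3 : ∫⁻ x, ‖u x‖ₑ = ∫⁻ x in Ω, ‖u x‖ₑ := by
    rw [← lintegral_indicator hΩm]
    refine lintegral_congr_ae ?_
    filter_upwards [hu0] with x hx
    by_cases hxΩ : x ∈ Ω
    · rw [indicator_of_mem hxΩ]
    · rw [indicator_of_notMem hxΩ, hx hxΩ, enorm_zero]
  rw [h3]
  calc ∫⁻ x in Ω, ‖u x‖ₑ ≤ ∫⁻ x in Ω, (1 + (volume B)⁻¹ * K * ∫⁻ y, g (x, y)) :=
        setLIntegral_mono' hΩm h1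
    _ = volume Ω + (volume B)⁻¹ * K * ∫⁻ x in Ω, ∫⁻ y, g (x, y) := by
        rw [lintegral_add_left measurable_const, lintegral_const_mul' _ _
          (ENNReal.mul_ne_top (ENNReal.inv_ne_top.2 hB0) ENNReal.ofReal_ne_top), lintegral_const,
          Measure.restrict_apply_univ, one_mul]
    _ ≤ _ := by
        have h2 : ∫⁻ x in Ω, ∫⁻ y, g (x, y) ≤ gagEnergy s p u := by
          refine (setLIntegral_le_lintegral _ _).trans ?_
          rw [gagEnergy, Measure.volume_eq_prod, lintegral_prod _ hgm.aemeasurable]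
        gcongr

end LocalEstimates

section Compactness

/-- An `L¹`-Cauchy sequence of functions has an a.e. convergent subsequence. -/
lemma exists_subseq_ae_tendsto_of_cauchy {α : Type*} [MeasurableSpace α] {ν : Measure α}
    {u : ℕ → α → ℝ} (hu : ∀ m, Integrable (u m) ν)
    (hc : Tendsto (fun n : ℕ × ℕ => ∫⁻ x, ‖u n.1 x - u n.2 x‖ₑ ∂ν) atTop (nhds 0)) :
    ∃ φ : ℕ → ℕ, StrictMono φ ∧ ∃ v : α → ℝ, Measurable v ∧
      ∀ᵐ x ∂ν, Tendsto (fun k => u (φ k) x) atTop (nhds (v x)) := by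
  have hL : ∀ m, MemLp (u m) 1 ν := fun m => memLp_one_iff_integrable.2 (hu m)
  have hcau : CauchySeq fun m => (hL m).toLp (u m) := by
    rw [Lp.cauchySeq_Lp_iff_cauchySeq_eLpNorm]
    refine hc.congr fun n => ?_
    rw [eLpNorm_one_eq_lintegral_enorm]
    refine lintegral_congr_ae ?_
    filter_upwards [(hL n.1).coeFn_toLp, (hL n.2).coeFn_toLp] with x h1 h2
    rw [Pi.sub_apply, h1, h2]
  obtain ⟨w, hw⟩ := cauchySeq_tendsto_of_complete hcau
  have hm := tendstoInMeasure_of_tendsto_Lp hw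
  obtain ⟨φ, hφ, hae⟩ := hm.exists_seq_tendsto_ae
  refine ⟨φ, hφ, w, (Lp.stronglyMeasurable w).measurable, ?_⟩
  have hall : ∀ᵐ x ∂ν, ∀ m, (hL m).toLp (u m) x = u m x :=
    ae_all_iff.2 fun m => (hL m).coeFn_toLp
  filter_upwards [hae, hall] with x h1 h2
  exact h1.congr fun k => h2 _

/-- Mean value over the dyadic cube with index `j`. -/
def cellMean (u : RN N → ℝ) (k : ℕ) (j : Fin N → ℤ) : ℝ :=
  ∫ y, u y ∂ProbabilityTheory.cond volume {y | cell k y = j}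

lemma cubeAvg_eq_cellMean (u : RN N → ℝ) (k : ℕ) (x : RN N) :
    cubeAvg u k x = cellMean u k (cell k x) := rfl

lemma measurable_cubeAvg (u : RN N → ℝ) (k : ℕ) : Measurable (cubeAvg u k) :=
  (Measurable.of_discrete (f := cellMean u k)).comp (measurable_cell k)

lemma abs_cellMean_le {u : RN N → ℝ} {b : ℝ} (hb : 0 ≤ b)
    (hu : ∫⁻ x, ‖u x‖ₑ ≤ ENNReal.ofReal b) (k : ℕ) (j : Fin N → ℤ) :
    |cellMean u k j| ≤ (((2⁻¹ : ℝ) ^ k) ^ N)⁻¹ * b := by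
  by_cases hj : ∃ x : RN N, cell k x = j
  · obtain ⟨x, rfl⟩ := hj
    have h1 := (enorm_cubeAvg_le u k x).trans (mul_le_mul_right hu _)
    rw [← ENNReal.ofReal_inv_of_pos (by positivity), ← ENNReal.ofReal_mul (by positivity),
      Real.enorm_eq_ofReal_abs] at h1
    exact (ENNReal.ofReal_le_ofReal_iff (by positivity)).1 h1
  · have h1 : {y : RN N | cell k y = j} = ∅ := by
      ext y; simpa using fun hy => hj ⟨y, hy⟩
    have h2 : cellMean u k j = 0 := by
      rw [cellMean, h1]; simp
    rw [h2, abs_zero]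
    positivity

/-- Bounded sequences in `L¹` have subsequences all of whose dyadic means converge. -/
lemma exists_subseq_cellMean_tendsto {u : ℕ → RN N → ℝ} {b : ℝ} (hb : 0 ≤ b)
    (hu : ∀ m, ∫⁻ x, ‖u m x‖ₑ ≤ ENNReal.ofReal b) :
    ∃ φ : ℕ → ℕ, StrictMono φ ∧ ∃ L : ℕ → (Fin N → ℤ) → ℝ,
      ∀ k j, Tendsto (fun m => cellMean (u (φ m)) k j) atTop (nhds (L k j)) := by
  have hK : IsCompact (univ.pi fun i : ℕ × (Fin N → ℤ) =>
      Icc (-((((2⁻¹ : ℝ) ^ i.1) ^ N)⁻¹ * b)) ((((2⁻¹ : ℝ) ^ i.1) ^ N)⁻¹ * b)) :=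
    isCompact_univ_pi fun i => isCompact_Icc
  obtain ⟨L, -, φ, hφ, hL⟩ := hK.tendsto_subseq
    (x := fun m (i : ℕ × (Fin N → ℤ)) => cellMean (u m) i.1 i.2)
    fun m i _ => abs_le.1 (abs_cellMean_le hb (hu m) i.1 i.2)
  exact ⟨φ, hφ, fun k j => L (k, j), fun k j => (tendsto_pi_nhds.1 hL) (k, j)⟩

variable {s p : RN N → RN N → ℝ} {s₀ p₀ P : ℝ}

lemma tendsto_scale_rpow (N : ℕ) {e : ℝ} (he : 0 < e) (B : ℝ≥0∞) (hB : B ≠ ⊤) :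
    Tendsto (fun k : ℕ => ENNReal.ofReal ((N * (2⁻¹ : ℝ) ^ k) ^ e) * B) atTop (nhds 0) := by
  have h1 : Tendsto (fun k : ℕ => (N : ℝ) * (2⁻¹ : ℝ) ^ k) atTop (nhds 0) := by
    simpa using (tendsto_pow_atTop_nhds_zero_of_lt_one (by norm_num : (0 : ℝ) ≤ 2⁻¹)
      (by norm_num)).const_mul (N : ℝ)
  have h2 := h1.rpow_const (p := e) (Or.inr he.le)
  rw [Real.zero_rpow he.ne'] at h2
  have h3 := ENNReal.tendsto_ofReal h2
  rw [ENNReal.ofReal_zero] at h3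
  simpa using ENNReal.Tendsto.mul_const h3 (Or.inr hB)

lemma eventually_scale_lt (N : ℕ) {t : ℝ} (ht : 0 < t) :
    ∀ᶠ k : ℕ in atTop, N * (2⁻¹ : ℝ) ^ k < t := by
  have h1 : Tendsto (fun k : ℕ => (N : ℝ) * (2⁻¹ : ℝ) ^ k) atTop (nhds 0) := by
    simpa using (tendsto_pow_atTop_nhds_zero_of_lt_one (by norm_num : (0 : ℝ) ≤ 2⁻¹)
      (by norm_num)).const_mul (N : ℝ)
  exact h1.eventually_lt_const ht

/-- Sequences with bounded Gagliardo energy have an a.e. convergent subsequence. -/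
lemma exists_subseq_ae_tendsto (h : Exponents s p s₀ p₀ P) (hN : 2 ≤ N) {Ω : Set (RN N)}
    (hΩb : Bornology.IsBounded Ω) (hΩm : MeasurableSet Ω) {u : ℕ → RN N → ℝ} {R : ℝ≥0∞}
    (hR : R ≠ ⊤) (hm : ∀ m, Measurable (u m)) (hu0 : ∀ m, ∀ᵐ x, x ∉ Ω → u m x = 0)
    (hu : ∀ m, gagEnergy s p (u m) ≤ R) :
    ∃ φ : ℕ → ℕ, StrictMono φ ∧ ∃ v : RN N → ℝ, Measurable v ∧ (∀ x, x ∉ Ω → v x = 0) ∧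
      ∀ᵐ x, Tendsto (fun k => u (φ k) x) atTop (nhds (v x)) := by
  obtain ⟨C, hC, hC1⟩ := exists_lintegral_enorm_le h hN hΩb hΩm
  have hvol : volume Ω ≠ ⊤ := hΩb.measure_lt_top.ne
  have hb : ∀ m, ∫⁻ x, ‖u m x‖ₑ ≤ ENNReal.ofReal (volume Ω + C * R).toReal := fun m => by
    rw [ENNReal.ofReal_toReal (ENNReal.add_ne_top.2 ⟨hvol, ENNReal.mul_ne_top hC hR⟩)]
    refine (hC1 _ (hm m) (hu0 m)).trans ?_
    gcongr
    exact hu m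
  have hint : ∀ m, Integrable (u m) := fun m =>
    ⟨(hm m).aestronglyMeasurable, (hb m).trans_lt ENNReal.ofReal_lt_top⟩
  obtain ⟨φ, hφ, L, hL⟩ := exists_subseq_cellMean_tendsto ENNReal.toReal_nonneg hb
  set b := (volume Ω + C * R).toReal
  have : IsFiniteMeasure (volume.restrict Ω) := ⟨by simpa using hvol.lt_top⟩
  have hcoarse : ∀ k, Tendsto (fun n : ℕ × ℕ => ∫⁻ x in Ω,
      ‖cubeAvg (u (φ n.1)) k x - cubeAvg (u (φ n.2)) k x‖ₑ) atTop (nhds 0) := by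
    intro k
    have h1 := tendsto_lintegral_filter_of_dominated_convergence (μ := volume.restrict Ω)
      (l := (atTop : Filter (ℕ × ℕ)))
      (F := fun n x => ‖cubeAvg (u (φ n.1)) k x - cubeAvg (u (φ n.2)) k x‖ₑ)
      (f := fun _ => 0)
      (fun _ => ENNReal.ofReal (2 * ((((2⁻¹ : ℝ) ^ k) ^ N)⁻¹ * b)))
      (Eventually.of_forall fun n =>
        ((measurable_cubeAvg _ k).sub (measurable_cubeAvg _ k)).enorm)
      (Eventually.of_forall fun n => ae_of_all _ fun x => by
        rw [Real.enorm_eq_ofReal_abs]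
        refine ENNReal.ofReal_le_ofReal ((abs_sub _ _).trans ?_)
        have h1 := abs_cellMean_le ENNReal.toReal_nonneg (hb (φ n.1)) k (cell k x)
        have h2 := abs_cellMean_le ENNReal.toReal_nonneg (hb (φ n.2)) k (cell k x)
        rw [cubeAvg_eq_cellMean, cubeAvg_eq_cellMean]
        linarith)
      (by
        rw [lintegral_const]
        exact ENNReal.mul_ne_top ENNReal.ofReal_ne_top (measure_ne_top _ _))
      (ae_of_all _ fun x => by
        have h1 := hL k (cell k x)
        rw [← prod_atTop_atTop_eq]
        have h2 := ((h1.comp tendsto_fst).sub (h1.comp tendsto_snd)).enorm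
        simpa [cubeAvg_eq_cellMean] using h2)
    simpa using h1
  have hcauchy : Tendsto (fun n : ℕ × ℕ => ∫⁻ x in Ω, ‖u (φ n.1) x - u (φ n.2) x‖ₑ)
      atTop (nhds 0) := by
    rw [ENNReal.tendsto_nhds_zero]
    intro ε hε
    have hε3 : 0 < ε / 3 := ENNReal.div_pos hε.ne' (by norm_num)
    set B := volume Ω + ENNReal.ofReal ((N : ℝ) ^ N) * R
    have hB : B ≠ ⊤ :=
      ENNReal.add_ne_top.2 ⟨hvol, ENNReal.mul_ne_top ENNReal.ofReal_ne_top hR⟩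
    obtain ⟨k, hk1, hk2⟩ := ((eventually_scale_lt N one_pos).and
      (ENNReal.tendsto_nhds_zero.1 (tendsto_scale_rpow N h.s_pos B hB) _ hε3)).exists
    have happ : ∀ m, ∫⁻ x in Ω, ‖u m x - cubeAvg (u m) k x‖ₑ ≤ ε / 3 := fun m => by
      refine (lintegral_sub_cubeAvg_le h (by omega) (hm m) (hint m) Ω hk1.le).trans
        (le_trans ?_ hk2)
      exact mul_le_mul_right (add_le_add le_rfl (mul_le_mul_right (hu m) _)) _
    filter_upwards [ENNReal.tendsto_nhds_zero.1 (hcoarse k) _ hε3] with n hn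
    have hA := measurable_cubeAvg (u (φ n.1)) k
    have hA' := measurable_cubeAvg (u (φ n.2)) k
    have hm1 := hm (φ n.1)
    have hm2 := hm (φ n.2)
    calc ∫⁻ x in Ω, ‖u (φ n.1) x - u (φ n.2) x‖ₑ
        ≤ ∫⁻ x in Ω, (‖u (φ n.1) x - cubeAvg (u (φ n.1)) k x‖ₑ +
          ‖cubeAvg (u (φ n.1)) k x - cubeAvg (u (φ n.2)) k x‖ₑ +
          ‖u (φ n.2) x - cubeAvg (u (φ n.2)) k x‖ₑ) := by
          refine lintegral_mono fun x => ?_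
          have h1 : u (φ n.1) x - u (φ n.2) x = (u (φ n.1) x - cubeAvg (u (φ n.1)) k x) +
            (cubeAvg (u (φ n.1)) k x - cubeAvg (u (φ n.2)) k x) +
            -(u (φ n.2) x - cubeAvg (u (φ n.2)) k x) := by ring
          rw [h1]
          refine (enorm_add_le _ _).trans ?_
          rw [enorm_neg]
          gcongr
          exact enorm_add_le _ _
      _ ≤ ε / 3 + ε / 3 + ε / 3 := by
          rw [lintegral_add_left (by fun_prop), lintegral_add_left (by fun_prop)]
          exact add_le_add (add_le_add (happ _) hn) (happ _)
      _ = ε := ENNReal.add_thirds ε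
  obtain ⟨ψ, hψ, v, hv, hae⟩ :=
    exists_subseq_ae_tendsto_of_cauchy (fun m => (hint (φ m)).restrict) hcauchy
  refine ⟨φ ∘ ψ, hφ.comp hψ, Ω.indicator v, hv.indicator hΩm,
    fun x hx => indicator_of_notMem hx v, ?_⟩
  filter_upwards [(ae_restrict_iff' hΩm).1 hae, ae_all_iff.2 hu0] with x h1 h2
  by_cases hx : x ∈ Ω
  · rw [indicator_of_mem hx]
    exact h1 hx
  · rw [indicator_of_notMem hx]
    exact tendsto_const_nhds.congr fun k => (h2 _ hx).symm

end Compactness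

section SubcriticalBound

variable {s p : RN N → RN N → ℝ} {s₀ p₀ P : ℝ}

/-- Locally frozen lower bounds `σ ≤ s`, `π ≤ p` near each point of `Ω`, together with an exponent
`β` that is uniformly subcritical with respect to them. -/
structure LocalExponents (s p : RN N → RN N → ℝ) (Ω : Set (RN N)) (k₀ : ℕ)
    (σ π β : RN N → ℝ) (ε B : ℝ) : Prop where
  scale_le : 2 * N * (2⁻¹ : ℝ) ^ k₀ ≤ 1
  eps_pos : 0 < ε
  meas : Measurable β
  σ_le : ∀ x ∈ Ω, ∀ y z, dist x y ≤ N * (2⁻¹ : ℝ) ^ k₀ → dist x z ≤ N * (2⁻¹ : ℝ) ^ k₀ →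
    σ x ≤ s y z
  π_le : ∀ x ∈ Ω, ∀ y z, dist x y ≤ N * (2⁻¹ : ℝ) ^ k₀ → dist x z ≤ N * (2⁻¹ : ℝ) ^ k₀ →
    π x ≤ p y z
  σ_le_one : ∀ x ∈ Ω, σ x ≤ 1
  one_le_π : ∀ x ∈ Ω, 1 ≤ π x
  π_le_β : ∀ x ∈ Ω, π x ≤ β x
  β_le : ∀ x ∈ Ω, β x ≤ B
  eps_le : ∀ x ∈ Ω, ε ≤ σ x * β x
  subcritical : ∀ x ∈ Ω, ε ≤ σ x * β x - N * (β x / π x) + N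

lemma rpow_lintegral_le {α : Type*} [MeasurableSpace α] {ν : Measure α} [IsProbabilityMeasure ν]
    {g : α → ℝ} (hg : AEStronglyMeasurable g ν) {π : ℝ} (hπ : 1 ≤ π) :
    (∫⁻ z, ‖g z‖ₑ ∂ν) ^ π ≤ ∫⁻ z, ‖g z‖ₑ ^ π ∂ν := by
  have h1 := eLpNorm'_le_eLpNorm'_of_exponent_le one_pos hπ ν hg
  simp only [eLpNorm', ENNReal.rpow_one, div_one] at h1
  calc (∫⁻ z, ‖g z‖ₑ ∂ν) ^ π ≤ ((∫⁻ z, ‖g z‖ₑ ^ π ∂ν) ^ (1 / π)) ^ π := by gcongr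
    _ = _ := by
      rw [← ENNReal.rpow_mul, one_div_mul_cancel (by linarith), ENNReal.rpow_one]

lemma enorm_cubeAvg_sub_succ_rpow_le (h : Exponents s p s₀ p₀ P) (hN : 0 < N) {u : RN N → ℝ}
    (hm : Measurable u) (hu : Integrable u) {k : ℕ} {x : RN N} {σ π : ℝ}
    (hk : 2 * N * (2⁻¹ : ℝ) ^ k ≤ 1)
    (hσ : ∀ y z, dist x y ≤ N * (2⁻¹ : ℝ) ^ k → dist x z ≤ N * (2⁻¹ : ℝ) ^ k → σ ≤ s y z)
    (hπ : ∀ y z, dist x y ≤ N * (2⁻¹ : ℝ) ^ k → dist x z ≤ N * (2⁻¹ : ℝ) ^ k → π ≤ p y z)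
    (hπ1 : 1 ≤ π) :
    ‖cubeAvg u k x - cubeAvg u (k + 1) x‖ₑ ^ π ≤
      ENNReal.ofReal ((2 * N * (2⁻¹ : ℝ) ^ k) ^ (σ * π)) *
        (1 + ENNReal.ofReal ((4 * N) ^ N * (((2⁻¹ : ℝ) ^ k) ^ N)⁻¹) *
          cubeMass (fun z => ENNReal.ofReal (gagDensity s p u z)) k (k + 1) x) := by
  set T : ℝ := 2 * N * (2⁻¹ : ℝ) ^ k with hTdef
  have hT : 0 < T := by positivity
  set g : RN N × RN N → ℝ≥0∞ := fun z => ENNReal.ofReal (gagDensity s p u z) with hg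
  have hgm : Measurable g := (measurable_gagDensity h hm).ennreal_ofReal
  set ν := (cubeMeasure k x).prod (cubeMeasure (k + 1) x)
  have hae : ∀ᵐ z ∂ν, z.1 ∈ cube k x ∧ z.2 ∈ cube (k + 1) x :=
    (Measure.quasiMeasurePreserving_fst.ae (ae_mem_cube k x)).and
      (Measure.quasiMeasurePreserving_snd.ae (ae_mem_cube (k + 1) x))
  calc ‖cubeAvg u k x - cubeAvg u (k + 1) x‖ₑ ^ π
      ≤ (∫⁻ z, ‖u z.1 - u z.2‖ₑ ∂ν) ^ π := by
        gcongr
        exact enorm_cubeAvg_sub_le hu hm k (k + 1) x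
    _ ≤ ∫⁻ z, ‖u z.1 - u z.2‖ₑ ^ π ∂ν :=
        rpow_lintegral_le (g := fun z : RN N × RN N => u z.1 - u z.2)
          (by fun_prop) hπ1
    _ ≤ ∫⁻ z, ENNReal.ofReal (T ^ (σ * π)) * (1 + ENNReal.ofReal (T ^ (N : ℝ)) * g z) ∂ν := by
        refine lintegral_mono_ae ?_
        filter_upwards [hae] with z hz
        have h1 : dist x z.1 ≤ N * (2⁻¹ : ℝ) ^ k := dist_le_of_mem_cube (mem_cube_self k x) hz.1
        have h2 : dist x z.2 ≤ N * (2⁻¹ : ℝ) ^ k :=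
          (dist_le_of_mem_cube (mem_cube_self (k + 1) x) hz.2).trans (by
            rw [pow_succ]
            have : (0 : ℝ) ≤ N * (2⁻¹ : ℝ) ^ k := by positivity
            linarith)
        refine enorm_sub_rpow_le h u hT hk ?_ (hσ _ _ h1 h2) (by linarith) (hπ _ _ h1 h2)
        have := dist_triangle_left z.1 z.2 x
        rw [hTdef]; linarith
    _ = ENNReal.ofReal (T ^ (σ * π)) * (1 + ENNReal.ofReal (T ^ (N : ℝ)) *
          ((ENNReal.ofReal (((2⁻¹ : ℝ) ^ k) ^ N))⁻¹ *
            (ENNReal.ofReal (((2⁻¹ : ℝ) ^ (k + 1)) ^ N))⁻¹ * cubeMass g k (k + 1) x)) := by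
        rw [lintegral_const_mul' _ _ ENNReal.ofReal_ne_top, lintegral_add_left measurable_const,
          lintegral_const_mul' _ _ ENNReal.ofReal_ne_top, lintegral_const, measure_univ, mul_one,
          lintegral_cubeMeasure_prod]
    _ = _ := by
        rw [← mul_assoc (ENNReal.ofReal (T ^ (N : ℝ))), ← ENNReal.ofReal_inv_of_pos (by positivity),
          ← ENNReal.ofReal_inv_of_pos (by positivity), ← ENNReal.ofReal_mul (by positivity),
          ← ENNReal.ofReal_mul (by positivity)]
        have h0 : (0 : ℝ) < (2 : ℝ)⁻¹ ^ k := by positivity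
        have h1 : T ^ (N : ℝ) * ((((2⁻¹ : ℝ) ^ k) ^ N)⁻¹ * (((2⁻¹ : ℝ) ^ (k + 1)) ^ N)⁻¹) =
            (4 * N) ^ N * (((2⁻¹ : ℝ) ^ k) ^ N)⁻¹ := by
          rw [Real.rpow_natCast, hTdef, pow_succ]
          generalize (2⁻¹ : ℝ) ^ k = t at h0
          rw [← inv_pow, ← inv_pow, ← mul_pow, ← mul_pow, ← mul_pow]
          congr 1
          field_simp
          norm_num
        rw [h1]

/-- Raising a single-scale estimate to a subcritical power. -/
lemma rpow_le_of_subcritical (hN : 0 < N) {d G ρ : ℝ≥0∞} {τ σ π β ε B : ℝ} (hτ : 0 < τ)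
    (hτ1 : 2 * N * τ ≤ 1) (hσ1 : σ ≤ 1) (hπ : 1 ≤ π) (hπβ : π ≤ β) (hβ : β ≤ B)
    (hε : ε ≤ σ * β) (hsub : ε ≤ σ * β - N * (β / π) + N) (hG : G ≤ ρ)
    (hd : d ^ π ≤ ENNReal.ofReal ((2 * N * τ) ^ (σ * π)) *
      (1 + ENNReal.ofReal ((4 * N) ^ N * (τ ^ N)⁻¹) * G)) :
    d ^ β ≤ ENNReal.ofReal ((2 * N) ^ B * 2 ^ B * (4 * N) ^ (N * B) * τ ^ ε) *
      (1 + ENNReal.ofReal ((τ ^ N)⁻¹) * (1 + ρ) ^ B * G) := by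
  have hπ0 : 0 < π := by linarith
  have hN1 : (1 : ℝ) ≤ N := by exact_mod_cast hN
  have hτ1' : τ ≤ 1 := by nlinarith
  set e := β / π with he
  have he1 : 1 ≤ e := (one_le_div hπ0).2 hπβ
  have heB : e ≤ B := (div_le_self (by linarith) hπ).trans hβ
  have he0 : 0 ≤ e := by linarith
  have hπe : π * e = β := mul_div_cancel₀ _ hπ0.ne'
  have h1 : d ^ β = (d ^ π) ^ e := by rw [← ENNReal.rpow_mul, hπe]
  have hGe : G ^ e ≤ (1 + ρ) ^ B * G := by
    have h2 : G ^ e ≤ G ^ (e - 1) * G := by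
      rcases eq_or_ne G 0 with h0 | h0
      · simp [h0, ENNReal.zero_rpow_of_pos (by linarith : 0 < e)]
      · rcases eq_or_ne G ⊤ with ht | ht
        · subst ht
          rw [ENNReal.mul_top]
          · exact le_top
          · rcases eq_or_lt_of_le he1 with h3 | h3
            · simp [← h3]
            · simp [ENNReal.top_rpow_of_pos (sub_pos.2 h3)]
        · rw [ENNReal.rpow_sub _ _ h0 ht, ENNReal.rpow_one, ENNReal.div_mul_cancel h0 ht]
    refine h2.trans ?_
    gcongr
    calc G ^ (e - 1) ≤ (1 + ρ) ^ (e - 1) :=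
          ENNReal.rpow_le_rpow (hG.trans le_add_self) (by linarith)
      _ ≤ (1 + ρ) ^ B := ENNReal.rpow_le_rpow_of_exponent_le le_self_add (by linarith)
  have h2 : (1 + ENNReal.ofReal ((4 * N) ^ N * (τ ^ N)⁻¹) * G) ^ e ≤
      ENNReal.ofReal (2 ^ B) *
        (1 + ENNReal.ofReal ((4 * N) ^ (N * B) * τ ^ (-(N * e))) * ((1 + ρ) ^ B * G)) := by
    refine (ENNReal.rpow_add_le_mul_rpow_add_rpow _ _ he1).trans ?_
    rw [ENNReal.one_rpow, ENNReal.mul_rpow_of_nonneg _ _ he0]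
    have h3 : (2 : ℝ≥0∞) ^ (e - 1) ≤ ENNReal.ofReal (2 ^ B) := by
      rw [← ENNReal.ofReal_rpow_of_pos two_pos, ENNReal.ofReal_ofNat]
      exact ENNReal.rpow_le_rpow_of_exponent_le (by norm_num) (by linarith)
    have h4 : ENNReal.ofReal ((4 * N) ^ N * (τ ^ N)⁻¹) ^ e ≤
        ENNReal.ofReal ((4 * N) ^ (N * B) * τ ^ (-(N * e))) := by
      rw [ENNReal.ofReal_rpow_of_nonneg (by positivity) he0]
      refine ENNReal.ofReal_le_ofReal ?_
      rw [Real.mul_rpow (by positivity) (by positivity), ← Real.rpow_natCast, ← Real.rpow_natCast,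
        ← Real.rpow_neg hτ.le, ← Real.rpow_mul (by positivity), ← Real.rpow_mul hτ.le, neg_mul]
      gcongr
      linarith
    gcongr
  have h5 : ENNReal.ofReal ((2 * N * τ) ^ (σ * π)) ^ e ≤
      ENNReal.ofReal ((2 * N) ^ B * τ ^ (σ * β)) := by
    rw [ENNReal.ofReal_rpow_of_nonneg (by positivity) he0]
    refine ENNReal.ofReal_le_ofReal ?_
    rw [← Real.rpow_mul (by positivity), mul_assoc σ, hπe, Real.mul_rpow (by positivity) hτ.le]
    gcongr
    · linarith
    · nlinarith
  have hc : (1 : ℝ) ≤ (4 * N) ^ (N * B) := Real.one_le_rpow (by linarith) (by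
    have : 0 ≤ B := by linarith
    positivity)
  calc d ^ β ≤ ENNReal.ofReal ((2 * N) ^ B * τ ^ (σ * β)) * (ENNReal.ofReal (2 ^ B) *
        (1 + ENNReal.ofReal ((4 * N) ^ (N * B) * τ ^ (-(N * e))) * ((1 + ρ) ^ B * G))) := by
        rw [h1]
        refine (ENNReal.rpow_le_rpow hd he0).trans ?_
        rw [ENNReal.mul_rpow_of_nonneg _ _ he0]
        gcongr
    _ = ENNReal.ofReal ((2 * N) ^ B * 2 ^ B * τ ^ (σ * β)) + ENNReal.ofReal ((2 * N) ^ B * 2 ^ B *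
        (4 * N) ^ (N * B) * τ ^ (σ * β - N * e)) * ((1 + ρ) ^ B * G) := by
        rw [mul_add, mul_add, mul_one, ← mul_assoc, ← mul_assoc,
          ← ENNReal.ofReal_mul (by positivity), ← ENNReal.ofReal_mul (by positivity)]
        rw [show σ * β - N * e = σ * β + -(N * e) by ring, Real.rpow_add hτ]
        congr 2
        · ring
        · congr 1; ring
    _ ≤ ENNReal.ofReal ((2 * N) ^ B * 2 ^ B * (4 * N) ^ (N * B) * τ ^ ε) +
        ENNReal.ofReal ((2 * N) ^ B * 2 ^ B * (4 * N) ^ (N * B) * τ ^ ε * (τ ^ N)⁻¹) *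
          ((1 + ρ) ^ B * G) := by
        gcongr ?_ + ?_ * _
        · refine ENNReal.ofReal_le_ofReal ?_
          have h6 : τ ^ (σ * β) ≤ τ ^ ε := Real.rpow_le_rpow_of_exponent_ge hτ hτ1' hε
          exact mul_le_mul (le_mul_of_one_le_right (by positivity) hc) h6 (by positivity)
            (by positivity)
        · refine ENNReal.ofReal_le_ofReal ?_
          rw [mul_assoc _ (τ ^ ε), ← Real.rpow_natCast τ N, ← Real.rpow_neg hτ.le,
            ← Real.rpow_add hτ]
          have h6 := Real.rpow_le_rpow_of_exponent_ge hτ hτ1'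
            (by linarith : ε + -(N : ℝ) ≤ σ * β - N * e)
          gcongr
    _ = _ := by
        rw [mul_add, mul_one, ← mul_assoc, ← mul_assoc, ← mul_assoc,
          ← ENNReal.ofReal_mul (by positivity)]

section Dyadic

variable {Ω : Set (RN N)} {k₀ : ℕ} {σ π β : RN N → ℝ} {ε B : ℝ}

lemma lintegral_cubeAvg_sub_succ_le (h : Exponents s p s₀ p₀ P)
    (hL : LocalExponents s p Ω k₀ σ π β ε B) (hN : 0 < N) (hΩm : MeasurableSet Ω) {u : RN N → ℝ}
    (hm : Measurable u) (hu : Integrable u) {k : ℕ} (hk : k₀ ≤ k) :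
    ∫⁻ x in Ω, ‖cubeAvg u k x - cubeAvg u (k + 1) x‖ₑ ^ β x ≤
      ENNReal.ofReal ((2 * N) ^ B * 2 ^ B * (4 * N) ^ (N * B) * ((2⁻¹ : ℝ) ^ k) ^ ε) *
        (volume Ω + (1 + gagEnergy s p u) ^ B * gagEnergy s p u) := by
  set τ : ℝ := (2⁻¹ : ℝ) ^ k with hτdef
  have hτ : 0 < τ := by positivity
  have hτk : τ ≤ (2⁻¹ : ℝ) ^ k₀ := pow_le_pow_of_le_one (by norm_num) (by norm_num) hk
  set g : RN N × RN N → ℝ≥0∞ := fun z => ENNReal.ofReal (gagDensity s p u z) with hg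
  have hgm : Measurable g := (measurable_gagDensity h hm).ennreal_ofReal
  set ρ := gagEnergy s p u with hρ
  have hscale : 2 * N * τ ≤ 1 := (by gcongr : 2 * N * τ ≤ 2 * N * (2⁻¹ : ℝ) ^ k₀).trans hL.scale_le
  have hN2 : N * τ ≤ N * (2⁻¹ : ℝ) ^ k₀ := by gcongr
  have h1 : ∀ x ∈ Ω, ‖cubeAvg u k x - cubeAvg u (k + 1) x‖ₑ ^ β x ≤
      ENNReal.ofReal ((2 * N) ^ B * 2 ^ B * (4 * N) ^ (N * B) * τ ^ ε) *
      (1 + ENNReal.ofReal ((τ ^ N)⁻¹) * (1 + ρ) ^ B * cubeMass g k (k + 1) x) := fun x hx =>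
    rpow_le_of_subcritical hN hτ hscale (hL.σ_le_one x hx) (hL.one_le_π x hx)
      (hL.π_le_β x hx) (hL.β_le x hx) (hL.eps_le x hx) (hL.subcritical x hx) (cubeMass_le g _ _ _)
      (enorm_cubeAvg_sub_succ_rpow_le h hN hm hu hscale
        (fun y z hy hz => hL.σ_le x hx y z (hy.trans hN2) (hz.trans hN2))
        (fun y z hy hz => hL.π_le x hx y z (hy.trans hN2) (hz.trans hN2)) (hL.one_le_π x hx))
  refine (setLIntegral_mono' hΩm h1).trans ?_
  rw [lintegral_const_mul' _ _ ENNReal.ofReal_ne_top, lintegral_add_left measurable_const,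
    lintegral_const_mul _ (measurable_cubeMass hgm _ _), lintegral_const,
    Measure.restrict_apply_univ, one_mul]
  refine mul_le_mul_right (add_le_add le_rfl ?_) _
  calc ENNReal.ofReal ((τ ^ N)⁻¹) * (1 + ρ) ^ B * ∫⁻ x in Ω, cubeMass g k (k + 1) x
      ≤ ENNReal.ofReal ((τ ^ N)⁻¹) * (1 + ρ) ^ B * (ENNReal.ofReal (τ ^ N) * ρ) := by
        gcongr
        exact (setLIntegral_le_lintegral _ _).trans (lintegral_cubeMass_le hgm k (k + 1))
    _ = ENNReal.ofReal ((τ ^ N)⁻¹) * ENNReal.ofReal (τ ^ N) * ((1 + ρ) ^ B * ρ) := by ring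
    _ = _ := by
        rw [← ENNReal.ofReal_mul (by positivity), inv_mul_cancel₀ (by positivity),
          ENNReal.ofReal_one, one_mul]

lemma enorm_sub_cubeAvg_le_tsum (h : Exponents s p s₀ p₀ P) (hN : 0 < N) {u : RN N → ℝ}
    (hm : Measurable u) (hu : Integrable u) (hΩ : volume Ω ≠ ⊤) (hgu : gagEnergy s p u ≠ ⊤)
    (k₀ : ℕ) :
    ∀ᵐ x ∂volume.restrict Ω, ‖u x - cubeAvg u k₀ x‖ₑ ≤
      ∑' j, ‖cubeAvg u (k₀ + j) x - cubeAvg u (k₀ + j + 1) x‖ₑ := by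
  have hmeas : ∀ k, Measurable fun x => ‖u x - cubeAvg u k x‖ₑ := fun k =>
    (hm.sub (measurable_cubeAvg u k)).enorm
  have h0 : Tendsto (fun k => ∫⁻ x in Ω, ‖u x - cubeAvg u k x‖ₑ) atTop (nhds 0) := by
    refine tendsto_of_tendsto_of_tendsto_of_le_of_le' tendsto_const_nhds
      (tendsto_scale_rpow N h.s_pos
        (volume Ω + ENNReal.ofReal ((N : ℝ) ^ N) * gagEnergy s p u)
        (ENNReal.add_ne_top.2 ⟨hΩ, ENNReal.mul_ne_top ENNReal.ofReal_ne_top hgu⟩))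
      (Eventually.of_forall fun _ => zero_le) ?_
    filter_upwards [eventually_scale_lt N one_pos] with k hk
    exact lintegral_sub_cubeAvg_le h hN hm hu Ω hk.le
  have h1 : ∫⁻ x in Ω, liminf (fun k => ‖u x - cubeAvg u k x‖ₑ) atTop = 0 := by
    refine le_antisymm ((lintegral_liminf_le hmeas).trans ?_) zero_le
    rw [h0.liminf_eq]
  rw [lintegral_eq_zero_iff (Measurable.liminf hmeas)] at h1
  filter_upwards [h1] with x hx
  refine ENNReal.le_of_forall_pos_le_add fun δ hδ _ => ?_
  have h2 : ∃ᶠ k in atTop, ‖u x - cubeAvg u k x‖ₑ < δ :=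
    frequently_lt_of_liminf_lt (h := by simpa [hx] using hδ)
  obtain ⟨k, hk1, hk2⟩ := (h2.and_eventually (eventually_ge_atTop k₀)).exists
  obtain ⟨n, rfl⟩ := Nat.exists_eq_add_of_le hk2
  have h3 : ‖cubeAvg u k₀ x - cubeAvg u (k₀ + n) x‖ₑ ≤
      ∑ j ∈ Finset.range n, ‖cubeAvg u (k₀ + j) x - cubeAvg u (k₀ + j + 1) x‖ₑ := by
    have := Finset.sum_range_sub' (fun j => cubeAvg u (k₀ + j) x) n
    simp only [add_zero, ← add_assoc] at this
    rw [← this]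
    exact enorm_sum_le _ _
  calc ‖u x - cubeAvg u k₀ x‖ₑ
      = ‖-(cubeAvg u k₀ x - cubeAvg u (k₀ + n) x) + (u x - cubeAvg u (k₀ + n) x)‖ₑ := by
        congr 1; ring
    _ ≤ ‖cubeAvg u k₀ x - cubeAvg u (k₀ + n) x‖ₑ + ‖u x - cubeAvg u (k₀ + n) x‖ₑ := by
        refine (enorm_add_le _ _).trans ?_
        rw [enorm_neg]
    _ ≤ _ := add_le_add (h3.trans (ENNReal.sum_le_tsum _)) hk1.le

lemma tsum_rpow_le {a : ℕ → ℝ≥0∞} {θ : ℝ≥0∞} {b B : ℝ} (hθ0 : θ ≠ 0) (hθ1 : θ < 1) (hb : 1 ≤ b)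
    (hB : b ≤ B) :
    (∑' j, a j) ^ b ≤ (1 - θ)⁻¹ ^ B * ∑' j, (θ ^ j) ^ (-B) * a j ^ b := by
  set S := ∑' j, (θ ^ j) ^ (-B) * a j ^ b with hS
  have hb0 : 0 < b := by linarith
  have h1 : ∀ j, a j ≤ θ ^ j * S ^ b⁻¹ := fun j => by
    have hθj0 : θ ^ j ≠ 0 := pow_ne_zero _ hθ0
    have hθjt : θ ^ j ≠ ⊤ := ENNReal.pow_ne_top hθ1.ne_top
    have h2 : (θ ^ j) ^ (-B) * a j ^ b ≤ S := ENNReal.le_tsum (f := fun j =>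
      (θ ^ j) ^ (-B) * a j ^ b) j
    have h3 : a j ^ b ≤ (θ ^ j) ^ b * S := by
      calc a j ^ b = (θ ^ j) ^ B * ((θ ^ j) ^ (-B) * a j ^ b) := by
            rw [← mul_assoc, ← ENNReal.rpow_add _ _ hθj0 hθjt, add_neg_cancel, ENNReal.rpow_zero,
              one_mul]
        _ ≤ (θ ^ j) ^ b * S := by
            gcongr ?_ * ?_
            exact ENNReal.rpow_le_rpow_of_exponent_ge (pow_le_one' hθ1.le j) hB
    calc a j = (a j ^ b) ^ b⁻¹ := by rw [ENNReal.rpow_rpow_inv hb0.ne']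
      _ ≤ ((θ ^ j) ^ b * S) ^ b⁻¹ := by gcongr
      _ = _ := by
        rw [ENNReal.mul_rpow_of_nonneg _ _ (by positivity), ENNReal.rpow_rpow_inv hb0.ne']
  calc (∑' j, a j) ^ b ≤ (∑' j, θ ^ j * S ^ b⁻¹) ^ b := by
        gcongr with j
        exact h1 j
    _ = ((1 - θ)⁻¹) ^ b * S := by
        rw [ENNReal.tsum_mul_right, ENNReal.tsum_geometric,
          ENNReal.mul_rpow_of_nonneg _ _ hb0.le, ENNReal.rpow_inv_rpow hb0.ne']
    _ ≤ _ := by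
        gcongr
        exact ENNReal.one_le_inv.2 tsub_le_self

/-- Subcritical modular bound on energy-bounded sets. -/
lemma exists_lintegral_rpow_le (h : Exponents s p s₀ p₀ P)
    (hL : LocalExponents s p Ω k₀ σ π β ε B) (hN : 2 ≤ N) (hΩb : Bornology.IsBounded Ω)
    (hΩm : MeasurableSet Ω) {R : ℝ≥0∞} (hR : R ≠ ⊤) (hB : 1 ≤ B) :
    ∃ C : ℝ≥0∞, C ≠ ⊤ ∧ ∀ u : RN N → ℝ, Measurable u → (∀ᵐ x, x ∉ Ω → u x = 0) →
      gagEnergy s p u ≤ R → ∫⁻ x in Ω, ‖u x‖ₑ ^ β x ≤ C := by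
  obtain ⟨C₀, hC₀, hC₀'⟩ := exists_lintegral_enorm_le h hN hΩb hΩm
  have hvol : volume Ω ≠ ⊤ := hΩb.measure_lt_top.ne
  have hB0 : 0 < B := by linarith
  have hε := hL.eps_pos
  set b := volume Ω + C₀ * R
  have hb : b ≠ ⊤ := ENNReal.add_ne_top.2 ⟨hvol, ENNReal.mul_ne_top hC₀ hR⟩
  set A := (ENNReal.ofReal (((2⁻¹ : ℝ) ^ k₀) ^ N))⁻¹ * b
  have hA : A ≠ ⊤ := ENNReal.mul_ne_top (by simp) hb
  set K : ℝ := (2 * N) ^ B * 2 ^ B * (4 * N) ^ (N * B)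
  set W := volume Ω + (1 + R) ^ B * R
  have hW : W ≠ ⊤ := ENNReal.add_ne_top.2 ⟨hvol, ENNReal.mul_ne_top
    (ENNReal.rpow_ne_top_of_nonneg hB0.le (ENNReal.add_ne_top.2 ⟨one_ne_top, hR⟩)) hR⟩
  set t : ℝ := 2⁻¹ ^ (ε / (2 * B))
  have ht0 : 0 < t := by positivity
  have ht1 : t < 1 := Real.rpow_lt_one (by norm_num) (by norm_num) (by positivity)
  have htB : t ^ B < 1 := Real.rpow_lt_one ht0.le ht1 hB0
  set θ := ENNReal.ofReal t
  have hθ0 : θ ≠ 0 := by simpa [θ] using ht0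
  have hθ1 : θ < 1 := by simpa [θ, ENNReal.ofReal_lt_one] using ht1
  have h1θ : (1 - θ)⁻¹ ≠ ⊤ := ENNReal.inv_ne_top.2 (tsub_pos_iff_lt.2 hθ1).ne'
  set K₁ := K * ((2⁻¹ : ℝ) ^ k₀) ^ ε
  refine ⟨2 ^ B * ((1 + A) ^ B * volume Ω + (1 - θ)⁻¹ ^ B * (ENNReal.ofReal K₁ * W *
    (1 - ENNReal.ofReal (t ^ B))⁻¹)), ?_, fun u hm hu0 hgu => ?_⟩
  · have h1 : (1 - ENNReal.ofReal (t ^ B))⁻¹ ≠ ⊤ :=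
      ENNReal.inv_ne_top.2 (tsub_pos_iff_lt.2 (by simpa [ENNReal.ofReal_lt_one] using htB)).ne'
    have h2 : (1 + A) ^ B ≠ ⊤ :=
      ENNReal.rpow_ne_top_of_nonneg hB0.le (ENNReal.add_ne_top.2 ⟨one_ne_top, hA⟩)
    have h3 : (1 - θ)⁻¹ ^ B ≠ ⊤ := ENNReal.rpow_ne_top_of_nonneg hB0.le h1θ
    have h4 : (2 : ℝ≥0∞) ^ B ≠ ⊤ := ENNReal.rpow_ne_top_of_nonneg hB0.le (by simp)
    exact ENNReal.mul_ne_top h4 (ENNReal.add_ne_top.2 ⟨ENNReal.mul_ne_top h2 hvol,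
      ENNReal.mul_ne_top h3 (ENNReal.mul_ne_top (ENNReal.mul_ne_top ENNReal.ofReal_ne_top hW) h1)⟩)
  have hub : ∫⁻ x, ‖u x‖ₑ ≤ b :=
    (hC₀' u hm hu0).trans (add_le_add le_rfl (mul_le_mul_right hgu _))
  have hint : Integrable u := ⟨hm.aestronglyMeasurable, hub.trans_lt hb.lt_top⟩
  set D : ℕ → RN N → ℝ≥0∞ := fun j x => ‖cubeAvg u (k₀ + j) x - cubeAvg u (k₀ + j + 1) x‖ₑ
  have hDm : ∀ j, Measurable (D j) := fun j =>
    ((measurable_cubeAvg u _).sub (measurable_cubeAvg u _)).enorm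
  have hpt : ∀ᵐ x ∂volume.restrict Ω, ‖u x‖ₑ ^ β x ≤
      2 ^ B * ((1 + A) ^ B + (1 - θ)⁻¹ ^ B * ∑' j, (θ ^ j) ^ (-B) * D j x ^ β x) := by
    filter_upwards [ae_restrict_mem hΩm, enorm_sub_cubeAvg_le_tsum h (by omega) hm hint hvol
      (hgu.trans_lt hR.lt_top).ne k₀] with x hx h1
    have hβ1 : 1 ≤ β x := (hL.one_le_π x hx).trans (hL.π_le_β x hx)
    have hβB := hL.β_le x hx
    have h2 : ‖u x‖ₑ ≤ ‖cubeAvg u k₀ x‖ₑ + ∑' j, D j x := by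
      calc ‖u x‖ₑ = ‖cubeAvg u k₀ x + (u x - cubeAvg u k₀ x)‖ₑ := by congr 1; ring
        _ ≤ _ := (enorm_add_le _ _).trans (add_le_add le_rfl h1)
    have h3 : ‖cubeAvg u k₀ x‖ₑ ≤ A := (enorm_cubeAvg_le u k₀ x).trans (mul_le_mul_right hub _)
    calc ‖u x‖ₑ ^ β x ≤ (‖cubeAvg u k₀ x‖ₑ + ∑' j, D j x) ^ β x := by gcongr
      _ ≤ 2 ^ (β x - 1) * (‖cubeAvg u k₀ x‖ₑ ^ β x + (∑' j, D j x) ^ β x) :=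
          ENNReal.rpow_add_le_mul_rpow_add_rpow _ _ hβ1
      _ ≤ _ := by
          gcongr ?_ * (?_ + ?_)
          · exact ENNReal.rpow_le_rpow_of_exponent_le (by norm_num) (by linarith)
          · exact (ENNReal.rpow_le_rpow (h3.trans le_add_self) (by linarith)).trans
              (ENNReal.rpow_le_rpow_of_exponent_le le_self_add hβB)
          · exact tsum_rpow_le hθ0 hθ1 hβ1 hβB
  have hterm : ∀ j, ∫⁻ x in Ω, (θ ^ j) ^ (-B) * D j x ^ β x ≤
      ENNReal.ofReal K₁ * W * ENNReal.ofReal (t ^ B) ^ j := by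
    intro j
    have hθj : (θ ^ j) ^ (-B) = ENNReal.ofReal ((t ^ j) ^ (-B)) := by
      rw [← ENNReal.ofReal_pow ht0.le, ENNReal.ofReal_rpow_of_pos (by positivity)]
    rw [hθj, lintegral_const_mul' _ _ ENNReal.ofReal_ne_top]
    calc ENNReal.ofReal ((t ^ j) ^ (-B)) * ∫⁻ x in Ω, D j x ^ β x
        ≤ ENNReal.ofReal ((t ^ j) ^ (-B)) *
          (ENNReal.ofReal (K * ((2⁻¹ : ℝ) ^ (k₀ + j)) ^ ε) * W) := by
          gcongr
          refine (lintegral_cubeAvg_sub_succ_le h hL (by omega) hΩm hm hint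
            (Nat.le_add_right k₀ j)).trans ?_
          exact mul_le_mul_right (add_le_add le_rfl (by gcongr)) _
      _ = _ := by
          rw [← mul_assoc, ← ENNReal.ofReal_mul (by positivity), ← ENNReal.ofReal_pow (by positivity),
            mul_right_comm (ENNReal.ofReal K₁), ← ENNReal.ofReal_mul (by positivity)]
          congr 2
          have h5 : ((2⁻¹ : ℝ) ^ j) ^ ε = (t ^ B) ^ j * (t ^ B) ^ j := by
            rw [← Real.rpow_natCast, ← Real.rpow_natCast, ← Real.rpow_mul ht0.le,
              ← Real.rpow_mul (by norm_num), ← Real.rpow_mul (by norm_num),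
              ← Real.rpow_add (by norm_num)]
            congr 1
            field_simp
            ring
          have h6 : (t ^ j) ^ (-B) * (t ^ B) ^ j = 1 := by
            rw [Real.rpow_neg (by positivity), ← Real.rpow_natCast, ← Real.rpow_natCast,
              ← Real.rpow_mul ht0.le, ← Real.rpow_mul ht0.le, mul_comm B,
              inv_mul_cancel₀ (by positivity)]
          rw [pow_add, Real.mul_rpow (by positivity) (by positivity), h5]
          linear_combination (K * ((2⁻¹ : ℝ) ^ k₀) ^ ε * (t ^ B) ^ j) * h6
  have hmeasD : ∀ j, Measurable fun x => (θ ^ j) ^ (-B) * D j x ^ β x := fun j =>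
    ((hDm j).pow hL.meas).const_mul _
  calc ∫⁻ x in Ω, ‖u x‖ₑ ^ β x
      ≤ ∫⁻ x in Ω, 2 ^ B * ((1 + A) ^ B + (1 - θ)⁻¹ ^ B * ∑' j, (θ ^ j) ^ (-B) * D j x ^ β x) :=
        lintegral_mono_ae hpt
    _ = 2 ^ B * ((1 + A) ^ B * volume Ω +
          (1 - θ)⁻¹ ^ B * ∑' j, ∫⁻ x in Ω, (θ ^ j) ^ (-B) * D j x ^ β x) := by
        have hm1 : Measurable fun x => ∑' j, (θ ^ j) ^ (-B) * D j x ^ β x :=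
          Measurable.tsum hmeasD
        rw [lintegral_const_mul _ (by fun_prop), lintegral_add_left measurable_const,
          lintegral_const_mul _ hm1, lintegral_const, Measure.restrict_apply_univ,
          lintegral_tsum fun j => (hmeasD j).aemeasurable]
    _ ≤ _ := by
        rw [← ENNReal.tsum_geometric (ENNReal.ofReal (t ^ B)),
          ← ENNReal.tsum_mul_left (a := ENNReal.ofReal K₁ * W)]
        exact mul_le_mul_right (add_le_add le_rfl
          (mul_le_mul_right (ENNReal.tsum_le_tsum hterm) _)) _

end Dyadic

end SubcriticalBound

section SubcriticalExponents

variable {s p : RN N → RN N → ℝ} {s₀ p₀ P : ℝ}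

lemma exists_forall_abs_sub_lt {K : Set (RN N)} (hK : IsCompact K) {g : RN N → RN N → ℝ}
    (hg : Continuous fun z : RN N × RN N => g z.1 z.2) {δ : ℝ} (hδ : 0 < δ) :
    ∃ η > 0, ∀ x ∈ K, ∀ y z, dist x y < η → dist x z < η → |g x x - g y z| < δ := by
  have hK' : IsCompact ((fun x : RN N => (x, x)) '' K) := hK.image (by fun_prop)
  have h1 := hK'.uniformContinuousAt_of_continuousAt (fun z : RN N × RN N => g z.1 z.2)
    (fun a _ => hg.continuousAt) (Metric.dist_mem_uniformity hδ)
  obtain ⟨η, hη, h2⟩ := Metric.mem_uniformity_dist.1 h1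
  refine ⟨η, hη, fun x hx y z hy hz => ?_⟩
  have h3 : dist (x, x) (y, z) < η := by
    rw [Prod.dist_eq]; exact max_lt hy hz
  have := h2 h3 (mem_image_of_mem _ hx)
  simpa [Real.dist_eq] using this

/-- Strictly subcritical exponents have uniformly subcritical local data. -/
lemma exists_localExponents (h : Exponents s p s₀ p₀ P) (hN : 0 < N) {S : ℝ}
    (hs : ∀ x y, s x y ≤ S) (hSP : S * P < N) {r : RN N → ℝ} (hr : Continuous r) {Q : ℝ}
    (hQ : 1 < Q) (hrp : ∀ x, p x x ≤ r x * Q)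
    (hrc : ∀ x, r x * Q < N * p x x / (N - s x x * p x x)) {Ω : Set (RN N)}
    (hΩ : Bornology.IsBounded Ω) :
    ∃ A > Q, ∃ (k₀ : ℕ) (σ π : RN N → ℝ) (ε B : ℝ), 1 ≤ B ∧
      LocalExponents s p Ω k₀ σ π (fun x => A * r x) ε B := by
  have hP := h.one_lt_sup
  have hp1 := h.p_one
  have hs0 := h.s_pos
  have hN0 : (0 : ℝ) < N := by exact_mod_cast hN
  have hspos : ∀ x, 0 < s x x := fun x => hs0.trans_le (h.s_ge x x)
  have hppos : ∀ x, 0 < p x x := fun x => h.pos x x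
  have hsp : ∀ x, s x x * p x x ≤ S * P := fun x =>
    mul_le_mul (hs x x) (h.p_le x x) (hppos x).le ((hspos x).le.trans (hs x x))
  have hr0 : ∀ x, 0 < r x := fun x => by
    have := (hppos x).trans_le (hrp x)
    exact pos_of_mul_pos_left this (by linarith)
  set R : ℝ := N * P / (N - S * P)
  have hD : 0 < N - S * P := by linarith
  have hR : ∀ x, r x ≤ R := fun x => by
    have h1 := hr0 x
    have h2 : r x * Q < R := (hrc x).trans_le (by
      have := hsp x
      have := h.p_le x x
      simp only [R]
      gcongr)
    nlinarith
  have hR0 : 0 < R := by positivity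
  have hcl : IsCompact (closure Ω) := hΩ.isCompact_closure
  have hsc : Continuous fun x => s x x := h.s_cont.comp (by fun_prop : Continuous fun x => (x, x))
  have hpc : Continuous fun x => p x x := h.p_cont.comp (by fun_prop : Continuous fun x => (x, x))
  obtain ⟨c₀, hc₀, hc⟩ := hcl.exists_forall_le' (a := 0)
    (f := fun x => N * p x x - r x * Q * (N - s x x * p x x))
    ((continuous_const.mul hpc).sub ((hr.mul_const Q).mul
      (continuous_const.sub (hsc.mul hpc)))).continuousOn (fun x _ => by
      have h1 := hrc x
      have := hsp x
      rw [lt_div_iff₀ (by linarith)] at h1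
      linarith)
  set B := (Q + 1) * R
  set L := N + R * N + B * (1 + P)
  have hL : 0 < L := by positivity
  obtain ⟨δ, hδ0, hδ⟩ : ∃ δ > 0, δ ≤ 1 ∧ δ ≤ s₀ / 2 ∧ δ ≤ p₀ - 1 ∧ δ ≤ c₀ / (2 * L) :=
    ⟨min (min 1 (s₀ / 2)) (min (p₀ - 1) (c₀ / (2 * L))),
      lt_min (lt_min one_pos (by linarith)) (lt_min (by linarith) (by positivity)),
      (min_le_left _ _).trans (min_le_left _ _), (min_le_left _ _).trans (min_le_right _ _),
      (min_le_right _ _).trans (min_le_left _ _), (min_le_right _ _).trans (min_le_right _ _)⟩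
  obtain ⟨hδ1, hδs, hδp, hδc⟩ := hδ
  obtain ⟨η₁, hη₁, hs1⟩ := exists_forall_abs_sub_lt hcl h.s_cont hδ0
  obtain ⟨η₂, hη₂, hp2⟩ := exists_forall_abs_sub_lt hcl h.p_cont hδ0
  obtain ⟨k₀, ⟨hk1, hk2⟩, hk3⟩ := (((eventually_scale_lt N hη₁).and
    (eventually_scale_lt N hη₂)).and (eventually_scale_lt N (t := 1 / 2) (by norm_num))).exists
  have hbase : ∀ x, 1 ≤ r x * Q := fun x => by linarith [hrp x, h.p_ge x x]
  have hβB : ∀ x, (Q + δ) * r x ≤ B := fun x =>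
    mul_le_mul (by linarith) (hR x) (hr0 x).le (by linarith)
  have hβ1 : ∀ x, r x * Q ≤ (Q + δ) * r x := fun x => by nlinarith [hr0 x]
  refine ⟨Q + δ, by linarith, k₀, fun x => s x x - δ, fun x => p x x - δ,
    min (s₀ / 2) (c₀ / (2 * P)), B, (hbase 0).trans ((hβ1 0).trans (hβB 0)), ?_⟩
  refine ⟨by linarith, lt_min (by linarith) (by positivity), by fun_prop,
    fun x hx y z hy hz => ?_, fun x hx y z hy hz => ?_, fun x _ => ?_, fun x _ => ?_, fun x _ => ?_,
    fun x _ => hβB x, fun x _ => ?_, fun x hx => ?_⟩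
  · have := (abs_lt.1 (hs1 x (subset_closure hx) y z (hy.trans_lt hk1) (hz.trans_lt hk1))).2
    linarith
  · have := (abs_lt.1 (hp2 x (subset_closure hx) y z (hy.trans_lt hk2) (hz.trans_lt hk2))).2
    linarith
  · linarith [h.s_le x x]
  · linarith [h.p_ge x x]
  · linarith [hrp x, hβ1 x]
  · refine (min_le_left _ _).trans ?_
    have h1 : s₀ / 2 ≤ s x x - δ := by linarith [h.s_ge x x]
    have h2 := (hbase x).trans (hβ1 x)
    nlinarith
  · refine (min_le_right _ _).trans ?_
    have h1 := hc x (subset_closure hx)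
    have hpx := h.p_ge x x
    have hPx := h.p_le x x
    have hsx := h.s_ge x x
    have hsx1 := h.s_le x x
    have hrx := hr0 x
    have hRx := hR x
    have hβx := hβB x
    have hπ1 : 1 ≤ p x x - δ := by linarith
    have hδL : δ * L ≤ c₀ / 2 := by
      calc δ * L ≤ c₀ / (2 * L) * L := by gcongr
        _ = c₀ / 2 := by field_simp
    have h2 : (s x x - δ) * (p x x - δ) ≥ s x x * p x x - δ * (1 + P) := by nlinarith
    have h3 : (Q + δ) * r x * (N - (s x x - δ) * (p x x - δ)) ≤
        r x * Q * (N - s x x * p x x) + δ * (R * N + B * (1 + P)) := by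
      have hβ0 : 0 ≤ (Q + δ) * r x := by positivity
      calc (Q + δ) * r x * (N - (s x x - δ) * (p x x - δ))
          ≤ (Q + δ) * r x * (N - s x x * p x x + δ * (1 + P)) := by gcongr; linarith
        _ = r x * Q * (N - s x x * p x x) + δ * (r x * (N - s x x * p x x)) +
            δ * ((Q + δ) * r x * (1 + P)) := by ring
        _ ≤ r x * Q * (N - s x x * p x x) + δ * (R * N) + δ * (B * (1 + P)) := by
            have h4 : 0 < s x x * p x x := mul_pos (hspos x) (hppos x)
            have h5 : 0 ≤ N - s x x * p x x := by linarith [hsp x]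
            gcongr
            linarith
        _ = _ := by ring
    have h6 : c₀ / 2 ≤ N * (p x x - δ) - (Q + δ) * r x * (N - (s x x - δ) * (p x x - δ)) := by
      have : δ * L = δ * N + δ * (R * N + B * (1 + P)) := by simp only [L]; ring
      nlinarith
    have h7 : (s x x - δ) * ((Q + δ) * r x) - N * ((Q + δ) * r x / (p x x - δ)) + N =
        (N * (p x x - δ) - (Q + δ) * r x * (N - (s x x - δ) * (p x x - δ))) / (p x x - δ) := by
      field_simp
      ring
    rw [h7, ← div_div, le_div_iff₀ (by linarith)]
    refine le_trans ?_ h6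
    rw [div_mul_eq_mul_div, div_le_iff₀ (by linarith)]
    gcongr
    linarith

end SubcriticalExponents

section Space

lemma inf2_le {g : RN N → RN N → ℝ} (hg : 0 < inf2 g) (x y : RN N) : inf2 g ≤ g x y := by
  refine csInf_le ?_ ⟨x, y, rfl⟩
  by_contra hb
  exact hg.ne' (Real.sInf_of_not_bddBelow hb)

lemma le_sup2 {g : RN N → RN N → ℝ} (hg : BddAbove {t | ∃ x y, g x y = t}) (x y : RN N) :
    g x y ≤ sup2 g :=
  le_csSup hg ⟨x, y, rfl⟩

lemma infOn_le {D : Set (RN N)} {g : RN N → ℝ} (hg : 0 < infOn D g) {x : RN N} (hx : x ∈ D) :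
    infOn D g ≤ g x := by
  refine csInf_le ?_ (mem_image_of_mem g hx)
  by_contra hb
  exact hg.ne' (Real.sInf_of_not_bddBelow hb)

variable {s p : RN N → RN N → ℝ}

lemma exponents_of_S1_of_P1 (hs : S1 s) (hp : P1 s p) :
    Exponents s p (inf2 s) (inf2 p) (sup2 p) where
  s_cont := hs.1
  p_cont := hp.1.1
  s_pos := hs.2.2.2.1
  s_ge := inf2_le hs.2.2.2.1
  s_le x y := (le_sup2 hs.2.2.1 x y).trans hs.2.2.2.2.le
  p_one := hp.1.2.1
  p_ge := inf2_le (zero_lt_one.trans hp.1.2.1)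
  p_le := le_sup2 hp.1.2.2

variable {s₀ p₀ P : ℝ} {Ω : Set (RN N)}

lemma MemX0.gagEnergy_lt_top (h : Exponents s p s₀ p₀ P) (hΩ : MeasurableSet Ω)
    {b u : RN N → ℝ} (hu : MemX0 Ω s p b u) : gagEnergy s p u < ⊤ := by
  obtain ⟨-, -, ⟨l, hl, h1⟩, h0⟩ := hu
  rw [gmodular_Qset h hΩ h0, gmodular_univ h u hl] at h1
  have h2 := gagEnergy_mul_lt_top h hl.le h1
  have h3 : (fun x => l * (u x / l)) = u := by ext x; field_simp
  rwa [h3] at h2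

lemma memX0_of_gagEnergy_lt_top (h : Exponents s p s₀ p₀ P) (hΩ : MeasurableSet Ω)
    {b u : RN N → ℝ} (hm : Measurable u) (hu0 : ∀ᵐ x, x ∉ Ω → u x = 0)
    (hu : gagEnergy s p u < ⊤) (hb : ∫⁻ x in Ω, ‖u x‖ₑ ^ b x < ⊤) : MemX0 Ω s p b u := by
  refine ⟨hm, ⟨hm, 1, one_pos, ?_⟩, ⟨1, one_pos, ?_⟩, hu0⟩
  · simpa [lmodular, Real.enorm_eq_ofReal_abs] using hb
  · rw [gmodular_Qset h hΩ hu0, gmodular_univ h u one_pos]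
    simpa using hu

lemma x0Norm_nonneg (s p : RN N → RN N → ℝ) (u : RN N → ℝ) : 0 ≤ x0Norm s p u :=
  Real.sInf_nonneg fun _ hl => hl.1.le

lemma x0Norm_le (h : Exponents s p s₀ p₀ P) {u : RN N → ℝ} {l : ℝ} (hl : 0 < l)
    (hu : gagEnergy s p (fun x => u x / l) < 1) : x0Norm s p u ≤ l := by
  refine csInf_le ⟨0, fun _ h => h.1.le⟩ ⟨hl, ?_⟩
  rwa [gmodular_univ h u hl]

lemma x0Norm_div_le_one (h : Exponents s p s₀ p₀ P) {u : RN N → ℝ} {l : ℝ} (hl : 1 ≤ l)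
    (hu : gagEnergy s p u < ENNReal.ofReal l) : x0Norm s p (fun x => u x / l) ≤ 1 := by
  have hl0 : 0 < l := by linarith
  refine x0Norm_le h one_pos ?_
  have h1 : gagEnergy s p (fun x => l⁻¹ * u x) ≤ ENNReal.ofReal l⁻¹ * gagEnergy s p u :=
    gagEnergy_mul_le u (by positivity) fun x y => by
      have := Real.rpow_le_rpow_of_exponent_ge (inv_pos.2 hl0) (inv_le_one_of_one_le₀ hl)
        (h.one_lt x y).le
      rwa [Real.rpow_one] at this
  have h2 : (fun x => u x / l / 1) = fun x => l⁻¹ * u x := by ext x; rw [div_one, div_eq_inv_mul]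
  rw [h2]
  refine h1.trans_lt ?_
  calc ENNReal.ofReal l⁻¹ * gagEnergy s p u < ENNReal.ofReal l⁻¹ * ENNReal.ofReal l :=
        ENNReal.mul_lt_mul_right (by simpa using hl0) ENNReal.ofReal_ne_top hu
    _ = 1 := by
        rw [← ENNReal.ofReal_mul (by positivity), inv_mul_cancel₀ hl0.ne', ENNReal.ofReal_one]

lemma tendsto_x0Norm (h : Exponents s p s₀ p₀ P) {w : ℕ → RN N → ℝ}
    (hw : Tendsto (fun k => gagEnergy s p (w k)) atTop (nhds 0)) :
    Tendsto (fun k => x0Norm s p (w k)) atTop (nhds 0) := by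
  rw [Metric.tendsto_atTop']
  intro ε hε
  set l := min (ε / 2) 1
  have hl : 0 < l := lt_min (by linarith) one_pos
  have h1 : Tendsto (fun k => ENNReal.ofReal ((l⁻¹) ^ P) * gagEnergy s p (w k)) atTop (nhds 0) := by
    simpa using ENNReal.Tendsto.const_mul hw (Or.inr ENNReal.ofReal_ne_top)
  obtain ⟨n, hn⟩ := eventually_atTop.1 (h1.eventually_lt_const one_pos)
  refine ⟨n, fun k hk => ?_⟩
  have h2 : x0Norm s p (w k) ≤ l := by
    refine x0Norm_le h hl (lt_of_le_of_lt ?_ (hn k hk.le))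
    have h3 : (fun x => w k x / l) = fun x => l⁻¹ * w k x := by ext x; rw [div_eq_inv_mul]
    rw [h3]
    exact gagEnergy_mul_le _ (by positivity) fun x y =>
      Real.rpow_le_rpow_of_exponent_le (one_le_inv_iff₀.2 ⟨hl, min_le_right _ _⟩) (h.p_le x y)
  rw [Real.dist_eq, sub_zero, abs_of_nonneg (x0Norm_nonneg _ _ _)]
  exact h2.trans_lt ((min_le_left _ _).trans_lt (by linarith))

end Space

section Vitali

variable {α : Type*} [MeasurableSpace α] {ν : Measure α} [IsFiniteMeasure ν]

/-- Boundedness of a higher power upgrades a.e. convergence to convergence of integrals. -/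
lemma tendsto_lintegral_rpow_zero {g : ℕ → α → ℝ≥0∞} (hg : ∀ m, Measurable (g m))
    (h0 : ∀ᵐ x ∂ν, Tendsto (fun m => g m x) atTop (nhds 0)) {a A : ℝ} (ha : 0 < a) (haA : a < A)
    {C : ℝ≥0∞} (hC : C ≠ ⊤) (hgC : ∀ m, ∫⁻ x, g m x ^ A ∂ν ≤ C) :
    Tendsto (fun m => ∫⁻ x, g m x ^ a ∂ν) atTop (nhds 0) := by
  have hsplit : ∀ t : ℝ≥0∞, ∀ L : ℝ, 0 < L →
      t ^ a ≤ min (t ^ a) (ENNReal.ofReal (L ^ a)) + ENNReal.ofReal (L ^ (a - A)) * t ^ A := by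
    intro t L hL
    rcases le_total (t ^ a) (ENNReal.ofReal (L ^ a)) with hc | hc
    · rw [min_eq_left hc]; exact le_self_add
    · refine le_add_of_le_right ?_
      rw [← ENNReal.ofReal_rpow_of_pos hL] at hc ⊢
      have hLt : ENNReal.ofReal L ≤ t := (ENNReal.rpow_le_rpow_iff ha).1 hc
      have hL0 : ENNReal.ofReal L ≠ 0 := by simpa using hL
      calc t ^ a = ENNReal.ofReal L ^ (a - A) * (ENNReal.ofReal L ^ (A - a) * t ^ a) := by
            rw [← mul_assoc, ← ENNReal.rpow_add _ _ hL0 ENNReal.ofReal_ne_top]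
            simp
        _ ≤ ENNReal.ofReal L ^ (a - A) * (t ^ (A - a) * t ^ a) := by
            gcongr
        _ = _ := by
            rw [← ENNReal.rpow_add_of_nonneg _ _ (by linarith) ha.le]
            simp
  rw [ENNReal.tendsto_nhds_zero]
  intro ε hε
  have hε2 : 0 < ε / 2 := ENNReal.half_pos hε.ne'
  have hlim : Tendsto (fun L : ℝ => ENNReal.ofReal (L ^ (a - A)) * C) atTop (nhds 0) := by
    have h1 := tendsto_rpow_neg_atTop (sub_pos.2 haA)
    rw [neg_sub] at h1
    have h2 := ENNReal.tendsto_ofReal h1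
    rw [ENNReal.ofReal_zero] at h2
    simpa using ENNReal.Tendsto.mul_const h2 (Or.inr hC)
  obtain ⟨L, hL1, hL0⟩ := ((ENNReal.tendsto_nhds_zero.1 hlim _ hε2).and
    (eventually_gt_atTop 0)).exists
  have hmin : Tendsto (fun m => ∫⁻ x, min (g m x ^ a) (ENNReal.ofReal (L ^ a)) ∂ν) atTop
      (nhds 0) := by
    have h1 := tendsto_lintegral_of_dominated_convergence (μ := ν)
      (F := fun m x => min (g m x ^ a) (ENNReal.ofReal (L ^ a))) (f := fun _ => 0)
      (fun _ => ENNReal.ofReal (L ^ a))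
      (fun m => ((hg m).pow_const a).min measurable_const)
      (fun m => ae_of_all _ fun x => min_le_right _ _)
      (by
        rw [lintegral_const]
        exact ENNReal.mul_ne_top ENNReal.ofReal_ne_top (measure_ne_top _ _))
      (by
        filter_upwards [h0] with x hx
        have h2 := ((ENNReal.continuous_rpow_const (y := a)).tendsto 0).comp hx
        rw [ENNReal.zero_rpow_of_pos ha] at h2
        have h3 := h2.min (tendsto_const_nhds (x := ENNReal.ofReal (L ^ a)))
        simpa using h3)
    simpa using h1
  filter_upwards [ENNReal.tendsto_nhds_zero.1 hmin _ hε2] with m hm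
  calc ∫⁻ x, g m x ^ a ∂ν
      ≤ ∫⁻ x, (min (g m x ^ a) (ENNReal.ofReal (L ^ a)) +
          ENNReal.ofReal (L ^ (a - A)) * g m x ^ A) ∂ν :=
        lintegral_mono fun x => hsplit _ L hL0
    _ = ∫⁻ x, min (g m x ^ a) (ENNReal.ofReal (L ^ a)) ∂ν +
          ENNReal.ofReal (L ^ (a - A)) * ∫⁻ x, g m x ^ A ∂ν := by
        rw [lintegral_add_left (((hg m).pow_const a).min measurable_const),
          lintegral_const_mul' _ _ ENNReal.ofReal_ne_top]
    _ ≤ ε / 2 + ε / 2 := add_le_add hm ((mul_le_mul_right (hgC m) _).trans hL1)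
    _ = ε := ENNReal.add_halves ε

end Vitali

section DoubleIntegral

open scoped Topology

/-- Weighted arithmetic-geometric mean inequality behind the Hardy-Littlewood-Sobolev bound. -/
lemma mul_mul_le_add_rpow (H G κ : ℝ≥0∞) {a b : ℝ} (ha : 1 < a) (ha2 : a ≤ 2)
    (hb : b * (2 - 2 / a) = 1) :
    H * G * κ ≤ H ^ a * G ^ a + (H ^ a * κ ^ b + G ^ a * κ ^ b) := by
  have ha0 : 0 < a := by linarith
  have hb' : 0 < 2 - 2 / a := by
    rw [sub_pos, div_lt_iff₀ ha0]; linarith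
  have hb0 : 0 < b := by
    by_contra hcon
    nlinarith
  have hα : 0 ≤ 2 / a - 1 := by rw [sub_nonneg, le_div_iff₀ ha0]; linarith
  have hβ : 0 ≤ 1 - 1 / a := by rw [sub_nonneg, div_le_iff₀ ha0]; linarith
  set S := H ^ a * G ^ a + (H ^ a * κ ^ b + G ^ a * κ ^ b)
  have e1 : a * (2 / a - 1) + a * (1 - 1 / a) = 1 := by field_simp; ring
  have e2 : b * (1 - 1 / a) + b * (1 - 1 / a) = 1 := by
    calc _ = b * (2 - 2 / a) := by ring
      _ = 1 := hb
  have h1 : H * G * κ = (H ^ a * G ^ a) ^ (2 / a - 1) * (H ^ a * κ ^ b) ^ (1 - 1 / a) *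
      (G ^ a * κ ^ b) ^ (1 - 1 / a) := by
    have hx : ∀ x : ℝ≥0∞, x = x ^ (a * (2 / a - 1)) * x ^ (a * (1 - 1 / a)) := fun x => by
      rw [← ENNReal.rpow_add_of_nonneg _ _ (by positivity) (by positivity), e1, ENNReal.rpow_one]
    have hk : κ = κ ^ (b * (1 - 1 / a)) * κ ^ (b * (1 - 1 / a)) := by
      rw [← ENNReal.rpow_add_of_nonneg _ _ (by positivity) (by positivity), e2, ENNReal.rpow_one]
    rw [ENNReal.mul_rpow_of_nonneg _ _ hα, ENNReal.mul_rpow_of_nonneg _ _ hβ,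
      ENNReal.mul_rpow_of_nonneg _ _ hβ]
    simp only [← ENNReal.rpow_mul]
    conv_lhs => rw [hx H, hx G, hk]
    ring
  rw [h1]
  calc (H ^ a * G ^ a) ^ (2 / a - 1) * (H ^ a * κ ^ b) ^ (1 - 1 / a) *
      (G ^ a * κ ^ b) ^ (1 - 1 / a)
      ≤ S ^ (2 / a - 1) * S ^ (1 - 1 / a) * S ^ (1 - 1 / a) := by
        refine mul_le_mul' (mul_le_mul' (ENNReal.rpow_le_rpow ?_ hα)
          (ENNReal.rpow_le_rpow ?_ hβ)) (ENNReal.rpow_le_rpow ?_ hβ)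
        · exact le_self_add
        · exact le_add_left le_self_add
        · exact le_add_left le_add_self
    _ = S := by
        rw [← ENNReal.rpow_add_of_nonneg _ _ hα hβ, ← ENNReal.rpow_add_of_nonneg _ _ (by linarith) hβ]
        convert ENNReal.rpow_one S using 2
        ring

variable {α : Type*} [MeasurableSpace α] {ν : Measure α} [SFinite ν]

lemma lintegral_lintegral_mul_le {H G : α → ℝ≥0∞} {κ : α → α → ℝ≥0∞} (hH : Measurable H)
    (hG : Measurable G) (hκ : Measurable (Function.uncurry κ)) {a b : ℝ} (ha : 1 < a)
    (ha2 : a ≤ 2) (hb : b * (2 - 2 / a) = 1) {K : ℝ≥0∞} (hK : ∀ᵐ x ∂ν, ∫⁻ y, κ x y ^ b ∂ν ≤ K)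
    (hK' : ∀ᵐ y ∂ν, ∫⁻ x, κ x y ^ b ∂ν ≤ K) :
    ∫⁻ x, ∫⁻ y, H x * G y * κ x y ∂ν ∂ν ≤
      (∫⁻ x, H x ^ a ∂ν) * ∫⁻ y, G y ^ a ∂ν +
        K * (∫⁻ x, H x ^ a ∂ν + ∫⁻ y, G y ^ a ∂ν) := by
  have hκx : ∀ x, Measurable fun y => κ x y ^ b := fun x => by
    have := hκ.comp (measurable_prodMk_left (x := x)); exact this.pow_const b
  have hκy : ∀ y, Measurable fun x => κ x y ^ b := fun y => by
    have := hκ.comp (measurable_prodMk_right (y := y)); exact this.pow_const b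
  have hm1 : Measurable fun z : α × α => H z.1 ^ a * G z.2 ^ a := by fun_prop
  have hm2 : Measurable fun z : α × α => H z.1 ^ a * κ z.1 z.2 ^ b :=
    ((hH.comp measurable_fst).pow_const a).mul (hκ.pow_const b)
  have hm3 : Measurable fun z : α × α => G z.2 ^ a * κ z.1 z.2 ^ b :=
    ((hG.comp measurable_snd).pow_const a).mul (hκ.pow_const b)
  calc ∫⁻ x, ∫⁻ y, H x * G y * κ x y ∂ν ∂ν
      ≤ ∫⁻ x, ∫⁻ y, (H x ^ a * G y ^ a + (H x ^ a * κ x y ^ b + G y ^ a * κ x y ^ b)) ∂ν ∂ν :=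
        lintegral_mono fun x => lintegral_mono fun y => mul_mul_le_add_rpow _ _ _ ha ha2 hb
    _ = ∫⁻ x, ∫⁻ y, H x ^ a * G y ^ a ∂ν ∂ν + (∫⁻ x, ∫⁻ y, H x ^ a * κ x y ^ b ∂ν ∂ν +
          ∫⁻ x, ∫⁻ y, G y ^ a * κ x y ^ b ∂ν ∂ν) := by
        rw [← lintegral_add_left hm2.lintegral_prod_right', ← lintegral_add_left
          hm1.lintegral_prod_right']
        refine lintegral_congr fun x => ?_
        rw [lintegral_add_left ((hG.pow_const a).const_mul (H x ^ a)),
          lintegral_add_left ((hκx x).const_mul (H x ^ a))]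
    _ ≤ _ := by
        rw [lintegral_lintegral_swap (f := fun x y => G y ^ a * κ x y ^ b) hm3.aemeasurable,
          mul_add]
        refine add_le_add (le_of_eq ?_) (add_le_add ?_ ?_)
        · simp_rw [lintegral_const_mul _ (hG.pow_const a)]
          rw [lintegral_mul_const _ (hH.pow_const a)]
        · rw [← lintegral_const_mul _ (hH.pow_const a)]
          refine lintegral_mono_ae ?_
          filter_upwards [hK] with x hx
          rw [lintegral_const_mul _ (hκx x), mul_comm]
          exact mul_le_mul_left hx _
        · rw [← lintegral_const_mul _ (hG.pow_const a)]
          refine lintegral_mono_ae ?_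
          filter_upwards [hK'] with x hx
          rw [lintegral_const_mul _ (hκy x), mul_comm]
          exact mul_le_mul_left hx _

lemma tendsto_lintegral_lintegral_mul {H G : ℕ → α → ℝ≥0∞} {κ : α → α → ℝ≥0∞}
    (hH : ∀ m, Measurable (H m)) (hG : ∀ m, Measurable (G m))
    (hκ : Measurable (Function.uncurry κ)) {a b : ℝ} (ha : 1 < a)
    (ha2 : a ≤ 2) (hb : b * (2 - 2 / a) = 1) {K C : ℝ≥0∞} (hKt : K ≠ ⊤) (hC : C ≠ ⊤)
    (hK : ∀ᵐ x ∂ν, ∫⁻ y, κ x y ^ b ∂ν ≤ K) (hK' : ∀ᵐ y ∂ν, ∫⁻ x, κ x y ^ b ∂ν ≤ K)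
    (hHC : ∀ m, ∫⁻ x, H m x ^ a ∂ν ≤ C)
    (hG0 : Tendsto (fun m => ∫⁻ x, G m x ^ a ∂ν) atTop (𝓝 0)) :
    Tendsto (fun m => ∫⁻ x, ∫⁻ y, H m x * G m y * κ x y ∂ν ∂ν) atTop (𝓝 0) := by
  have ha0 : 0 < a := by linarith
  have hbound : ∀ m, ∀ t : ℝ≥0∞, t ≠ 0 → t ≠ ⊤ →
      ∫⁻ x, ∫⁻ y, H m x * G m y * κ x y ∂ν ∂ν ≤ C * ∫⁻ x, G m x ^ a ∂ν +
        K * (t ^ a * C + (t⁻¹) ^ a * ∫⁻ x, G m x ^ a ∂ν) := by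
    intro m t ht0 ht
    have h1 := lintegral_lintegral_mul_le (ν := ν) (H := fun x => t * H m x)
      (G := fun y => t⁻¹ * G m y) ((hH m).const_mul t) ((hG m).const_mul _) hκ ha ha2 hb hK hK'
    simp only [ENNReal.mul_rpow_of_nonneg _ _ ha0.le] at h1
    rw [lintegral_const_mul _ ((hH m).pow_const a), lintegral_const_mul _ ((hG m).pow_const a)]
      at h1
    have h2 : ∀ x y, t * H m x * (t⁻¹ * G m y) * κ x y = H m x * G m y * κ x y := fun x y => by
      rw [show t * H m x * (t⁻¹ * G m y) * κ x y = (t * t⁻¹) * (H m x * G m y * κ x y) by ring,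
        ENNReal.mul_inv_cancel ht0 ht, one_mul]
    have h3 : t ^ a * t⁻¹ ^ a = 1 := by
      rw [← ENNReal.mul_rpow_of_nonneg _ _ ha0.le, ENNReal.mul_inv_cancel ht0 ht,
        ENNReal.one_rpow]
    simp only [h2] at h1
    refine h1.trans (add_le_add ?_ (mul_le_mul_right (add_le_add (mul_le_mul_right (hHC m) _)
      le_rfl) _))
    rw [mul_mul_mul_comm, h3, one_mul]
    exact mul_le_mul_left (hHC m) _
  rw [ENNReal.tendsto_nhds_zero]
  intro ε hε
  have hε2 : 0 < ε / 2 := ENNReal.half_pos hε.ne'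
  have hsmall : Tendsto (fun n : ℕ => K * (((n : ℝ≥0∞)⁻¹) ^ a * C)) atTop (𝓝 0) := by
    have h1 := ((ENNReal.continuous_rpow_const (y := a)).tendsto 0).comp
      ENNReal.tendsto_inv_nat_nhds_zero
    rw [ENNReal.zero_rpow_of_pos ha0] at h1
    have h2 := ENNReal.Tendsto.const_mul (a := K)
      (ENNReal.Tendsto.mul_const (b := C) h1 (Or.inr hC)) (Or.inr hKt)
    simpa using h2
  obtain ⟨n, hn, hn0⟩ := ((ENNReal.tendsto_nhds_zero.1 hsmall _ hε2).and
    (eventually_gt_atTop 0)).exists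
  have ht0 : ((n : ℝ≥0∞)⁻¹) ≠ 0 := by simp
  have ht : ((n : ℝ≥0∞)⁻¹) ≠ ⊤ := by simpa using hn0.ne'
  have hrest : Tendsto (fun m => C * ∫⁻ x, G m x ^ a ∂ν +
      K * ((((n : ℝ≥0∞)⁻¹)⁻¹) ^ a * ∫⁻ x, G m x ^ a ∂ν)) atTop (𝓝 0) := by
    have h1 := ENNReal.Tendsto.const_mul (a := C) hG0 (Or.inr hC)
    have h2 := ENNReal.Tendsto.const_mul (a := K) (ENNReal.Tendsto.const_mul
      (a := (((n : ℝ≥0∞)⁻¹)⁻¹) ^ a) hG0 (Or.inr (ENNReal.rpow_ne_top_of_nonneg ha0.le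
        (by simp)))) (Or.inr hKt)
    simpa using h1.add h2
  filter_upwards [ENNReal.tendsto_nhds_zero.1 hrest _ hε2] with m hm
  calc _ ≤ _ := hbound m _ ht0 ht
    _ = K * (((n : ℝ≥0∞)⁻¹) ^ a * C) + (C * ∫⁻ x, G m x ^ a ∂ν +
      K * ((((n : ℝ≥0∞)⁻¹)⁻¹) ^ a * ∫⁻ x, G m x ^ a ∂ν)) := by rw [mul_add]; ring
    _ ≤ ε / 2 + ε / 2 := add_le_add hn hm
    _ = ε := ENNReal.add_halves ε

end DoubleIntegral

section Kernel

lemma exists_lintegral_kernel_le (hN : 0 < N) {Ω : Set (RN N)} (hΩ : Bornology.IsBounded Ω)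
    (hΩm : MeasurableSet Ω) {μ : RN N → RN N → ℝ} (hμ : ∀ x y, 0 < μ x y) {b τ : ℝ} (hb : 0 ≤ b)
    (hbμ : ∀ x y, μ x y * b ≤ τ) (hτ : τ < N) :
    ∃ K : ℝ≥0∞, K ≠ ⊤ ∧
      (∀ x ∈ Ω, ∫⁻ y in Ω, ‖(dist x y ^ μ x y)⁻¹‖ₑ ^ b ≤ K) ∧
      ∀ y ∈ Ω, ∫⁻ x in Ω, ‖(dist x y ^ μ x y)⁻¹‖ₑ ^ b ≤ K := by
  obtain ⟨D, hD⟩ := hΩ.subset_ball 0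
  set k : RN N → ℝ≥0∞ := fun z => (Metric.ball (0 : RN N) (2 * D)).indicator
    (fun z => ‖‖z‖ ^ (-τ)‖ₑ) z with hk
  have hkm : Measurable k := by
    refine Measurable.indicator ?_ measurableSet_ball
    fun_prop
  have hkfin : ∫⁻ z, k z < ⊤ := by
    rw [hk, lintegral_indicator measurableSet_ball]
    have h1 : IntegrableOn (fun z : RN N => ‖z‖ ^ (-τ)) (Metric.ball 0 (2 * D)) := by
      refine integrableOn_ball_of_norm_le_rpow (C := 1) (α := τ) (by simpa using Nat.one_le_iff_ne_zero.2 hN.ne')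
        (by simpa using hτ) (ae_of_all _ fun z => ?_) ?_
      · rw [Real.norm_of_nonneg (by positivity), one_mul]
      · exact Measurable.aestronglyMeasurable (by fun_prop)
    exact h1.2
  have hpt : ∀ x ∈ Ω, ∀ y ∈ Ω, ‖(dist x y ^ μ x y)⁻¹‖ₑ ^ b ≤ 1 + k (x - y) := by
    intro x hx y hy
    have hxy : x - y ∈ Metric.ball (0 : RN N) (2 * D) := by
      have h1 := hD hx
      have h2 := hD hy
      rw [mem_ball_zero_iff] at *
      linarith [norm_sub_le x y]
    rw [hk]
    simp only [indicator_of_mem hxy]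
    have hd : dist x y = ‖x - y‖ := dist_eq_norm _ _
    rw [hd]
    set d := ‖x - y‖ with hdd
    have hd0 : 0 ≤ d := norm_nonneg _
    rcases hd0.eq_or_lt with h0 | h0
    · rw [← h0, Real.zero_rpow (hμ x y).ne']
      simp only [_root_.inv_zero, enorm_zero]
      rcases hb.eq_or_lt with hb0 | hb0
      · rw [← hb0]; simp
      · rw [ENNReal.zero_rpow_of_pos hb0]; exact zero_le
    · rw [Real.enorm_of_nonneg (by positivity), Real.enorm_of_nonneg (by positivity),
        ENNReal.ofReal_rpow_of_nonneg (by positivity) hb, ← Real.rpow_neg hd0,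
        ← Real.rpow_mul hd0, ← ENNReal.ofReal_one,
        ← ENNReal.ofReal_add zero_le_one (by positivity)]
      refine ENNReal.ofReal_le_ofReal ?_
      rcases le_total d 1 with h1 | h1
      · have := Real.rpow_le_rpow_of_exponent_ge h0 h1
          (show -τ ≤ -μ x y * b by linarith [hbμ x y])
        linarith
      · have := Real.rpow_le_one_of_one_le_of_nonpos h1
          (show -μ x y * b ≤ 0 by nlinarith [hμ x y])
        have : 0 ≤ d ^ (-τ) := by positivity
        linarith
  refine ⟨volume Ω + ∫⁻ z, k z, ENNReal.add_ne_top.2 ⟨hΩ.measure_lt_top.ne, hkfin.ne⟩,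
    fun x hx => ?_, fun y hy => ?_⟩
  · calc ∫⁻ y in Ω, ‖(dist x y ^ μ x y)⁻¹‖ₑ ^ b ≤ ∫⁻ y in Ω, (1 + k (x - y)) :=
          setLIntegral_mono' hΩm fun y hy => hpt x hx y hy
      _ ≤ _ := by
          rw [lintegral_add_left measurable_const, setLIntegral_one]
          exact add_le_add le_rfl ((setLIntegral_le_lintegral _ _).trans
            (lintegral_sub_left_eq_self k x).le)
  · calc ∫⁻ x in Ω, ‖(dist x y ^ μ x y)⁻¹‖ₑ ^ b ≤ ∫⁻ x in Ω, (1 + k (x - y)) :=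
          setLIntegral_mono' hΩm fun x hx => hpt x hx y hy
      _ ≤ _ := by
          rw [lintegral_add_left measurable_const, setLIntegral_one]
          exact add_le_add le_rfl ((setLIntegral_le_lintegral _ _).trans
            (lintegral_sub_right_eq_self k y).le)

end Kernel

section Nonlinearity

open scoped Topology

variable {Ω : Set (RN N)} {f : RN N → ℝ → ℝ} {M : ℝ} {r : RN N → ℝ}

lemma Caratheodory.measurable_uncurry (hf : Caratheodory f) :
    Measurable fun z : ℝ × RN N => f z.2 z.1 :=
  measurable_uncurry_of_continuous_of_measurable (u := fun t x => f x t) hf.2 hf.1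

lemma Caratheodory.measurable_comp (hf : Caratheodory f) {u : RN N → ℝ} (hu : Measurable u) :
    Measurable fun x => f x (u x) :=
  hf.measurable_uncurry.comp (hu.prodMk measurable_id)

lemma Caratheodory.measurable_Fant_comp (hf : Caratheodory f) {u : RN N → ℝ}
    (hu : Measurable u) : Measurable fun x => Fant f x (u x) := by
  have h1 : ∀ x, Fant f x (u x) = u x * ∫ τ in Ioc (0 : ℝ) 1, f x (u x * τ) := fun x => by
    rw [← intervalIntegral.integral_of_le zero_le_one, intervalIntegral.mul_integral_comp_mul_left,
      mul_zero, mul_one]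
    rfl
  simp_rw [h1]
  refine hu.mul (StronglyMeasurable.measurable ?_)
  refine StronglyMeasurable.integral_prod_right' (f := fun z : RN N × ℝ => f z.1 (u z.1 * z.2)) ?_
  refine Measurable.stronglyMeasurable ?_
  exact hf.measurable_uncurry.comp
    (((hu.comp measurable_fst).mul measurable_snd).prodMk measurable_fst)

lemma F1.abs_Fant_le (h1 : F1 Ω f M r) {x : RN N} (hx : x ∈ Ω) (hr : 1 < r x) (t : ℝ) :
    |Fant f x t| ≤ M * |t| ^ r x := by
  have h2 : ∀ τ ∈ uIoc 0 t, ‖f x τ‖ ≤ M * |t| ^ (r x - 1) := by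
    intro τ hτ
    have h3 : |τ| ≤ |t| := by
      rcases le_total 0 t with h0 | h0
      · rw [uIoc_of_le h0] at hτ
        rw [abs_of_pos hτ.1, abs_of_nonneg h0]; exact hτ.2
      · rw [uIoc_of_ge h0] at hτ
        rw [abs_of_nonpos hτ.2, abs_of_nonpos h0]; linarith [hτ.1]
    refine (h1.2 x hx τ).trans (mul_le_mul_of_nonneg_left ?_ h1.1.le)
    exact Real.rpow_le_rpow (abs_nonneg _) h3 (by linarith)
  have h4 := intervalIntegral.norm_integral_le_of_norm_le_const h2
  rw [sub_zero, mul_assoc, ← Real.rpow_add_one' (abs_nonneg t) (by linarith),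
    sub_add_cancel] at h4
  exact h4

lemma F1.enorm_Fant_rpow_le (h1 : F1 Ω f M r) {x : RN N} (hx : x ∈ Ω) (hr : 1 < r x) (t : ℝ)
    {A : ℝ} (hA : 0 < A) :
    ‖Fant f x t‖ₑ ^ A ≤ ENNReal.ofReal M ^ A * ‖t‖ₑ ^ (A * r x) := by
  rw [mul_comm A, ENNReal.rpow_mul, ← ENNReal.mul_rpow_of_nonneg _ _ hA.le]
  refine ENNReal.rpow_le_rpow ?_ hA.le
  rw [Real.enorm_eq_ofReal_abs, Real.enorm_eq_ofReal_abs,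
    ENNReal.ofReal_rpow_of_nonneg (abs_nonneg _) (by linarith), ← ENNReal.ofReal_mul h1.1.le]
  exact ENNReal.ofReal_le_ofReal (h1.abs_Fant_le hx hr t)

lemma F1.enorm_mul_rpow_le (h1 : F1 Ω f M r) {x : RN N} (hx : x ∈ Ω) (hr : 1 < r x) (t w : ℝ)
    {A : ℝ} (hA : 0 < A) :
    ‖f x t * w‖ₑ ^ A ≤ ENNReal.ofReal M ^ A * (‖t‖ₑ ^ (A * r x) + ‖w‖ₑ ^ (A * r x)) := by
  have h2 : ‖f x t * w‖ₑ ≤ ENNReal.ofReal M * (max ‖t‖ₑ ‖w‖ₑ) ^ r x := by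
    set m := max |t| |w| with hm
    have hm0 : 0 ≤ m := (abs_nonneg t).trans (le_max_left _ _)
    have h3 : |f x t * w| ≤ M * m ^ r x := by
      rw [abs_mul]
      calc |f x t| * |w| ≤ (M * |t| ^ (r x - 1)) * |w| :=
            mul_le_mul_of_nonneg_right (h1.2 x hx t) (abs_nonneg _)
        _ ≤ (M * m ^ (r x - 1)) * m := by
            have := h1.1
            refine mul_le_mul (mul_le_mul_of_nonneg_left (Real.rpow_le_rpow (abs_nonneg _)
              (le_max_left _ _) (by linarith)) this.le) (le_max_right _ _) (abs_nonneg _)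
              (by positivity)
        _ = M * m ^ r x := by
            rw [mul_assoc, ← Real.rpow_add_one' hm0 (by linarith), sub_add_cancel]
    have h4 : max ‖t‖ₑ ‖w‖ₑ = ENNReal.ofReal m := by
      rw [Real.enorm_eq_ofReal_abs, Real.enorm_eq_ofReal_abs, hm, ENNReal.ofReal_max]
    rw [h4, Real.enorm_eq_ofReal_abs, ENNReal.ofReal_rpow_of_nonneg hm0 (by linarith),
      ← ENNReal.ofReal_mul h1.1.le]
    exact ENNReal.ofReal_le_ofReal h3
  refine (ENNReal.rpow_le_rpow h2 hA.le).trans ?_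
  rw [ENNReal.mul_rpow_of_nonneg _ _ hA.le, ← ENNReal.rpow_mul, mul_comm (r x)]
  refine mul_le_mul_right ?_ _
  rcases max_choice ‖t‖ₑ ‖w‖ₑ with h3 | h3 <;> rw [h3]
  · exact le_self_add
  · exact le_add_self

lemma F1.lintegral_Fant_le (h1 : F1 Ω f M r) (hΩm : MeasurableSet Ω) (hr : ∀ x ∈ Ω, 1 < r x)
    {A : ℝ} (hA : 0 < A) (u : RN N → ℝ) {C : ℝ≥0∞} (hu : ∫⁻ x in Ω, ‖u x‖ₑ ^ (A * r x) ≤ C) :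
    ∫⁻ x in Ω, ‖Fant f x (u x)‖ₑ ^ A ≤ ENNReal.ofReal M ^ A * C := by
  calc ∫⁻ x in Ω, ‖Fant f x (u x)‖ₑ ^ A
      ≤ ∫⁻ x in Ω, ENNReal.ofReal M ^ A * ‖u x‖ₑ ^ (A * r x) :=
        setLIntegral_mono' hΩm fun x hx => h1.enorm_Fant_rpow_le hx (hr x hx) _ hA
    _ ≤ _ := by
        rw [lintegral_const_mul' _ _ (ENNReal.rpow_ne_top_of_nonneg hA.le ENNReal.ofReal_ne_top)]
        exact mul_le_mul_right hu _

lemma F1.lintegral_mul_le (h1 : F1 Ω f M r) (hΩm : MeasurableSet Ω) (hr : ∀ x ∈ Ω, 1 < r x)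
    (hrm : Measurable r) {A : ℝ} (hA : 0 < A) {u : RN N → ℝ} (hum : Measurable u) (w : RN N → ℝ)
    {C C' : ℝ≥0∞} (hu : ∫⁻ x in Ω, ‖u x‖ₑ ^ (A * r x) ≤ C)
    (hw : ∫⁻ x in Ω, ‖w x‖ₑ ^ (A * r x) ≤ C') :
    ∫⁻ x in Ω, ‖f x (u x) * w x‖ₑ ^ A ≤ ENNReal.ofReal M ^ A * (C + C') := by
  calc ∫⁻ x in Ω, ‖f x (u x) * w x‖ₑ ^ A
      ≤ ∫⁻ x in Ω, ENNReal.ofReal M ^ A * (‖u x‖ₑ ^ (A * r x) + ‖w x‖ₑ ^ (A * r x)) :=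
        setLIntegral_mono' hΩm fun x hx => h1.enorm_mul_rpow_le hx (hr x hx) _ _ hA
    _ ≤ _ := by
        rw [lintegral_const_mul' _ _ (ENNReal.rpow_ne_top_of_nonneg hA.le ENNReal.ofReal_ne_top),
          lintegral_add_left (hum.enorm.pow (hrm.const_mul A))]
        exact mul_le_mul_right (add_le_add hu hw) _

end Nonlinearity

section Riesz

open scoped Topology

/-- Integrability data for the variable-order Riesz kernel on `Ω`, adapted to the
exponent `a`. -/
structure RieszBound (Ω : Set (RN N)) (μ : RN N → RN N → ℝ) (a b : ℝ) (K : ℝ≥0∞) : Prop where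
  one_lt : 1 < a
  le_two : a ≤ 2
  conj : b * (2 - 2 / a) = 1
  meas : Measurable fun z : RN N × RN N => μ z.1 z.2
  ne_top : K ≠ ⊤
  left : ∀ x ∈ Ω, ∫⁻ y in Ω, ‖(dist x y ^ μ x y)⁻¹‖ₑ ^ b ≤ K
  right : ∀ y ∈ Ω, ∫⁻ x in Ω, ‖(dist x y ^ μ x y)⁻¹‖ₑ ^ b ≤ K

lemma exists_rieszBound (hN : 2 ≤ N) {Ω : Set (RN N)} (hΩ : Bornology.IsBounded Ω)
    (hΩm : MeasurableSet Ω) {μ q : RN N → RN N → ℝ} (hμ : Mu1 μ) (hq : CPlus2 q)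
    (hqμ : ∀ x y, 2 / q x y + μ x y / (N : ℝ) = 2) {A : ℝ} (hA : sup2 q < A) :
    ∃ a b K, a < A ∧ RieszBound Ω μ a b K := by
  have hN0 : (0 : ℝ) < N := by exact_mod_cast (by omega : 0 < N)
  have hq1 : ∀ x y, 1 < q x y := fun x y =>
    hq.2.1.trans_le (inf2_le (zero_lt_one.trans hq.2.1) x y)
  have hqs := le_sup2 hq.2.2
  have hQ1 : 1 < sup2 q := (hq1 0 0).trans_le (hqs 0 0)
  have hμe : ∀ x y, μ x y = N * (2 - 2 / q x y) := fun x y => by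
    rw [← eq_sub_of_add_eq' (hqμ x y), mul_div_cancel₀ _ hN0.ne']
  have hμ0 : ∀ x y, 0 < μ x y := fun x y => hμ.2.2.1.trans_le (inf2_le hμ.2.2.1 x y)
  have hQ2 : sup2 q < 2 := by
    have h1 : sup2 μ / N < 1 := (div_lt_one hN0).2 hμ.2.2.2
    have h2 : sup2 q ≤ 2 / (2 - sup2 μ / N) := by
      refine csSup_le ⟨_, 0, 0, rfl⟩ ?_
      rintro t ⟨x, y, rfl⟩
      have h3 : μ x y / N ≤ sup2 μ / N := by
        have := le_sup2 hμ.2.1 x y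
        gcongr
      have h4 := hq1 x y
      have h5 : 2 / q x y * q x y = 2 := by field_simp
      rw [le_div_iff₀ (by linarith)]
      nlinarith [hqμ x y]
    refine h2.trans_lt ?_
    rw [div_lt_iff₀ (by linarith)]
    linarith
  obtain ⟨a, ha1, ha2⟩ := exists_between (lt_min hA hQ2)
  have haA := ha2.trans_le (min_le_left _ _)
  have ha2 := ha2.trans_le (min_le_right _ _)
  have ha0 : 0 < a := by linarith
  have hpos : 0 < 2 - 2 / a := by rw [sub_pos, div_lt_iff₀ ha0]; linarith
  have hQa : 2 - 2 / sup2 q < 2 - 2 / a := by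
    have : 2 / a < 2 / sup2 q := by gcongr
    linarith
  obtain ⟨K, hK, hK1, hK2⟩ := exists_lintegral_kernel_le (by omega : 0 < N) hΩ hΩm hμ0
    (b := 1 / (2 - 2 / a)) (τ := N * (2 - 2 / sup2 q) / (2 - 2 / a)) (by positivity)
    (fun x y => by
      rw [mul_one_div, hμe]
      have h1 : 2 / sup2 q ≤ 2 / q x y := by
        have := hq1 x y
        have := hqs x y
        gcongr
      gcongr)
    (by
      rw [div_lt_iff₀ hpos]
      exact mul_lt_mul_of_pos_left hQa hN0)
  refine ⟨a, 1 / (2 - 2 / a), K, haA, by linarith, ha2.le, one_div_mul_cancel hpos.ne', ?_, hK, hK1, hK2⟩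
  have hqm := hq.1.measurable
  simp_rw [hμe]
  fun_prop

namespace RieszBound

variable {Ω : Set (RN N)} {μ : RN N → RN N → ℝ} {a b : ℝ} {K : ℝ≥0∞}

lemma measurable_kernel (hR : RieszBound Ω μ a b K) :
    Measurable fun z : RN N × RN N => dist z.1 z.2 ^ μ z.1 z.2 := by
  have := hR.meas
  fun_prop

lemma measurable_enorm (hR : RieszBound Ω μ a b K) :
    Measurable (Function.uncurry fun x y : RN N => ‖(dist x y ^ μ x y)⁻¹‖ₑ) :=
  hR.measurable_kernel.inv.enorm

lemma integrable (hR : RieszBound Ω μ a b K) (hΩm : MeasurableSet Ω) {g k : RN N → ℝ}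
    (hg : Measurable g) (hk : Measurable k) (hga : ∫⁻ x in Ω, ‖g x‖ₑ ^ a ≠ ⊤)
    (hka : ∫⁻ x in Ω, ‖k x‖ₑ ^ a ≠ ⊤) :
    Integrable (fun z : RN N × RN N => g z.1 * k z.2 / dist z.1 z.2 ^ μ z.1 z.2)
      ((volume.restrict Ω).prod (volume.restrict Ω)) := by
  have hm : Measurable fun z : RN N × RN N => g z.1 * k z.2 / dist z.1 z.2 ^ μ z.1 z.2 :=
    ((hg.comp measurable_fst).mul (hk.comp measurable_snd)).div hR.measurable_kernel
  refine ⟨hm.aestronglyMeasurable, ?_⟩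
  rw [hasFiniteIntegral_iff_enorm, lintegral_prod _ hm.enorm.aemeasurable]
  simp only [div_eq_mul_inv, enorm_mul]
  refine (lintegral_lintegral_mul_le hg.enorm hk.enorm hR.measurable_enorm hR.one_lt hR.le_two
    hR.conj ((ae_restrict_iff' hΩm).2 (ae_of_all _ hR.left))
    ((ae_restrict_iff' hΩm).2 (ae_of_all _ hR.right))).trans_lt ?_
  exact ENNReal.add_lt_top.2 ⟨ENNReal.mul_lt_top hga.lt_top hka.lt_top,
    ENNReal.mul_lt_top hR.ne_top.lt_top (ENNReal.add_lt_top.2 ⟨hga.lt_top, hka.lt_top⟩)⟩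

lemma tendsto_integral (hR : RieszBound Ω μ a b K) (hΩm : MeasurableSet Ω)
    {g k : ℕ → RN N → ℝ} (hg : ∀ m, Measurable (g m)) (hk : ∀ m, Measurable (k m)) {C : ℝ≥0∞}
    (hC : C ≠ ⊤) (hgC : ∀ m, ∫⁻ x in Ω, ‖g m x‖ₑ ^ a ≤ C)
    (hk0 : Tendsto (fun m => ∫⁻ x in Ω, ‖k m x‖ₑ ^ a) atTop (𝓝 0)) :
    Tendsto (fun m => ∫ x in Ω, ∫ y in Ω, g m x * k m y / dist x y ^ μ x y) atTop (𝓝 0) := by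
  have h1 := tendsto_lintegral_lintegral_mul (ν := volume.restrict Ω) (fun m => (hg m).enorm)
    (fun m => (hk m).enorm) hR.measurable_enorm hR.one_lt hR.le_two hR.conj hR.ne_top hC
    ((ae_restrict_iff' hΩm).2 (ae_of_all _ hR.left))
    ((ae_restrict_iff' hΩm).2 (ae_of_all _ hR.right)) hgC hk0
  rw [tendsto_zero_iff_enorm_tendsto_zero]
  refine tendsto_of_tendsto_of_tendsto_of_le_of_le tendsto_const_nhds h1 (fun _ => zero_le)
    fun m => ?_
  refine (enorm_integral_le_lintegral_enorm _).trans (lintegral_mono fun x => ?_)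
  refine (enorm_integral_le_lintegral_enorm _).trans (lintegral_mono fun y => ?_)
  simp only [div_eq_mul_inv, enorm_mul]
  exact le_rfl

end RieszBound

end Riesz

section Monotonicity

open scoped Topology

lemma rpow_sub_two_mul_mul_self {e : ℝ} (he : 0 < e) (a : ℝ) : |a| ^ (e - 2) * a * a = |a| ^ e := by
  rcases eq_or_ne a 0 with rfl | ha
  · simp [Real.zero_rpow he.ne']
  · have h1 : 0 < |a| := abs_pos.2 ha
    rw [mul_assoc, ← abs_mul_abs_self, ← mul_assoc, ← Real.rpow_add_one h1.ne',
      ← Real.rpow_add_one h1.ne']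
    congr 1; ring

lemma abs_rpow_sub_two_mul {e : ℝ} (a : ℝ) (ha : a ≠ 0) : |a| ^ (e - 2) * |a| = |a| ^ (e - 1) := by
  rw [← Real.rpow_add_one (abs_pos.2 ha).ne']
  congr 1; ring

/-- Young's inequality for the duality map of a power. -/
lemma abs_rpow_sub_two_mul_mul_le {e : ℝ} (he : 1 < e) (a b : ℝ) :
    |(|a| ^ (e - 2) * a * b)| ≤ (1 - 1 / e) * |a| ^ e + 1 / e * |b| ^ e := by
  have he0 : 0 < e := by linarith
  have h0 : 0 ≤ 1 - 1 / e := by rw [sub_nonneg, div_le_iff₀ he0]; linarith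
  rcases eq_or_ne a 0 with rfl | ha
  · simp only [mul_zero, zero_mul, abs_zero]
    positivity
  · rw [abs_mul, abs_mul, abs_of_nonneg (a := |a| ^ (e - 2)) (by positivity),
      abs_rpow_sub_two_mul a ha]
    have h1 := Real.geom_mean_le_arith_mean2_weighted h0 (by positivity : 0 ≤ 1 / e)
      (by positivity : 0 ≤ |a| ^ e) (by positivity : 0 ≤ |b| ^ e) (by ring)
    rw [← Real.rpow_mul (abs_nonneg _), ← Real.rpow_mul (abs_nonneg _),
      mul_one_div_cancel he0.ne', Real.rpow_one] at h1
    convert h1 using 3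
    field_simp

lemma rpow_sub_rpow_div_le {e : ℝ} (he : 1 < e) (a b : ℝ) :
    |a| ^ e / e - |b| ^ e / e ≤ |a| ^ (e - 2) * a * (a - b) := by
  have h1 := (le_abs_self _).trans (abs_rpow_sub_two_mul_mul_le he a b)
  rw [mul_sub, rpow_sub_two_mul_mul_self (by linarith)]
  have h2 : (1 - 1 / e) * |a| ^ e + 1 / e * |b| ^ e =
    |a| ^ e - (|a| ^ e / e - |b| ^ e / e) := by ring
  linarith

/-- Density of the convex potential whose derivative is `energyLHS`. -/
def gagPotential (s p : RN N → RN N → ℝ) (u : RN N → ℝ) (z : RN N × RN N) : ℝ :=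
  gagDensity s p u z / p z.1 z.2

variable {s p : RN N → RN N → ℝ} {s₀ p₀ P : ℝ}

lemma gagPotential_nonneg (h : Exponents s p s₀ p₀ P) (u : RN N → ℝ) (z : RN N × RN N) :
    0 ≤ gagPotential s p u z :=
  div_nonneg (gagDensity_nonneg s p u z) (h.pos z.1 z.2).le

lemma gagPotential_le (h : Exponents s p s₀ p₀ P) (u : RN N → ℝ) (z : RN N × RN N) :
    gagPotential s p u z ≤ gagDensity s p u z :=
  div_le_self (gagDensity_nonneg s p u z) (h.one_lt z.1 z.2).le

lemma gagDensity_le_mul_gagPotential (h : Exponents s p s₀ p₀ P) (u : RN N → ℝ)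
    (z : RN N × RN N) : gagDensity s p u z ≤ P * gagPotential s p u z := by
  have h1 := h.pos z.1 z.2
  calc gagDensity s p u z = p z.1 z.2 * gagPotential s p u z := by
        unfold gagPotential; field_simp
    _ ≤ _ := mul_le_mul_of_nonneg_right (h.p_le _ _) (gagPotential_nonneg h u z)

lemma measurable_gagPotential (h : Exponents s p s₀ p₀ P) {u : RN N → ℝ} (hu : Measurable u) :
    Measurable (gagPotential s p u) :=
  (measurable_gagDensity h hu).div h.p_cont.measurable

lemma integrable_gagPotential (h : Exponents s p s₀ p₀ P) {u : RN N → ℝ} (hu : Measurable u)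
    (hfin : gagEnergy s p u < ⊤) : Integrable (gagPotential s p u) :=
  (integrable_gagDensity h hu hfin).mono' (measurable_gagPotential h hu).aestronglyMeasurable
    (ae_of_all _ fun z => by
      rw [Real.norm_of_nonneg (gagPotential_nonneg h u z)]
      exact gagPotential_le h u z)

lemma energyLHS_self (h : Exponents s p s₀ p₀ P) (u : RN N → ℝ) :
    energyLHS s p u u = ∫ z, gagDensity s p u z := by
  refine integral_congr_ae (ae_of_all _ fun z => ?_)
  simp only [gagDensity]
  rw [rpow_sub_two_mul_mul_self (h.pos _ _)]

lemma integrable_energy (h : Exponents s p s₀ p₀ P) {u w : RN N → ℝ} (hu : Measurable u)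
    (hw : Measurable w) (hue : gagEnergy s p u < ⊤) (hwe : gagEnergy s p w < ⊤) :
    Integrable fun z : RN N × RN N =>
      |u z.1 - u z.2| ^ (p z.1 z.2 - 2) * (u z.1 - u z.2) * (w z.1 - w z.2) /
        dist z.1 z.2 ^ ((N : ℝ) + s z.1 z.2 * p z.1 z.2) := by
  have h2 := h.p_cont.measurable
  have h3 := measurable_kernel h
  refine ((integrable_gagDensity h hu hue).add (integrable_gagDensity h hw hwe)).mono'
    (Measurable.aestronglyMeasurable (by fun_prop)) (ae_of_all _ fun z => ?_)
  have h1 := h.one_lt z.1 z.2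
  have hd : 0 ≤ dist z.1 z.2 ^ ((N : ℝ) + s z.1 z.2 * p z.1 z.2) := by positivity
  rw [norm_div, Real.norm_of_nonneg hd, Pi.add_apply]
  unfold gagDensity
  rw [← add_div]
  refine div_le_div_of_nonneg_right ?_ hd
  refine (abs_rpow_sub_two_mul_mul_le h1 _ _).trans (add_le_add ?_ ?_)
  · refine mul_le_of_le_one_left (by positivity) ?_
    have : 0 ≤ 1 / p z.1 z.2 := by positivity
    linarith
  · refine mul_le_of_le_one_left (by positivity) ?_
    rw [div_le_one (by linarith)]; exact h1.le

lemma integral_gagPotential_sub_le (h : Exponents s p s₀ p₀ P) {u v : RN N → ℝ}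
    (hu : Measurable u) (hv : Measurable v) (hue : gagEnergy s p u < ⊤)
    (hve : gagEnergy s p v < ⊤) :
    (∫ z, gagPotential s p u z) - ∫ z, gagPotential s p v z ≤
      energyLHS s p u (fun x => u x - v x) := by
  rw [← integral_sub (integrable_gagPotential h hu hue) (integrable_gagPotential h hv hve)]
  have hwe : gagEnergy s p (fun x => u x - v x) < ⊤ :=
    (gagEnergy_sub_le h hu).trans_lt
      (ENNReal.mul_lt_top ENNReal.ofReal_lt_top (ENNReal.add_lt_top.2 ⟨hue, hve⟩))
  refine integral_mono ((integrable_gagPotential h hu hue).sub (integrable_gagPotential h hv hve))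
    (integrable_energy h hu (hu.sub hv) hue hwe) fun z => ?_
  have h1 := rpow_sub_rpow_div_le (h.one_lt z.1 z.2) (u z.1 - u z.2) (v z.1 - v z.2)
  have hd : 0 ≤ dist z.1 z.2 ^ ((N : ℝ) + s z.1 z.2 * p z.1 z.2) := by positivity
  have h2 := div_le_div_of_nonneg_right h1 hd
  have e1 : u z.1 - v z.1 - (u z.2 - v z.2) = u z.1 - u z.2 - (v z.1 - v z.2) := by ring
  simp only [e1]
  refine le_of_eq_of_le ?_ h2
  simp only [gagPotential, gagDensity]
  rw [sub_div, div_right_comm, div_right_comm (|v z.1 - v z.2| ^ p z.1 z.2)]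

lemma tendsto_gagPotential (h : Exponents s p s₀ p₀ P) {u : ℕ → RN N → ℝ} {v : RN N → ℝ}
    (hu : ∀ᵐ x, Tendsto (fun k => u k x) atTop (𝓝 (v x))) :
    ∀ᵐ z : RN N × RN N, Tendsto (fun k => gagPotential s p (u k) z) atTop
      (𝓝 (gagPotential s p v z)) := by
  have h1 := (Measure.quasiMeasurePreserving_fst
    (μ := (volume : Measure (RN N))) (ν := (volume : Measure (RN N)))).ae hu
  have h2 := (Measure.quasiMeasurePreserving_snd
    (μ := (volume : Measure (RN N))) (ν := (volume : Measure (RN N)))).ae hu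
  rw [Measure.volume_eq_prod]
  filter_upwards [h1, h2] with z hz1 hz2
  unfold gagPotential gagDensity
  exact (((hz1.sub hz2).abs.rpow_const (Or.inr (h.pos _ _).le)).div_const _).div_const _

/-- Fatou's lemma for the Gagliardo modular. -/
lemma gagEnergy_le_of_tendsto (h : Exponents s p s₀ p₀ P) {u : ℕ → RN N → ℝ} {v : RN N → ℝ}
    (hum : ∀ k, Measurable (u k)) {R : ℝ≥0∞} (huR : ∀ k, gagEnergy s p (u k) ≤ R)
    (hu : ∀ᵐ x, Tendsto (fun k => u k x) atTop (𝓝 (v x))) : gagEnergy s p v ≤ R := by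
  calc gagEnergy s p v
      = ∫⁻ z, liminf (fun k => ENNReal.ofReal (gagDensity s p (u k) z)) atTop := by
        refine lintegral_congr_ae ?_
        filter_upwards [tendsto_gagPotential h hu] with z hz
        have h1 := hz.mul_const (p z.1 z.2)
        have h2 : ∀ w : RN N → ℝ, gagPotential s p w z * p z.1 z.2 = gagDensity s p w z :=
          fun w => div_mul_cancel₀ _ (h.pos _ _).ne'
        simp only [h2] at h1
        exact (ENNReal.tendsto_ofReal h1).liminf_eq.symm
    _ ≤ liminf (fun k => gagEnergy s p (u k)) atTop :=
        lintegral_liminf_le fun k => (measurable_gagDensity h (hum k)).ennreal_ofReal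
    _ ≤ R := by
        refine (liminf_le_liminf (v := fun _ => R) (Eventually.of_forall huR)).trans ?_
        simp

/-- The `(S₊)` property of the principal part. -/
lemma tendsto_gagEnergy_sub (h : Exponents s p s₀ p₀ P) {u : ℕ → RN N → ℝ} {v : RN N → ℝ}
    (hum : ∀ k, Measurable (u k)) (hvm : Measurable v) (hue : ∀ k, gagEnergy s p (u k) < ⊤)
    (hve : gagEnergy s p v < ⊤) (hu : ∀ᵐ x, Tendsto (fun k => u k x) atTop (𝓝 (v x)))
    (hE : Tendsto (fun k => energyLHS s p (u k) (fun x => u k x - v x)) atTop (𝓝 0)) :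
    Tendsto (fun k => gagEnergy s p (fun x => u k x - v x)) atTop (𝓝 0) := by
  set w : ℕ → RN N → ℝ := fun k x => (u k x - v x) / 2 with hw
  have hwm : ∀ k, Measurable (w k) := fun k => ((hum k).sub hvm).div_const 2
  have hwle : ∀ k z, gagPotential s p (w k) z ≤
      (gagPotential s p (u k) z + gagPotential s p v z) / 2 := fun k z => by
    have h1 := div_le_div_of_nonneg_right (gagDensity_half_sub_le h (u k) v z) (h.pos z.1 z.2).le
    unfold gagPotential
    refine h1.trans (le_of_eq ?_)
    ring
  have hiu : ∀ k, Integrable (gagPotential s p (u k)) := fun k =>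
    integrable_gagPotential h (hum k) (hue k)
  have hiv := integrable_gagPotential h hvm hve
  have hiuv : ∀ k, Integrable fun z => (gagPotential s p (u k) z + gagPotential s p v z) / 2 :=
    fun k => ((hiu k).add hiv).div_const 2
  have hiw : ∀ k, Integrable (gagPotential s p (w k)) := fun k =>
    (hiuv k).mono' (measurable_gagPotential h (hwm k)).aestronglyMeasurable
      (ae_of_all _ fun z => by
        rw [Real.norm_of_nonneg (gagPotential_nonneg h _ z)]
        exact hwle k z)
  set g : ℕ → RN N × RN N → ℝ := fun k z =>
    (gagPotential s p (u k) z + gagPotential s p v z) / 2 - gagPotential s p (w k) z with hg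
  have hg0 : ∀ k z, 0 ≤ g k z := fun k z => sub_nonneg.2 (hwle k z)
  have hgi : ∀ k, ∫ z, g k z = ((∫ z, gagPotential s p (u k) z) + ∫ z, gagPotential s p v z) / 2 -
      ∫ z, gagPotential s p (w k) z := fun k => by
    rw [hg]
    simp only
    rw [integral_sub (hiuv k) (hiw k), integral_div, integral_add (hiu k) hiv]
  have hglim : ∀ᵐ z, Tendsto (fun k => g k z) atTop (𝓝 (gagPotential s p v z)) := by
    have hw0 : ∀ᵐ x, Tendsto (fun k => w k x) atTop (𝓝 ((fun _ => (0 : ℝ)) x)) := by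
      filter_upwards [hu] with x hx
      have := (hx.sub_const (v x)).div_const 2
      simpa using this
    filter_upwards [tendsto_gagPotential h hu, tendsto_gagPotential h hw0] with z h1 h2
    have h3 := ((h1.add_const (gagPotential s p v z)).div_const 2).sub h2
    convert h3 using 2
    simp [gagPotential, gagDensity, Real.zero_rpow (h.pos _ _).ne']
  have hfatou : ENNReal.ofReal (∫ z, gagPotential s p v z) ≤
      liminf (fun k => ENNReal.ofReal (∫ z, g k z)) atTop := by
    have hm : ∀ k, Measurable fun z => ENNReal.ofReal (g k z) := fun k =>
      ((((measurable_gagPotential h (hum k)).add (measurable_gagPotential h hvm)).div_const 2).sub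
        (measurable_gagPotential h (hwm k))).ennreal_ofReal
    have h1 : ∀ k, ENNReal.ofReal (∫ z, g k z) = ∫⁻ z, ENNReal.ofReal (g k z) := fun k =>
      ofReal_integral_eq_lintegral_ofReal ((hiuv k).sub (hiw k)) (ae_of_all _ (hg0 k))
    simp_rw [h1]
    rw [ofReal_integral_eq_lintegral_ofReal hiv (ae_of_all _ (gagPotential_nonneg h v))]
    refine le_of_eq_of_le (lintegral_congr_ae ?_) (lintegral_liminf_le hm)
    filter_upwards [hglim] with z hz
    exact (ENNReal.tendsto_ofReal hz).liminf_eq.symm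
  have hwlim : Tendsto (fun k => ∫ z, gagPotential s p (w k) z) atTop (𝓝 0) := by
    rw [Metric.tendsto_atTop]
    intro δ hδ
    have hev : ∀ᶠ k in atTop, (∫ z, gagPotential s p v z) - δ / 2 < ∫ z, g k z := by
      rcases lt_or_ge ((∫ z, gagPotential s p v z) - δ / 2) 0 with hneg | hpos
      · exact Eventually.of_forall fun k => hneg.trans_le (integral_nonneg (hg0 k))
      · have h1 : ENNReal.ofReal ((∫ z, gagPotential s p v z) - δ / 2) <
            liminf (fun k => ENNReal.ofReal (∫ z, g k z)) atTop :=
          ((ENNReal.ofReal_lt_ofReal_iff (by linarith)).2 (by linarith)).trans_le hfatou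
        filter_upwards [eventually_lt_of_lt_liminf h1] with k hk
        exact (ENNReal.ofReal_lt_ofReal_iff_of_nonneg hpos).1 hk
    have hE' := hE.eventually (gt_mem_nhds (half_pos hδ))
    obtain ⟨n, hn⟩ := eventually_atTop.1 (hev.and hE')
    refine ⟨n, fun k hk => ?_⟩
    obtain ⟨h1, h2⟩ := hn k hk
    have h3 := integral_gagPotential_sub_le h (hum k) hvm (hue k) hve
    rw [hgi] at h1
    have h4 : 0 ≤ ∫ z, gagPotential s p (w k) z := integral_nonneg (gagPotential_nonneg h _)
    rw [Real.dist_0_eq_abs, abs_of_nonneg h4]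
    linarith
  have hbd : ∀ k, gagEnergy s p (fun x => u k x - v x) ≤
      ENNReal.ofReal (2 ^ P * P * ∫ z, gagPotential s p (w k) z) := fun k => by
    have hP := h.one_lt_sup
    rw [← integral_const_mul, ofReal_integral_eq_lintegral_ofReal ((hiw k).const_mul _)
      (ae_of_all _ fun z => mul_nonneg (by positivity) (gagPotential_nonneg h _ z))]
    refine lintegral_mono fun z => ENNReal.ofReal_le_ofReal ?_
    have h2 := gagDensity_mul s p (w k) (l := 2) (by norm_num) z
    have h3 : (fun x => 2 * w k x) = fun x => u k x - v x := by ext x; rw [hw]; ring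
    rw [h3] at h2
    rw [h2, mul_assoc]
    exact mul_le_mul (Real.rpow_le_rpow_of_exponent_le (by norm_num) (h.p_le _ _))
      (gagDensity_le_mul_gagPotential h _ z) (gagDensity_nonneg _ _ _ _) (by positivity)
  refine tendsto_of_tendsto_of_tendsto_of_le_of_le tendsto_const_nhds ?_ (fun _ => zero_le) hbd
  have h1 := ENNReal.tendsto_ofReal (hwlim.const_mul (2 ^ P * P))
  simpa using h1

end Monotonicity

section PalaisSmale

open scoped Topology

lemma energyLHS_div (s p : RN N → RN N → ℝ) (u w : RN N → ℝ) (l : ℝ) :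
    energyLHS s p u (fun x => w x / l) = energyLHS s p u w / l := by
  unfold energyLHS
  rw [← integral_div]
  refine integral_congr_ae (ae_of_all _ fun z => ?_)
  simp only
  ring

lemma choquardRHS_div (Ω : Set (RN N)) (μ : RN N → RN N → ℝ) (f : RN N → ℝ → ℝ)
    (u w : RN N → ℝ) (l : ℝ) :
    choquardRHS Ω μ f u (fun x => w x / l) = choquardRHS Ω μ f u w / l := by
  unfold choquardRHS
  simp_rw [← integral_div]
  refine integral_congr_ae (ae_of_all _ fun x => integral_congr_ae (ae_of_all _ fun y => ?_))
  simp only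
  ring

lemma Jderiv_div (Ω : Set (RN N)) (s p μ : RN N → RN N → ℝ) (f : RN N → ℝ → ℝ)
    (u w : RN N → ℝ) (l : ℝ) :
    Jderiv Ω s p μ f u (fun x => w x / l) = Jderiv Ω s p μ f u w / l := by
  unfold Jderiv
  rw [energyLHS_div, choquardRHS_div, sub_div]

lemma rpow_le_one_add_rpow (t : ℝ≥0∞) {a A : ℝ} (ha : 0 ≤ a) (haA : a ≤ A) :
    t ^ a ≤ 1 + t ^ A := by
  rcases le_total t 1 with ht | ht
  · exact (ENNReal.rpow_le_one ht ha).trans le_self_add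
  · exact (ENNReal.rpow_le_rpow_of_exponent_le ht haA).trans le_add_self

lemma choquardRHS_eq (Ω : Set (RN N)) (μ : RN N → RN N → ℝ) (f : RN N → ℝ → ℝ)
    (u w : RN N → ℝ) :
    choquardRHS Ω μ f u w =
      ∫ x in Ω, ∫ y in Ω, Fant f x (u x) * (f y (u y) * w y) / dist x y ^ μ x y := by
  simp only [choquardRHS, mul_assoc]

/-- The data shared by the estimates on Palais-Smale sequences: the nonlinearity is subcritical
with respect to the Riesz kernel, and finite-energy functions have the matching integrability. -/
structure ChoquardData (Ω : Set (RN N)) (s p μ : RN N → RN N → ℝ) (f : RN N → ℝ → ℝ) (M : ℝ)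
    (r : RN N → ℝ) (s₀ p₀ P a b A : ℝ) (K : ℝ≥0∞) : Prop where
  exps : Exponents s p s₀ p₀ P
  bdd : Bornology.IsBounded Ω
  meas : MeasurableSet Ω
  riesz : RieszBound Ω μ a b K
  lt : a < A
  cara : Caratheodory f
  growth : F1 Ω f M r
  one_lt_r : ∀ x ∈ Ω, 1 < r x
  meas_r : Measurable r
  p_le : ∀ x, p x x ≤ A * r x
  embed : ∀ R : ℝ≥0∞, R ≠ ⊤ → ∃ C : ℝ≥0∞, C ≠ ⊤ ∧ ∀ u : RN N → ℝ, Measurable u →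
    (∀ᵐ x, x ∉ Ω → u x = 0) → gagEnergy s p u ≤ R → ∫⁻ x in Ω, ‖u x‖ₑ ^ (A * r x) ≤ C

namespace ChoquardData

variable {Ω : Set (RN N)} {s p μ : RN N → RN N → ℝ} {f : RN N → ℝ → ℝ} {M : ℝ} {r : RN N → ℝ}
  {s₀ p₀ P a b A : ℝ} {K : ℝ≥0∞} (D : ChoquardData Ω s p μ f M r s₀ p₀ P a b A K)
include D

lemma a_pos : 0 < a := zero_lt_one.trans D.riesz.one_lt

lemma A_pos : 0 < A := D.a_pos.trans D.lt

lemma embed_lt_top {u : RN N → ℝ} (hu : Measurable u) (hu0 : ∀ᵐ x, x ∉ Ω → u x = 0)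
    (hue : gagEnergy s p u < ⊤) : ∫⁻ x in Ω, ‖u x‖ₑ ^ (A * r x) < ⊤ := by
  obtain ⟨C, hC, h1⟩ := D.embed _ hue.ne
  exact (h1 u hu hu0 le_rfl).trans_lt hC.lt_top

lemma lintegral_le_add {e e' : RN N → ℝ} (he : ∀ x ∈ Ω, 0 ≤ e x) (hee : ∀ x ∈ Ω, e x ≤ e' x)
    (g : RN N → ℝ≥0∞) :
    ∫⁻ x in Ω, g x ^ e x ≤ volume Ω + ∫⁻ x in Ω, g x ^ e' x := by
  rw [← setLIntegral_one, ← lintegral_add_left measurable_const]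
  exact setLIntegral_mono' D.meas fun x hx => rpow_le_one_add_rpow _ (he x hx) (hee x hx)

lemma memX0 {u : RN N → ℝ} (hu : Measurable u) (hu0 : ∀ᵐ x, x ∉ Ω → u x = 0)
    (hue : gagEnergy s p u < ⊤) : MemX0 Ω s p (fun x => p x x) u :=
  memX0_of_gagEnergy_lt_top D.exps D.meas hu hu0 hue <|
    (D.lintegral_le_add (fun x _ => (D.exps.pos x x).le) (fun x _ => D.p_le x) _).trans_lt
      (ENNReal.add_lt_top.2 ⟨D.bdd.measure_lt_top, D.embed_lt_top hu hu0 hue⟩)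

lemma lintegral_Fant_le {u : RN N → ℝ} {C : ℝ≥0∞} (hu : ∫⁻ x in Ω, ‖u x‖ₑ ^ (A * r x) ≤ C) :
    ∫⁻ x in Ω, ‖Fant f x (u x)‖ₑ ^ a ≤ volume Ω + ENNReal.ofReal M ^ A * C :=
  (D.lintegral_le_add (fun _ _ => D.a_pos.le) (fun _ _ => D.lt.le) _).trans
    (add_le_add le_rfl (D.growth.lintegral_Fant_le D.meas D.one_lt_r D.A_pos u hu))

lemma lintegral_mul_le {u w : RN N → ℝ} (hum : Measurable u) {C C' : ℝ≥0∞}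
    (hu : ∫⁻ x in Ω, ‖u x‖ₑ ^ (A * r x) ≤ C) (hw : ∫⁻ x in Ω, ‖w x‖ₑ ^ (A * r x) ≤ C') :
    ∫⁻ x in Ω, ‖f x (u x) * w x‖ₑ ^ A ≤ ENNReal.ofReal M ^ A * (C + C') :=
  D.growth.lintegral_mul_le D.meas D.one_lt_r D.meas_r D.A_pos hum w hu hw

lemma rpow_M_ne_top : ENNReal.ofReal M ^ A ≠ ⊤ :=
  ENNReal.rpow_ne_top_of_nonneg D.A_pos.le ENNReal.ofReal_ne_top

lemma bound_ne_top {C : ℝ≥0∞} (hC : C ≠ ⊤) : volume Ω + ENNReal.ofReal M ^ A * C ≠ ⊤ :=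
  ENNReal.add_ne_top.2 ⟨D.bdd.measure_lt_top.ne, ENNReal.mul_ne_top D.rpow_M_ne_top hC⟩

/-- The Choquard term is continuous along bounded sequences converging almost everywhere. -/
lemma tendsto_choquardRHS {u : ℕ → RN N → ℝ} {v : RN N → ℝ} (hum : ∀ k, Measurable (u k))
    (hvm : Measurable v) {C C' : ℝ≥0∞} (hC : C ≠ ⊤) (hC' : C' ≠ ⊤)
    (huC : ∀ k, ∫⁻ x in Ω, ‖u k x‖ₑ ^ (A * r x) ≤ C)
    (hwC : ∀ k, ∫⁻ x in Ω, ‖u k x - v x‖ₑ ^ (A * r x) ≤ C')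
    (hu : ∀ᵐ x, Tendsto (fun k => u k x) atTop (𝓝 (v x))) :
    Tendsto (fun k => choquardRHS Ω μ f (u k) (fun x => u k x - v x)) atTop (𝓝 0) := by
  simp_rw [choquardRHS_eq]
  have : IsFiniteMeasure (volume.restrict Ω) := ⟨by simpa using D.bdd.measure_lt_top⟩
  have hkm : ∀ k, Measurable fun x => f x (u k x) * (u k x - v x) := fun k =>
    (D.cara.measurable_comp (hum k)).mul ((hum k).sub hvm)
  refine D.riesz.tendsto_integral D.meas (fun k => D.cara.measurable_Fant_comp (hum k)) hkm
    (D.bound_ne_top hC) (fun k => D.lintegral_Fant_le (huC k)) ?_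
  refine tendsto_lintegral_rpow_zero (fun k => (hkm k).enorm) (ae_restrict_of_ae ?_) D.a_pos D.lt
    (ENNReal.mul_ne_top D.rpow_M_ne_top (ENNReal.add_ne_top.2 ⟨hC, hC'⟩))
    fun k => D.lintegral_mul_le (hum k) (huC k) (hwC k)
  filter_upwards [hu] with x hx
  have h1 := (((D.cara.2 x).tendsto (v x)).comp hx).mul (hx.sub_const (v x))
  rw [sub_self, mul_zero] at h1
  exact tendsto_zero_iff_enorm_tendsto_zero.1 h1

lemma half_integral_Fant_le {Θ : ℝ} (hΘ : 0 < Θ) (hf2 : F2 Ω f Θ) {u : RN N → ℝ}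
    (hum : Measurable u) (hu : ∫⁻ x in Ω, ‖u x‖ₑ ^ (A * r x) < ⊤) :
    1 / 2 * ∫ x in Ω, ∫ y in Ω, Fant f x (u x) * Fant f y (u y) / dist x y ^ μ x y ≤
      1 / Θ * choquardRHS Ω μ f u u := by
  have hFm := D.cara.measurable_Fant_comp hum
  have hfm : Measurable fun x => f x (u x) * u x := (D.cara.measurable_comp hum).mul hum
  have hFa : ∫⁻ x in Ω, ‖Fant f x (u x)‖ₑ ^ a ≠ ⊤ :=
    ((D.lintegral_Fant_le le_rfl).trans_lt (D.bound_ne_top hu.ne).lt_top).ne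
  have hfa : ∫⁻ x in Ω, ‖f x (u x) * u x‖ₑ ^ a ≠ ⊤ :=
    ((D.lintegral_le_add (fun _ _ => D.a_pos.le) (fun _ _ => D.lt.le) _).trans_lt
      (ENNReal.add_lt_top.2 ⟨D.bdd.measure_lt_top,
        (D.lintegral_mul_le hum le_rfl le_rfl).trans_lt
          (ENNReal.mul_lt_top D.rpow_M_ne_top.lt_top (ENNReal.add_lt_top.2 ⟨hu, hu⟩))⟩)).ne
  have hi1 := D.riesz.integrable D.meas hFm hFm hFa hFa
  have hi2 := D.riesz.integrable D.meas hFm hfm hFa hfa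
  have hpos : ∀ᵐ x ∂volume.restrict Ω, 0 ≤ Fant f x (u x) ∧
      Θ * Fant f x (u x) ≤ 2 * (f x (u x) * u x) := by
    rw [ae_restrict_iff' D.meas]
    filter_upwards [hf2] with x hx hxΩ
    rcases eq_or_ne (u x) 0 with h0 | h0
    · rw [h0]; simp [Fant]
    · obtain ⟨h1, h2⟩ := hx hxΩ _ h0
      exact ⟨(pos_of_mul_pos_right h1 hΘ.le).le, by rwa [mul_comm (f x _)]⟩
  rw [choquardRHS_eq,
    integral_integral (f := fun x y => Fant f x (u x) * Fant f y (u y) / dist x y ^ μ x y) hi1,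
    integral_integral (f := fun x y => Fant f x (u x) * (f y (u y) * u y) / dist x y ^ μ x y) hi2,
    ← integral_const_mul, ← integral_const_mul]
  refine integral_mono_ae (hi1.const_mul _) (hi2.const_mul _) ?_
  filter_upwards [Measure.quasiMeasurePreserving_fst.ae hpos,
    Measure.quasiMeasurePreserving_snd.ae hpos] with z h1 h2
  have hd : 0 ≤ dist z.1 z.2 ^ μ z.1 z.2 := by positivity
  rw [← mul_div_assoc, ← mul_div_assoc]
  refine div_le_div_of_nonneg_right ?_ hd
  have h3 : 1 / 2 * Fant f z.2 (u z.2) ≤ 1 / Θ * (f z.2 (u z.2) * u z.2) := by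
    rw [one_div_mul_eq_div, one_div_mul_eq_div, div_le_div_iff₀ two_pos hΘ]
    linarith [h2.2]
  calc 1 / 2 * (Fant f z.1 (u z.1) * Fant f z.2 (u z.2))
      = Fant f z.1 (u z.1) * (1 / 2 * Fant f z.2 (u z.2)) := by ring
    _ ≤ Fant f z.1 (u z.1) * (1 / Θ * (f z.2 (u z.2) * u z.2)) :=
        mul_le_mul_of_nonneg_left h3 h1.1
    _ = _ := by ring

lemma mul_energy_le {Θ : ℝ} (hΘ : P < Θ) (hf2 : F2 Ω f Θ) {u : RN N → ℝ} (hum : Measurable u)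
    (hu0 : ∀ᵐ x, x ∉ Ω → u x = 0) (hue : gagEnergy s p u < ⊤) :
    (1 / P - 1 / Θ) * (gagEnergy s p u).toReal ≤
      Jfun Ω s p μ f u - 1 / Θ * Jderiv Ω s p μ f u u := by
  have hP := D.exps.one_lt_sup
  have h1 := D.half_integral_Fant_le (by linarith) hf2 hum (D.embed_lt_top hum hu0 hue)
  have h2 : 1 / P * ∫ z, gagDensity s p u z ≤ ∫ z, gagPotential s p u z := by
    rw [← integral_const_mul]
    refine integral_mono ((integrable_gagDensity D.exps hum hue).const_mul _)
      (integrable_gagPotential D.exps hum hue) fun z => ?_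
    simp only
    rw [one_div_mul_eq_div, div_le_iff₀ (by linarith), mul_comm]
    exact gagDensity_le_mul_gagPotential D.exps u z
  have h3 : Jfun Ω s p μ f u = (∫ z, gagPotential s p u z) - (1 / 2) * ∫ x in Ω, ∫ y in Ω,
      Fant f x (u x) * Fant f y (u y) / dist x y ^ μ x y := by
    unfold Jfun gagPotential gagDensity
    simp only [div_div, mul_comm]
  rw [h3, Jderiv, energyLHS_self D.exps, ← integral_gagDensity D.exps hum, sub_mul, mul_sub]
  linarith

/-- Palais-Smale sequences have eventually bounded energy. -/
lemma exists_gagEnergy_le {Θ : ℝ} (hΘ : P < Θ) (hf2 : F2 Ω f Θ) {c : ℝ} {u : ℕ → RN N → ℝ}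
    (hum : ∀ m, Measurable (u m)) (hu0 : ∀ m, ∀ᵐ x, x ∉ Ω → u m x = 0)
    (hue : ∀ m, gagEnergy s p (u m) < ⊤)
    (hJ : Tendsto (fun m => Jfun Ω s p μ f (u m)) atTop (𝓝 c))
    (hJ' : ∀ ε : ℝ, 0 < ε → ∃ M₀ : ℕ, ∀ m : ℕ, M₀ ≤ m →
      ∀ w : RN N → ℝ, MemX0 Ω s p (fun x => p x x) w → x0Norm s p w ≤ 1 →
        |Jderiv Ω s p μ f (u m) w| ≤ ε) :
    ∃ R : ℝ≥0∞, R ≠ ⊤ ∧ ∃ n : ℕ, ∀ m, n ≤ m → gagEnergy s p (u m) ≤ R := by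
  have hP := D.exps.one_lt_sup
  have hΘ0 : 0 < Θ := by linarith
  set δ := 1 / P - 1 / Θ with hδ
  have hδ0 : 0 < δ := by
    rw [hδ, sub_pos]
    exact one_div_lt_one_div_of_lt (by linarith) hΘ
  obtain ⟨n₁, hn₁⟩ := hJ' (Θ * δ / 2) (by positivity)
  obtain ⟨n₂, hn₂⟩ := eventually_atTop.1 (hJ.eventually (gt_mem_nhds (lt_add_one c)))
  refine ⟨ENNReal.ofReal ((c + 1 + δ / 2) * (2 / δ)), ENNReal.ofReal_ne_top, max n₁ n₂,
    fun m hm => ?_⟩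
  set ρ := (gagEnergy s p (u m)).toReal with hρ
  have hρ0 : 0 ≤ ρ := ENNReal.toReal_nonneg
  have hρe : gagEnergy s p (u m) = ENNReal.ofReal ρ := (ENNReal.ofReal_toReal (hue m).ne).symm
  have h1 := D.mul_energy_le hΘ hf2 (hum m) (hu0 m) (hue m)
  have hwe : gagEnergy s p (fun x => u m x / (1 + ρ)) < ⊤ := by
    have := gagEnergy_mul_lt_top D.exps (l := (1 + ρ)⁻¹) (by positivity) (hue m)
    simpa only [div_eq_inv_mul] using this
  have h2 := hn₁ m ((le_max_left _ _).trans hm) (fun x => u m x / (1 + ρ))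
    (D.memX0 ((hum m).div_const _) (by
      filter_upwards [hu0 m] with x hx hxΩ
      rw [hx hxΩ, zero_div]) hwe)
    (x0Norm_div_le_one D.exps (by linarith) (by
      rw [hρe]
      exact (ENNReal.ofReal_lt_ofReal_iff (by linarith)).2 (by linarith)))
  rw [Jderiv_div, abs_div, abs_of_pos (by linarith : 0 < 1 + ρ), div_le_iff₀ (by linarith)] at h2
  have h3 := hn₂ m ((le_max_right _ _).trans hm)
  have h4 : -(1 / Θ * Jderiv Ω s p μ f (u m) (u m)) ≤ δ / 2 * (1 + ρ) := by
    rw [← mul_neg, one_div_mul_eq_div, div_le_iff₀ hΘ0]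
    refine (neg_le_abs _).trans (h2.trans (le_of_eq ?_))
    ring
  rw [hρe]
  refine ENNReal.ofReal_le_ofReal ?_
  rw [mul_div_assoc', le_div_iff₀ hδ0]
  linarith

/-- The Palais-Smale condition for the Choquard functional. -/
lemma palaisSmale (hN : 2 ≤ N) {Θ : ℝ} (hΘ : P < Θ) (hf2 : F2 Ω f Θ) {c : ℝ}
    {u : ℕ → RN N → ℝ} (hum : ∀ m, Measurable (u m)) (hu0 : ∀ m, ∀ᵐ x, x ∉ Ω → u m x = 0)
    (hue : ∀ m, gagEnergy s p (u m) < ⊤)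
    (hJ : Tendsto (fun m => Jfun Ω s p μ f (u m)) atTop (𝓝 c))
    (hJ' : ∀ ε : ℝ, 0 < ε → ∃ M₀ : ℕ, ∀ m : ℕ, M₀ ≤ m →
      ∀ w : RN N → ℝ, MemX0 Ω s p (fun x => p x x) w → x0Norm s p w ≤ 1 →
        |Jderiv Ω s p μ f (u m) w| ≤ ε) :
    ∃ φ : ℕ → ℕ, StrictMono φ ∧ ∃ v : RN N → ℝ, MemX0 Ω s p (fun x => p x x) v ∧
      Tendsto (fun k => x0Norm s p (fun x => u (φ k) x - v x)) atTop (𝓝 0) := by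
  obtain ⟨R, hR, n, hn⟩ := D.exists_gagEnergy_le hΘ hf2 hum hu0 hue hJ hJ'
  obtain ⟨ψ, hψ, v, hvm, hv0, hlim⟩ := exists_subseq_ae_tendsto D.exps hN D.bdd D.meas hR
    (fun m => hum (m + n)) (fun m => hu0 (m + n)) fun m => hn _ (Nat.le_add_left n m)
  have hvR : gagEnergy s p v ≤ R := gagEnergy_le_of_tendsto D.exps (fun k => hum (ψ k + n))
    (fun k => hn _ (Nat.le_add_left n _)) hlim
  have hve := hvR.trans_lt hR.lt_top
  have hφ : StrictMono fun k => ψ k + n := fun _ _ hkl => Nat.add_lt_add_right (hψ hkl) n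
  refine ⟨fun k => ψ k + n, hφ, v, D.memX0 hvm (ae_of_all _ hv0) hve,
    tendsto_x0Norm D.exps (tendsto_gagEnergy_sub D.exps (fun k => hum (ψ k + n)) hvm
      (fun k => hue _) hve hlim ?_)⟩
  set R' := ENNReal.ofReal (2 ^ P) * (R + R)
  have hR' : R' ≠ ⊤ := ENNReal.mul_ne_top ENNReal.ofReal_ne_top (ENNReal.add_ne_top.2 ⟨hR, hR⟩)
  have hwm : ∀ k, Measurable fun x => u (ψ k + n) x - v x := fun k => (hum _).sub hvm
  have hw0 : ∀ k, ∀ᵐ x, x ∉ Ω → u (ψ k + n) x - v x = 0 := fun k => by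
    filter_upwards [hu0 (ψ k + n)] with x hx hxΩ
    rw [hx hxΩ, hv0 x hxΩ, sub_zero]
  have hwR : ∀ k, gagEnergy s p (fun x => u (ψ k + n) x - v x) ≤ R' := fun k =>
    (gagEnergy_sub_le D.exps (hum _)).trans
      (mul_le_mul_right (add_le_add (hn _ (Nat.le_add_left n _)) hvR) _)
  obtain ⟨C, hC, hC1⟩ := D.embed R hR
  obtain ⟨C', hC', hC1'⟩ := D.embed R' hR'
  have hcho := D.tendsto_choquardRHS (fun k => hum (ψ k + n)) hvm hC hC'
    (fun k => hC1 _ (hum _) (hu0 _) (hn _ (Nat.le_add_left n _)))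
    (fun k => hC1' _ (hwm k) (hw0 k) (hwR k)) hlim
  have hder : Tendsto (fun k => Jderiv Ω s p μ f (u (ψ k + n)) (fun x => u (ψ k + n) x - v x))
      atTop (𝓝 0) := by
    set l := 1 + R'.toReal with hl
    have hl0 : 0 ≤ R'.toReal := ENNReal.toReal_nonneg
    rw [Metric.tendsto_atTop]
    intro ε hε
    obtain ⟨n₁, hn₁⟩ := hJ' (ε / (2 * l)) (by positivity)
    refine ⟨n₁, fun k hk => ?_⟩
    have hwe := (hwR k).trans_lt hR'.lt_top
    have hwe' : gagEnergy s p (fun x => (u (ψ k + n) x - v x) / l) < ⊤ := by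
      have := gagEnergy_mul_lt_top D.exps (l := l⁻¹) (by positivity) hwe
      simpa only [div_eq_inv_mul] using this
    have h1 := hn₁ (ψ k + n) (hk.trans (hφ.id_le k)) (fun x => (u (ψ k + n) x - v x) / l)
      (D.memX0 ((hwm k).div_const _) (by
        filter_upwards [hw0 k] with x hx hxΩ
        rw [hx hxΩ, zero_div]) hwe')
      (x0Norm_div_le_one D.exps (by linarith) (by
        refine (hwR k).trans_lt ?_
        rw [← ENNReal.ofReal_toReal hR']
        exact (ENNReal.ofReal_lt_ofReal_iff (by linarith)).2 (by linarith)))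
    have hlpos : 0 < l := by linarith
    rw [Jderiv_div, abs_div, abs_of_pos hlpos, div_le_iff₀ hlpos] at h1
    rw [Real.dist_0_eq_abs]
    refine h1.trans_lt ?_
    rw [div_mul_eq_mul_div, div_lt_iff₀ (by positivity)]
    nlinarith
  have := hder.add hcho
  simpa only [Jderiv, sub_add_cancel, add_zero] using this

end ChoquardData

end PalaisSmale

theorem statement13
    {N : ℕ} (hN : 2 ≤ N) (Ω : Set (RN N))
    (hΩo : IsOpen Ω) (hΩb : Bornology.IsBounded Ω) (hΩne : Ω.Nonempty)
    (s p μ q : RN N → RN N → ℝ) (f : RN N → ℝ → ℝ) (M Θ : ℝ) (r : RN N → ℝ)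
    (hs : S1 s) (hp : P1 s p) (hμ : Mu1 μ) (hq : CPlus2 q)
    (hqμ : ∀ x y, 2 / q x y + μ x y / (N : ℝ) = 2)
    (hf : Caratheodory f)
    (hr : CPlusOn univ r) (hrM : MemM s p q r) (hrp : sup2 p < infOn univ r)
    (hf1 : F1 Ω f M r) (hΘ : sup2 p < Θ) (hf2 : F2 Ω f Θ)
    (c : ℝ) (u : ℕ → RN N → ℝ)
    (hmem : ∀ m, MemX0 Ω s p (fun x => p x x) (u m))
    (hJ : Tendsto (fun m => Jfun Ω s p μ f (u m)) atTop (nhds c))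
    (hJ' : ∀ ε : ℝ, 0 < ε → ∃ M₀ : ℕ, ∀ m : ℕ, M₀ ≤ m →
      ∀ w : RN N → ℝ, MemX0 Ω s p (fun x => p x x) w → x0Norm s p w ≤ 1 →
        |Jderiv Ω s p μ f (u m) w| ≤ ε) :
    ∃ φ : ℕ → ℕ, StrictMono φ ∧ ∃ v : RN N → ℝ,
      MemX0 Ω s p (fun x => p x x) v ∧
      Tendsto (fun k => x0Norm s p (fun x => u (φ k) x - v x))
        atTop (nhds 0) := by
  have h := exponents_of_S1_of_P1 hs hp
  have hΩm := hΩo.measurableSet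
  have hq1 : 1 < sup2 q := hq.2.1.trans_le
    ((inf2_le (zero_lt_one.trans hq.2.1) 0 0).trans (le_sup2 hq.2.2 0 0))
  have hr1 : ∀ x, 1 < r x := fun x =>
    hr.2.1.trans_le (infOn_le (zero_lt_one.trans hr.2.1) (mem_univ x))
  have hrc : Continuous r := continuousOn_univ.1 hr.1
  have hpr : ∀ x, p x x ≤ r x * sup2 q := fun x => (hrM x).1.trans (hrM x).2.1
  obtain ⟨A, hA, k₀, σ, π, ε, B, hB, hL⟩ := exists_localExponents h (by omega)
    (le_sup2 hs.2.2.1) hp.2.2 hrc hq1 hpr (fun x => (hrM x).2.2) hΩb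
  obtain ⟨a, b, K, haA, hK⟩ := exists_rieszBound hN hΩb hΩm hμ hq hqμ hA
  have D : ChoquardData Ω s p μ f M r (inf2 s) (inf2 p) (sup2 p) a b A K :=
    { exps := h
      bdd := hΩb
      meas := hΩm
      riesz := hK
      lt := haA
      cara := hf
      growth := hf1
      one_lt_r := fun x _ => hr1 x
      meas_r := hrc.measurable
      p_le := fun x => (hpr x).trans (by nlinarith [hr1 x])
      embed := fun R hR => exists_lintegral_rpow_le h hL hN hΩb hΩm hR hB }
  exact D.palaisSmale hN hΘ hf2 (fun m => (hmem m).1) (fun m => (hmem m).2.2.2)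
    (fun m => (hmem m).gagEnergy_lt_top h hΩm) hJ hJ'

end VarOrderChoquard
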